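/- Let m, n ∈ ℕ, n ≥ 2, let α ≥ 0 and R ∈ (0,∞). Let ν_α be the measure on the open ball B_R ⊆ ℝⁿ with dν_α(x) = |x|^α dx. Let ‖·‖_X̄ and ‖·‖_Ȳ be rearrangement-invariant function norms over (0,1); for measurable v on B_R set ‖v‖_{X(B_R)} := ‖v^*(ω_nR^n t)‖_X̄ (rearrangement with respect to Lebesgue measure) and ‖v‖_{Y(B_R,ν_α)} := ‖v^{*ν_α}(ν_α(B_R) t)‖_Ȳ (rearrangement with respect to ν_α). Then the following are equivalent: (1) there exists C_S > 0 such that for every radially symmetric, m-times weakly differentiable u on B_R: ‖u‖_{Y(B_R,ν_α)} ≤ C_S ( ‖u‖_{X(B_R)} + ‖ |D^m u| ‖_{X(B_R)} ); (2) there exists C_H > 0 such that for every nonnegative measurable f on (0,1): ‖ ∫_{t^{n/(n+α)}}^1 f(s) s^{−1+m/n} ds ‖_Ȳ ≤ C_H ‖f‖_X̄. -/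

import Mathlib

open MeasureTheory Set Filter Topology
open scoped ENNReal NNReal

noncomputable section

/-- The nonincreasing rearrangement of an `ℝ≥0∞`-valued function with respect to `μ`:
`f^*(t) = inf {λ : μ({f > λ}) ≤ t}`. -/
def rearr {α : Type*} [MeasurableSpace α] (μ : Measure α) (f : α → ℝ≥0∞) (t : ℝ) : ℝ≥0∞ :=
  sInf {l : ℝ≥0∞ | μ {x | l < f x} ≤ ENNReal.ofReal t}

/-- A rearrangement-invariant function norm over the measure space `(α, μ)`, acting on
nonnegative (`ℝ≥0∞`-valued) measurable functions. -/
structure RINorm {α : Type*} [MeasurableSpace α] (μ : Measure α) where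
  N : (α → ℝ≥0∞) → ℝ≥0∞
  add_le : ∀ f g : α → ℝ≥0∞, Measurable f → Measurable g →
    N (fun x => f x + g x) ≤ N f + N g
  smul_eq : ∀ (c : ℝ≥0) (f : α → ℝ≥0∞), Measurable f →
    N (fun x => (c : ℝ≥0∞) * f x) = (c : ℝ≥0∞) * N f
  eq_zero_iff : ∀ f : α → ℝ≥0∞, Measurable f → (N f = 0 ↔ f =ᵐ[μ] 0)
  mono : ∀ f g : α → ℝ≥0∞, Measurable f → Measurable g →
    (∀ᵐ x ∂μ, f x ≤ g x) → N f ≤ N g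
  fatou : ∀ (F : ℕ → α → ℝ≥0∞) (f : α → ℝ≥0∞), (∀ k, Measurable (F k)) → Measurable f →
    (∀ᵐ x ∂μ, Monotone fun k => F k x) → (∀ᵐ x ∂μ, (⨆ k, F k x) = f x) →
    (⨆ k, N (F k)) = N f
  indicator_lt_top : ∀ E : Set α, MeasurableSet E → μ E < ∞ →
    N (E.indicator fun _ => 1) < ∞
  exists_integral_le : ∀ E : Set α, MeasurableSet E → μ E < ∞ → ∃ C : ℝ≥0∞, C < ∞ ∧
    ∀ f : α → ℝ≥0∞, Measurable f → (∫⁻ x in E, f x ∂μ) ≤ C * N f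
  rearr_invariant : ∀ f g : α → ℝ≥0∞, Measurable f → Measurable g →
    (∀ l : ℝ≥0∞, μ {x | l < f x} = μ {x | l < g x}) → N f = N g


/-- Lebesgue measure on `(0,1)`. -/
def μU : Measure ℝ := volume.restrict (Set.Ioo (0 : ℝ) 1)

/-- The nonincreasing rearrangement of a real-valued function. -/
def rearrR {α : Type*} [MeasurableSpace α] (μ : Measure α) (u : α → ℝ) (t : ℝ) : ℝ≥0∞ :=
  rearr μ (fun x => ENNReal.ofReal |u x|) t

abbrev Euc (n : ℕ) := EuclideanSpace ℝ (Fin n)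

/-- The `i`-th partial derivative of a function on `ℝⁿ`. -/
def pderiv1 {n : ℕ} (i : Fin n) (φ : Euc n → ℝ) : Euc n → ℝ :=
  fun x => fderiv ℝ φ x (EuclideanSpace.single i 1)

/-- Iterated `i`-th partial derivative. -/
def iterPderiv {n : ℕ} (i : Fin n) : ℕ → (Euc n → ℝ) → Euc n → ℝ
  | 0, φ => φ
  | k + 1, φ => pderiv1 i (iterPderiv i k φ)

/-- The partial derivative `∂^γ φ` for a multi-index `γ`. -/
def multiPderiv {n : ℕ} (γ : Fin n → ℕ) (φ : Euc n → ℝ) : Euc n → ℝ :=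
  (List.finRange n).foldr (fun i ψ => iterPderiv i (γ i) ψ) φ

/-- The degree `|γ|` of a multi-index. -/
def mdeg {n : ℕ} (γ : Fin n → ℕ) : ℕ := ∑ i, γ i

/-- `u` is `m`-times weakly differentiable on the open set `Ω ⊆ ℝⁿ`, with weak
derivatives `Du γ` for all multi-indices `γ` with `|γ| ≤ m`. -/
def HasWeakDerivsOn {n : ℕ} (Ω : Set (Euc n)) (m : ℕ) (u : Euc n → ℝ)
    (Du : (Fin n → ℕ) → Euc n → ℝ) : Prop :=
  LocallyIntegrableOn u Ω volume ∧
  (∀ γ : Fin n → ℕ, mdeg γ ≤ m → LocallyIntegrableOn (Du γ) Ω volume) ∧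
  ∀ γ : Fin n → ℕ, mdeg γ ≤ m → ∀ φ : Euc n → ℝ,
    ContDiff ℝ (⊤ : ℕ∞) φ → HasCompactSupport φ → tsupport φ ⊆ Ω →
    ∫ x in Ω, u x * multiPderiv γ φ x = (-1 : ℝ) ^ mdeg γ * ∫ x in Ω, Du γ x * φ x

/-- The Euclidean length `|D^m u|` of the vector of all weak derivatives of orders
`1, …, m`. -/
def DmLen {n : ℕ} (m : ℕ) (Du : (Fin n → ℕ) → Euc n → ℝ) (x : Euc n) : ℝ :=
  Real.sqrt (∑ g : Fin n → Fin (m + 1),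
    if 1 ≤ mdeg (fun i => (g i : ℕ)) ∧ mdeg (fun i => (g i : ℕ)) ≤ m
      then Du (fun i => (g i : ℕ)) x ^ 2 else 0)

/-- The volume `ω_n` of the unit ball of `ℝⁿ`. -/
def omegaN (n : ℕ) : ℝ := (volume (Metric.ball (0 : Euc n) 1)).toReal

/-- The weighted measure `dν_α(x) = |x|^α dx` on the ball `B_R ⊆ ℝⁿ`. -/
def nuA (n : ℕ) (α R : ℝ) : Measure (Euc n) :=
  (volume.withDensity fun x : Euc n => ENNReal.ofReal (‖x‖ ^ α)).restrict
    (Metric.ball (0 : Euc n) R)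


lemma lt_rearr_iff {E : Type*} [MeasurableSpace E] (μ : Measure E) (g : E → ℝ≥0∞) (t : ℝ)
    (l : ℝ≥0∞) : l < rearr μ g t ↔ ENNReal.ofReal t < μ {x | l < g x} := by
  constructor
  · intro h
    by_contra hc
    have : rearr μ g t ≤ l := sInf_le (not_lt.1 hc)
    exact absurd h (not_lt.2 this)
  · intro h
    by_contra hc
    rw [not_lt] at hc
    have hl : l ≠ ∞ := by
      rintro rfl
      simp at h
    obtain ⟨v, hv, hvl, hvt⟩ := exists_seq_strictAnti_tendsto' (lt_top_iff_ne_top.2 hl)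
    have h1 : ∀ k, μ {x | v k < g x} ≤ ENNReal.ofReal t := by
      intro k
      have : rearr μ g t < v k := lt_of_le_of_lt hc (hvl k).1
      obtain ⟨l', hl', hl2⟩ := sInf_lt_iff.1 this
      exact le_trans (measure_mono (fun x hx => lt_trans hl2 hx)) hl'
    have h2 : {x | l < g x} = ⋃ k, {x | v k < g x} := by
      ext x
      simp only [mem_ofPred_eq, mem_iUnion]
      constructor
      · intro hx
        exact (hvt.eventually (gt_mem_nhds hx)).exists
      · rintro ⟨k, hk⟩
        exact lt_trans (hvl k).1 hk
    have h3 : Monotone fun k => {x | v k < g x} := by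
      intro a b hab x hx
      exact lt_of_le_of_lt (hv.antitone hab) hx
    rw [h2, h3.measure_iUnion] at h
    exact absurd h (not_lt.2 (iSup_le h1))

lemma rearr_antitone {E : Type*} [MeasurableSpace E] (μ : Measure E) (g : E → ℝ≥0∞) :
    Antitone (rearr μ g) := by
  intro a b hab
  apply sInf_le_sInf
  intro l hl
  exact le_trans hl (ENNReal.ofReal_le_ofReal hab)

lemma rearr_mul_measurable {E : Type*} [MeasurableSpace E] (μ : Measure E) (g : E → ℝ≥0∞)
    (V : ℝ) : Measurable (fun t => rearr μ g (V * t)) :=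
  (rearr_antitone μ g).measurable.comp (measurable_const.mul measurable_id)

lemma μU_ofReal_lt (V : ℝ) (hV : 0 < V) (c : ℝ≥0∞) (hc : c ≤ ENNReal.ofReal V) :
    ENNReal.ofReal V * μU {t | ENNReal.ofReal (V * t) < c} = c := by
  have hct : c ≠ ∞ := ne_top_of_le_ne_top ENNReal.ofReal_ne_top hc
  obtain ⟨d, hd, rfl⟩ : ∃ d : ℝ, 0 ≤ d ∧ c = ENNReal.ofReal d :=
    ⟨c.toReal, ENNReal.toReal_nonneg, (ENNReal.ofReal_toReal hct).symm⟩
  have hdV : d ≤ V := (ENNReal.ofReal_le_ofReal_iff hV.le).1 hc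
  have hms : MeasurableSet {t : ℝ | ENNReal.ofReal (V * t) < ENNReal.ofReal d} :=
    measurableSet_lt (by fun_prop) (by fun_prop)
  rw [μU, Measure.restrict_apply hms]
  have : {t : ℝ | ENNReal.ofReal (V * t) < ENNReal.ofReal d} ∩ Ioo 0 1 = Ioo 0 (d / V) := by
    ext t
    simp only [mem_inter_iff, mem_ofPred_eq, mem_Ioo]
    have h1 : d / V ≤ 1 := (div_le_one hV).2 hdV
    constructor
    · rintro ⟨h, h0, _⟩
      refine ⟨h0, ?_⟩
      rw [lt_div_iff₀ hV, mul_comm]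
      exact (ENNReal.ofReal_lt_ofReal_iff_of_nonneg (by positivity)).1 h
    · rintro ⟨h0, h⟩
      refine ⟨?_, h0, lt_of_lt_of_le h h1⟩
      rw [lt_div_iff₀ hV, mul_comm] at h
      exact (ENNReal.ofReal_lt_ofReal_iff_of_nonneg (by positivity)).2 h
  rw [this, Real.volume_Ioo, ← ENNReal.ofReal_mul hV.le]
  congr 1
  field_simp
  ring

lemma N_rearr_eq (X : RINorm μU) {E : Type*} [MeasurableSpace E] (μ : Measure E) (V : ℝ)
    (hV : 0 < V) (hμ : μ univ = ENNReal.ofReal V) (g : E → ℝ≥0∞) (h : ℝ → ℝ≥0∞)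
    (hh : Measurable h) (hgh : ∀ l, μ {x | l < g x} = ENNReal.ofReal V * μU {t | l < h t}) :
    X.N (fun t => rearr μ g (V * t)) = X.N h := by
  apply X.rearr_invariant _ _ (rearr_mul_measurable μ g V) hh
  intro l
  simp_rw [lt_rearr_iff]
  have h1 := μU_ofReal_lt V hV (μ {x | l < g x}) (hμ ▸ measure_mono (subset_univ _))
  rw [hgh] at h1
  have hv0 : ENNReal.ofReal V ≠ 0 := by simpa using hV
  rw [hgh]
  exact (ENNReal.mul_right_inj hv0 ENNReal.ofReal_ne_top).1 h1

lemma μU_univ : μU univ = 1 := by simp [μU]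
instance : IsProbabilityMeasure μU := ⟨μU_univ⟩

lemma N_le_of_distr (X : RINorm μU) (f g : ℝ → ℝ≥0∞) (hf : Measurable f) (hg : Measurable g)
    (h : ∀ l, μU {t | l < g t} ≤ μU {t | l < f t}) : X.N g ≤ X.N f := by
  have e : ∀ f : ℝ → ℝ≥0∞, Measurable f → X.N (fun t => rearr μU f (1 * t)) = X.N f := by
    intro f hf
    exact N_rearr_eq X μU 1 one_pos (by simp) f f hf (by simp)
  rw [← e f hf, ← e g hg]
  apply X.mono _ _ (rearr_mul_measurable _ _ _) (rearr_mul_measurable _ _ _)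
  refine Eventually.of_forall fun t => sInf_le_sInf fun l hl => le_trans (h l) hl

/-- if `T` is a map of `(E, μ)` to `(0,1)` with uniform image -/
lemma N_rearr_comp (X : RINorm μU) {E : Type*} [MeasurableSpace E] (μ : Measure E) (V : ℝ)
    (hV : 0 < V) (T : E → ℝ) (hT : Measurable T) (hmap : μ.map T = ENNReal.ofReal V • μU)
    (h : ℝ → ℝ≥0∞) (hh : Measurable h) :
    X.N (fun t => rearr μ (fun x => h (T x)) (V * t)) = X.N h := by
  apply N_rearr_eq X μ V hV _ _ _ hh
  · intro l
    have := congrArg (fun ν : Measure ℝ => ν {t | l < h t}) hmap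
    simpa [Measure.map_apply hT (measurableSet_lt measurable_const hh)] using this
  · have := congrArg (fun ν : Measure ℝ => ν univ) hmap
    simpa [Measure.map_apply hT MeasurableSet.univ] using this

lemma N_rearr_mono (X : RINorm μU) {E : Type*} [MeasurableSpace E] (μ : Measure E) (V : ℝ)
    (g g' : E → ℝ≥0∞) (hg : ∀ᵐ x ∂μ, g x ≤ g' x) :
    X.N (fun t => rearr μ g (V * t)) ≤ X.N (fun t => rearr μ g' (V * t)) := by
  apply X.mono _ _ (rearr_mul_measurable _ _ _) (rearr_mul_measurable _ _ _)
  refine Eventually.of_forall fun t => sInf_le_sInf fun l hl => le_trans (measure_mono_ae ?_) hl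
  filter_upwards [hg] with x hx h
  exact lt_of_lt_of_le h hx

lemma N_rearr_smul (X : RINorm μU) {E : Type*} [MeasurableSpace E] (μ : Measure E) (V : ℝ)
    (g g' : E → ℝ≥0∞) (c : ℝ≥0) (hg : ∀ᵐ x ∂μ, g x ≤ c * g' x) :
    X.N (fun t => rearr μ g (V * t)) ≤ c * X.N (fun t => rearr μ g' (V * t)) := by
  rw [← X.smul_eq c _ (rearr_mul_measurable _ _ _)]
  apply X.mono _ _ (rearr_mul_measurable _ _ _) ((rearr_mul_measurable _ _ _).const_mul _)
  refine Eventually.of_forall fun t => ?_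
  by_contra hc
  rw [not_le, lt_rearr_iff] at hc
  refine absurd hc (not_lt.2 ?_)
  have h1 : ¬ (rearr μ g' (V * t) < rearr μ g' (V * t)) := lt_irrefl _
  rw [lt_rearr_iff, not_lt] at h1
  refine le_trans (measure_mono_ae ?_) h1
  filter_upwards [hg] with x hx h
  have : (c : ℝ≥0∞) * rearr μ g' (V * t) < c * g' x := lt_of_lt_of_le h hx
  exact lt_of_mul_lt_mul_left' this

/-- integral of a function vs norm of its rearrangement -/
lemma lintegral_le_N (X : RINorm μU) : ∃ C : ℝ≥0∞, C < ∞ ∧ ∀ {E : Type} [MeasurableSpace E]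
    (μ : Measure E) (V : ℝ) (_ : 0 < V) (_ : μ univ = ENNReal.ofReal V) (g : E → ℝ≥0∞)
    (_ : AEMeasurable g μ),
    ∫⁻ x, g x ∂μ ≤ ENNReal.ofReal V * C * X.N (fun t => rearr μ g (V * t)) := by
  obtain ⟨C, hC, h⟩ := X.exists_integral_le univ MeasurableSet.univ (by simp)
  refine ⟨C, hC, ?_⟩
  intro E _ μ V hV hμ g hg
  have hv0 : ENNReal.ofReal V ≠ 0 := by simpa using hV
  have key : ∫⁻ x, g x ∂μ = ENNReal.ofReal V * ∫⁻ t, rearr μ g (V * t) ∂μU := by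
    have : IsFiniteMeasure μ := ⟨by rw [hμ]; exact ENNReal.ofReal_lt_top⟩
    have e1 : μ.map g = ENNReal.ofReal V • μU.map (fun t => rearr μ g (V * t)) := by
      symm
      have : IsFiniteMeasure (ENNReal.ofReal V • μU.map (fun t => rearr μ g (V * t))) := by
        refine ⟨?_⟩
        rw [Measure.smul_apply, Measure.map_apply (rearr_mul_measurable _ _ _) MeasurableSet.univ]
        simp
      apply ext_of_generate_finite _ (borel_eq_generateFrom_Ioi ℝ≥0∞ ▸ BorelSpace.measurable_eq) isPiSystem_Ioi
      · rintro _ ⟨l, rfl⟩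
        rw [Measure.smul_apply, Measure.map_apply (rearr_mul_measurable _ _ _) measurableSet_Ioi,
          Measure.map_apply_of_aemeasurable hg measurableSet_Ioi]
        have h2 := μU_ofReal_lt V hV (μ {x | l < g x}) (hμ ▸ measure_mono (subset_univ _))
        simp_rw [← lt_rearr_iff] at h2
        exact h2
      · rw [Measure.smul_apply, Measure.map_apply (rearr_mul_measurable _ _ _) MeasurableSet.univ,
          Measure.map_apply_of_aemeasurable hg MeasurableSet.univ]
        simp [hμ]
    calc ∫⁻ x, g x ∂μ = ∫⁻ y, y ∂(μ.map g) := by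
          rw [lintegral_map' (f := fun y => y) aemeasurable_id hg]
      _ = _ := by
          rw [e1, lintegral_smul_measure, lintegral_map (f := fun y => y) measurable_id
            (rearr_mul_measurable _ _ _)]
          rfl
  rw [key, mul_assoc]
  gcongr
  simpa using h _ (rearr_mul_measurable μ g V)



lemma N_le_of_tendsto (X : RINorm μU) (A : ℕ → ℝ → ℝ≥0∞) (f : ℝ → ℝ≥0∞)
    (hA : ∀ k, Measurable (A k)) (hf : Measurable f) (C : ℝ≥0∞) (hC : ∀ k, X.N (A k) ≤ C)
    (h : ∀ᵐ t ∂μU, Tendsto (fun k => A k t) atTop (𝓝 (f t))) : X.N f ≤ C := by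
  have hB : ∀ k, Measurable (fun t => ⨅ j, A (k + j) t) := fun k =>
    Measurable.iInf fun j => hA (k + j)
  rw [← X.fatou (fun k t => ⨅ j, A (k + j) t) f hB hf]
  · refine iSup_le fun k => le_trans ?_ (hC k)
    apply X.mono _ _ (hB k) (hA k)
    exact Eventually.of_forall fun t => iInf_le_of_le 0 (by simp)
  · refine Eventually.of_forall fun t => ?_
    intro a b hab
    refine le_iInf fun j => iInf_le_of_le (b - a + j) ?_
    rw [show a + (b - a + j) = b + j by omega]
  · filter_upwards [h] with t ht
    rw [← ht.liminf_eq, liminf_eq_iSup_iInf_of_nat']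
    refine iSup_congr fun k => iInf_congr fun j => ?_
    rw [add_comm]

lemma N_sum_le (X : RINorm μU) (A : ℕ → ℝ → ℝ≥0∞) (hA : ∀ k, Measurable (A k)) (C : ℝ≥0∞)
    (hC : ∀ k, X.N (A k) ≤ C) (K : ℕ) :
    X.N (fun t => ∑ i ∈ Finset.range K, A i t) ≤ K * C := by
  induction K with
  | zero =>
    simp only [Finset.range_zero, Finset.sum_empty, Nat.cast_zero, zero_mul, nonpos_iff_eq_zero]
    rw [X.eq_zero_iff _ measurable_const]
    rfl
  | succ k ih =>
    simp only [Finset.sum_range_succ]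
    refine le_trans (X.add_le _ _ (by fun_prop) (hA k)) ?_
    push_cast
    rw [add_mul, one_mul]
    exact add_le_add ih (hC k)

lemma N_jensen_bdd (X : RINorm μU) {Ω : Type*} [MeasurableSpace Ω] (P : Measure Ω)
    [IsProbabilityMeasure P] (F : ℝ → Ω → ℝ≥0∞) (hF : Measurable (Function.uncurry F))
    (M : ℝ≥0) (hM : ∀ t ω, F t ω ≤ M)
    (C : ℝ≥0∞) (h : ∀ᵐ ω ∂P, X.N (fun t => F t ω) ≤ C) :
    X.N (fun t => ∫⁻ ω, F t ω ∂P) ≤ C := by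
  let Q : Measure (ℕ → Ω) := Measure.infinitePi (fun _ => P)
  have hFt : ∀ t, Measurable (F t) := fun t => hF.comp (measurable_const.prodMk measurable_id)
  have hFω : ∀ ω, Measurable (fun t => F t ω) := fun ω => hF.comp (measurable_id.prodMk measurable_const)
  have hfin : ∀ t ω, F t ω ≠ ∞ := fun t ω => ne_top_of_le_ne_top ENNReal.coe_ne_top (hM t ω)
  have hG : Measurable (fun p : ℝ × (ℕ → Ω) => fun i : ℕ => (F p.1 (p.2 i)).toReal) := by
    refine measurable_pi_lambda _ fun i => ?_
    have h1 : Measurable (fun p : ℝ × (ℕ → Ω) => (p.1, p.2 i)) := by fun_prop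
    exact ENNReal.measurable_toReal.comp (hF.comp h1)
  have hmean : Measurable (fun t => ∫⁻ ω, F t ω ∂P) := hF.lintegral_prod_right'
  have slln : ∀ t, ∀ᵐ ω ∂Q, Tendsto (fun k : ℕ => (∑ i ∈ Finset.range k, (F t (ω i)).toReal) / k)
      atTop (𝓝 (∫⁻ ω, F t ω ∂P).toReal) := by
    intro t
    have hmp : ∀ i, MeasurePreserving (fun ω : ℕ → Ω => ω i) Q P := fun i =>
      measurePreserving_eval_infinitePi (fun _ => P) i
    have hmt : Measurable fun ω => (F t ω).toReal := (hFt t).ennreal_toReal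
    have hid : ∀ i, ProbabilityTheory.IdentDistrib (fun ω : ℕ → Ω => (F t (ω i)).toReal)
        (fun ω : ℕ → Ω => (F t (ω 0)).toReal) Q Q := by
      intro i
      refine ⟨(hmt.comp (measurable_pi_apply i)).aemeasurable,
        (hmt.comp (measurable_pi_apply 0)).aemeasurable, ?_⟩
      have e : ∀ i, Q.map (fun ω : ℕ → Ω => (F t (ω i)).toReal) = P.map fun ω => (F t ω).toReal := by
        intro i
        rw [← (hmp i).map_eq, Measure.map_map hmt (measurable_pi_apply i)]
        rfl
      rw [e, e]
    have hind := ProbabilityTheory.iIndepFun_infinitePi (P := fun _ : ℕ => P)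
      (X := fun (_ : ℕ) ω => (F t ω).toReal) (fun _ => hmt)
    have hint : Integrable (fun ω => (F t ω).toReal) P := by
      refine Integrable.of_bound hmt.aestronglyMeasurable M (Eventually.of_forall fun ω => ?_)
      rw [Real.norm_of_nonneg ENNReal.toReal_nonneg]
      exact ENNReal.toReal_mono ENNReal.coe_ne_top (hM t ω)
    have := ProbabilityTheory.strong_law_ae_real (μ := Q)
      (fun i (ω : ℕ → Ω) => (F t (ω i)).toReal) ((hmp 0).integrable_comp_of_integrable hint)
      (fun i j hij => hind.indepFun hij) hid
    have e2 : ∫ ω, (F t (ω 0)).toReal ∂Q = (∫⁻ ω, F t ω ∂P).toReal := by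
      rw [← integral_toReal (hFt t).aemeasurable (Eventually.of_forall fun ω => (hfin t ω).lt_top)]
      rw [← (hmp 0).map_eq, integral_map (measurable_pi_apply 0).aemeasurable
        hmt.aestronglyMeasurable]
    rw [e2] at this
    exact this
  have hset : MeasurableSet {p : ℝ × (ℕ → Ω) | Tendsto (fun k : ℕ =>
      (∑ i ∈ Finset.range k, (F p.1 (p.2 i)).toReal) / k) atTop (𝓝 (∫⁻ ω, F p.1 ω ∂P).toReal)} := by
    apply measurableSet_tendsto_fun
    · intro k
      refine Measurable.div_const ?_ _
      exact Finset.measurable_sum _ fun i _ => (measurable_pi_apply i).comp hG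
    · exact (hmean.comp measurable_fst).ennreal_toReal
  have s2 := (Measure.ae_ae_comm (μ := μU) (ν := Q) (p := fun t (ω : ℕ → Ω) => Tendsto (fun k : ℕ =>
      (∑ i ∈ Finset.range k, (F t (ω i)).toReal) / k) atTop (𝓝 (∫⁻ ω, F t ω ∂P).toReal)) hset).1
      (Eventually.of_forall slln)
  have s3 : ∀ᵐ ω ∂Q, ∀ i, X.N (fun t => F t (ω i)) ≤ C := by
    rw [ae_all_iff]
    intro i
    exact (measurePreserving_eval_infinitePi (fun _ => P) i).quasiMeasurePreserving.ae h
  obtain ⟨ω, h1, h2⟩ := (s2.and s3).exists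
  have hmA : ∀ k : ℕ, Measurable (fun t => ∑ i ∈ Finset.range (k + 1), F t (ω i)) :=
    fun k => Finset.measurable_sum _ fun i _ => hFω (ω i)
  apply N_le_of_tendsto X (fun k t => ((((k + 1 : ℕ) : ℝ≥0)⁻¹ : ℝ≥0) : ℝ≥0∞) *
    ∑ i ∈ Finset.range (k + 1), F t (ω i)) _ _ hmean C
  · intro k
    rw [X.smul_eq _ _ (hmA k)]
    refine le_trans (mul_le_mul_right (N_sum_le X (fun i t => F t (ω i)) (fun i => hFω _) C h2 (k+1)) _) ?_
    rw [← mul_assoc, ENNReal.coe_inv (by positivity)]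
    rw [ENNReal.coe_natCast, ENNReal.inv_mul_cancel (by positivity) (by simp), one_mul]
  · filter_upwards [h1] with t ht
    have hf : ∫⁻ ω, F t ω ∂P ≠ ∞ := by
      refine ne_top_of_le_ne_top (b := ∫⁻ ω, (M : ℝ≥0∞) ∂P) (by simp) (lintegral_mono (hM t))
    have h5 := ENNReal.tendsto_ofReal ((tendsto_add_atTop_iff_nat 1).2 ht)
    rw [ENNReal.ofReal_toReal hf] at h5
    refine h5.congr fun k => ?_
    rw [div_eq_inv_mul, ENNReal.ofReal_mul (by positivity), ENNReal.ofReal_sum_of_nonneg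
      (fun _ _ => ENNReal.toReal_nonneg)]
    simp_rw [ENNReal.ofReal_toReal (hfin _ _)]
    congr 1
    rw [ENNReal.ofReal_inv_of_pos (by positivity), ENNReal.coe_inv (by positivity),
      ENNReal.ofReal_natCast, ENNReal.coe_natCast]
  · intro k
    exact (hmA k).const_mul _

lemma N_jensen (X : RINorm μU) {Ω : Type*} [MeasurableSpace Ω] (P : Measure Ω)
    [IsProbabilityMeasure P] (F : ℝ → Ω → ℝ≥0∞) (hF : Measurable (Function.uncurry F))
    (C : ℝ≥0∞) (h : ∀ᵐ ω ∂P, X.N (fun t => F t ω) ≤ C) :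
    X.N (fun t => ∫⁻ ω, F t ω ∂P) ≤ C := by
  have hFt : ∀ t, Measurable (F t) := fun t => hF.comp (measurable_const.prodMk measurable_id)
  have hFω : ∀ ω, Measurable (fun t => F t ω) := fun ω => hF.comp (measurable_id.prodMk measurable_const)
  have hm : ∀ k : ℕ, Measurable (Function.uncurry fun t ω => min (F t ω) (k : ℝ≥0∞)) :=
    fun k => hF.min measurable_const
  rw [← X.fatou (fun k t => ∫⁻ ω, min (F t ω) (k : ℝ≥0∞) ∂P) (fun t => ∫⁻ ω, F t ω ∂P) (fun k => (hm k).lintegral_prod_right')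
    hF.lintegral_prod_right']
  · refine iSup_le fun k => ?_
    refine N_jensen_bdd X P _ (hm k) k (fun t ω => by simp) C ?_
    filter_upwards [h] with ω hω
    refine le_trans (X.mono _ _ ((hFω ω).min measurable_const) (hFω ω) ?_) hω
    exact Eventually.of_forall fun t => min_le_left _ _
  · refine Eventually.of_forall fun t => ?_
    intro a b hab
    refine lintegral_mono fun ω => min_le_min le_rfl ?_
    exact_mod_cast hab
  · refine Eventually.of_forall fun t => ?_
    rw [← lintegral_iSup (fun k => (hFt t).min measurable_const)]
    · refine lintegral_congr fun ω => ?_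
      rw [← inf_iSup_eq, ENNReal.iSup_natCast]
      simp
    · intro a b hab ω
      refine min_le_min le_rfl ?_
      exact_mod_cast hab

/-- dilation of an antitone function -/
lemma N_dilate_aux (X : RINorm μU) (G : ℝ → ℝ≥0∞) (hG : AntitoneOn G (Ioi 0)) (hGm : Measurable G)
    (δ : ℝ) (hδ : 0 < δ) (B : Set ℝ) (hB : MeasurableSet B) (hBδ : ∀ t ∈ B, δ < t)
    (hdis : ∀ t ∈ B, t - δ ∉ B) :
    X.N (B.indicator fun t => G (t / 2)) ≤ X.N G := by
  have hm : Measurable (B.indicator fun t => G (t / 2)) :=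
    (hGm.comp (measurable_id.div_const 2)).indicator hB
  apply N_le_of_distr X _ _ hGm hm
  intro l
  have hm1 : MeasurableSet {t | l < B.indicator (fun t => G (t / 2)) t} :=
    measurableSet_lt measurable_const hm
  have hm2 : MeasurableSet {t | l < G t} := measurableSet_lt measurable_const hGm
  rw [μU, Measure.restrict_apply hm1, Measure.restrict_apply hm2]
  set A := {t | l < B.indicator (fun t => G (t / 2)) t} ∩ Ioo 0 1
  have hA : MeasurableSet A := hm1.inter measurableSet_Ioo
  set D := {t : ℝ | t / 2 ∈ {t | l < G t} ∩ Ioo 0 1}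
  have hAB : ∀ t ∈ A, t ∈ B ∧ l < G (t / 2) := by
    intro t ht
    by_cases htB : t ∈ B
    · have := ht.1
      simp only [mem_ofPred_eq, indicator_of_mem htB] at this
      exact ⟨htB, this⟩
    · have := ht.1
      simp [indicator_of_notMem htB] at this
  have hsub1 : A ⊆ D := by
    intro t ht
    exact ⟨(hAB t ht).2, by have := ht.2.1; positivity, by have := ht.2.2; linarith⟩
  have hsub2 : (fun t => t + δ) ⁻¹' A ⊆ D := by
    intro t ht
    have h1 := hAB _ ht
    have h2 := hBδ _ h1.1
    have h3 : (t + δ) < 1 := ht.2.2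
    have ht0 : 0 < t := by linarith
    refine ⟨lt_of_lt_of_le h1.2 (hG ?_ ?_ ?_), ?_, ?_⟩
    · exact mem_Ioi.2 (by linarith)
    · exact mem_Ioi.2 (by linarith)
    · linarith
    · linarith
    · linarith
  have hdisj : Disjoint A ((fun t => t + δ) ⁻¹' A) := by
    rw [Set.disjoint_left]
    intro t ht ht2
    have := hdis _ (hAB _ ht2).1
    simp only [add_sub_cancel_right] at this
    exact this (hAB _ ht).1
  have h1 : volume A + volume A ≤ volume D := by
    calc volume A + volume A = volume A + volume ((fun t => t + δ) ⁻¹' A) := by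
          rw [measure_preimage_add_right]
      _ = volume (A ∪ (fun t => t + δ) ⁻¹' A) := by
          rw [measure_union hdisj (hA.preimage (by fun_prop))]
      _ ≤ volume D := measure_mono (union_subset hsub1 hsub2)
  have h2 : volume D = 2 * volume ({t | l < G t} ∩ Ioo 0 1) := by
    have := Real.volume_preimage_mul_right (a := (1/2 : ℝ)) (by norm_num) ({t | l < G t} ∩ Ioo 0 1)
    have e : D = (fun x => x * (1/2 : ℝ)) ⁻¹' ({t | l < G t} ∩ Ioo 0 1) := by
      ext t
      simp only [D, mem_ofPred_eq, mem_preimage]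
      rw [div_eq_mul_one_div]
    rw [e, this]
    norm_num
  rw [h2, two_mul] at h1
  by_contra hc
  rw [not_le] at hc
  exact absurd h1 (not_le.2 (ENNReal.add_lt_add hc hc))

lemma N_dilate (X : RINorm μU) (G : ℝ → ℝ≥0∞) (hG : AntitoneOn G (Ioi 0)) (hGm : Measurable G) :
    X.N (fun t => G (t / 2)) ≤ 2 * X.N G := by
  have hm : Measurable (fun t => G (t / 2)) := hGm.comp (measurable_id.div_const 2)
  let δ : ℕ → ℝ := fun k => 1 / ((k : ℝ) + 1)
  have hδ : ∀ k, 0 < δ k := fun k => by positivity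
  have hfl : ∀ k, Measurable (fun t : ℝ => ⌊t / δ k⌋) := fun k =>
    Int.measurable_floor.comp (measurable_id.div_const _)
  rw [← X.fatou (fun k => (Ioi (δ k)).indicator fun t => G (t / 2)) _
    (fun k => hm.indicator measurableSet_Ioi) hm]
  · refine iSup_le fun k => ?_
    let B1 : Set ℝ := {t | δ k < t} ∩ (fun t : ℝ => ⌊t / δ k⌋) ⁻¹' {z | Even z}
    let B2 : Set ℝ := {t | δ k < t} ∩ (fun t : ℝ => ⌊t / δ k⌋) ⁻¹' {z | ¬ Even z}
    have hB1 : MeasurableSet B1 := measurableSet_Ioi.inter (hfl k (MeasurableSet.of_discrete))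
    have hB2 : MeasurableSet B2 := measurableSet_Ioi.inter (hfl k (MeasurableSet.of_discrete))
    have hfe : ∀ t : ℝ, ⌊(t - δ k) / δ k⌋ = ⌊t / δ k⌋ - 1 := by
      intro t
      rw [sub_div, div_self (hδ k).ne', Int.floor_sub_one]
    have a1 := N_dilate_aux X G hG hGm (δ k) (hδ k) B1 hB1 (fun t ht => ht.1) (by
      rintro t ⟨_, ht⟩ ⟨_, ht2⟩
      simp only [mem_preimage, mem_ofPred_eq, hfe] at ht ht2
      rw [Int.even_sub_one] at ht2
      exact ht2 ht)
    have a2 := N_dilate_aux X G hG hGm (δ k) (hδ k) B2 hB2 (fun t ht => ht.1) (by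
      rintro t ⟨_, ht⟩ ⟨_, ht2⟩
      simp only [mem_preimage, mem_ofPred_eq, hfe] at ht ht2
      rw [Int.even_sub_one] at ht2
      exact ht2 ht)
    have e : (Ioi (δ k)).indicator (fun t => G (t / 2)) = fun t =>
        B1.indicator (fun t => G (t / 2)) t + B2.indicator (fun t => G (t / 2)) t := by
      ext t
      by_cases h1 : δ k < t
      · by_cases h2 : Even ⌊t / δ k⌋
        · simp [indicator, B1, B2, h1, h2, ← Int.not_even_iff_odd]
        · simp [indicator, B1, B2, h1, h2]
      · simp [indicator, B1, B2, h1]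
    rw [e, two_mul]
    exact le_trans (X.add_le _ _ (hm.indicator hB1) (hm.indicator hB2)) (add_le_add a1 a2)
  · refine Eventually.of_forall fun t a b hab => ?_
    apply indicator_le_indicator_of_subset _ (fun _ => zero_le)
    apply Ioi_subset_Ioi
    exact one_div_le_one_div_of_le (by positivity) (by gcongr)
  · have : ∀ᵐ t ∂μU, t ∈ Ioo (0:ℝ) 1 := ae_restrict_mem measurableSet_Ioo
    filter_upwards [this] with t ht
    apply le_antisymm
    · exact iSup_le fun k => indicator_le_self _ _ _
    · obtain ⟨k, hk⟩ := exists_nat_one_div_lt ht.1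
      refine le_iSup_of_le k ?_
      rw [indicator_of_mem (show t ∈ Ioi (δ k) from hk)]


abbrev SphE (n : ℕ) := Metric.sphere (0 : Euc n) 1
abbrev sigN (n : ℕ) : Measure (SphE n) := (volume : Measure (Euc n)).toSphere
def lamP (n : ℕ) : Measure ℝ :=
  (volume.restrict (Ioi (0:ℝ))).withDensity fun r => ENNReal.ofReal (r ^ (n - 1))
def polE (n : ℕ) (p : SphE n × ℝ) : Euc n := p.2 • (p.1 : Euc n)

lemma polE_meas (n : ℕ) : Measurable (polE n) := by
  unfold polE
  exact measurable_snd.smul (measurable_subtype_coe.comp measurable_fst)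

lemma polE_norm {n : ℕ} (θ : SphE n) (r : ℝ) (hr : 0 < r) : ‖polE n (θ, r)‖ = r := by
  have : ‖(θ : Euc n)‖ = 1 := by simpa using θ.2
  simp [polE, norm_smul, this, abs_of_pos hr]

lemma lamP_eq (n : ℕ) : (Measure.volumeIoiPow (n - 1)).map (Subtype.val) = lamP n := by
  ext s hs
  rw [Measure.map_apply measurable_subtype_coe hs, Measure.volumeIoiPow, lamP,
    withDensity_apply _ (hs.preimage measurable_subtype_coe), withDensity_apply _ hs,
    Measure.restrict_restrict hs]
  rw [setLIntegral_subtype measurableSet_Ioi _ (fun a : ℝ => ENNReal.ofReal (a ^ (n - 1)))]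
  congr 2
  ext x
  simp [and_comm]

instance (n : ℕ) : SigmaFinite (lamP n) := by
  unfold lamP
  exact SigmaFinite.withDensity_ofReal _

lemma polE_mp (n : ℕ) (hn : 1 ≤ n) :
    MeasurePreserving (polE n) ((sigN n).prod (lamP n)) volume := by
  refine ⟨polE_meas n, ?_⟩
  have : Nontrivial (Euc n) := by
    have : Nonempty (Fin n) := ⟨⟨0, hn⟩⟩
    infer_instance
  have h1 := (volume : Measure (Euc n)).measurePreserving_homeomorphUnitSphereProd
  rw [finrank_euclideanSpace_fin] at h1
  have h2 := h1.symm (homeomorphUnitSphereProd (Euc n)).toMeasurableEquiv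
  have h3 : (sigN n).prod (lamP n) = ((sigN n).prod (Measure.volumeIoiPow (n-1))).map
      (Prod.map id Subtype.val) := by
    rw [← lamP_eq, ← Measure.map_prod_map _ _ measurable_id measurable_subtype_coe, Measure.map_id]
  have h4 : (volume : Measure (Euc n)) = Measure.map Subtype.val
      (Measure.comap (Subtype.val : ({0}ᶜ : Set (Euc n)) → Euc n) volume) := by
    rw [map_comap_subtype_coe (measurableSet_singleton _).compl]
    simp
  rw [h3, Measure.map_map (polE_meas n) (measurable_id.prodMap measurable_subtype_coe)]
  conv_rhs => rw [h4, ← h2.map_eq, Measure.map_map measurable_subtype_coe h2.measurable]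
  rfl

lemma lintegral_polar (n : ℕ) (hn : 1 ≤ n) (F : Euc n → ℝ≥0∞) (hF : AEMeasurable F) :
    ∫⁻ x, F x = ∫⁻ θ : SphE n, (∫⁻ r in Ioi (0:ℝ), ENNReal.ofReal (r ^ (n - 1)) * F (r • (θ : Euc n))) ∂(sigN n) := by
  have mp := polE_mp n hn
  rw [← mp.map_eq] at hF
  have h1 : ∫⁻ x, F x = ∫⁻ p, F (polE n p) ∂((sigN n).prod (lamP n)) := by
    conv_lhs => rw [← mp.map_eq]
    rw [lintegral_map' hF mp.measurable.aemeasurable]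
  have hF2 : AEMeasurable (fun p => F (polE n p)) ((sigN n).prod (lamP n)) := hF.comp_measurable mp.measurable
  rw [h1, lintegral_prod _ hF2]
  refine lintegral_congr_ae ?_
  filter_upwards [Measure.ae_ae_of_ae_prod hF2.ae_eq_mk] with θ hθ
  have hθm : AEMeasurable (fun r => F (polE n (θ, r))) (lamP n) := by
    refine ⟨fun r => hF2.mk _ (θ, r), ?_, hθ⟩
    exact hF2.measurable_mk.comp (measurable_const.prodMk measurable_id)
  unfold lamP
  rw [lintegral_withDensity_eq_lintegral_mul₀' (by fun_prop) hθm]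
  rfl

lemma sigN_pos (n : ℕ) (hn : 1 ≤ n) : 0 < (sigN n univ).toReal := by
  have : Nontrivial (Euc n) := by
    have : Nonempty (Fin n) := ⟨⟨0, hn⟩⟩
    infer_instance
  rw [ENNReal.toReal_pos_iff]
  refine ⟨?_, measure_lt_top _ _⟩
  rw [pos_iff_ne_zero, ne_eq, Measure.measure_univ_eq_zero]
  exact Measure.toSphere_ne_zero _

lemma lintegral_nuA (n : ℕ) (hn : 1 ≤ n) (α R : ℝ) (g : ℝ → ℝ≥0∞)
    (hg : Measurable g) :
    ∫⁻ x, g ‖x‖ ∂(nuA n α R) = sigN n univ * ∫⁻ r in Ioo 0 R, ENNReal.ofReal (r ^ ((n:ℝ) + α - 1)) * g r := by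
  have hm : Measurable fun x : Euc n => ENNReal.ofReal (‖x‖ ^ α) := by fun_prop
  rw [nuA, restrict_withDensity measurableSet_ball]
  rw [lintegral_withDensity_eq_lintegral_mul _ hm (show Measurable (fun x : Euc n => g ‖x‖) from hg.comp measurable_norm), ← lintegral_indicator measurableSet_ball, lintegral_polar n hn]
  swap
  · exact ((hm.mul (hg.comp measurable_norm)).indicator measurableSet_ball).aemeasurable
  have : ∀ θ : SphE n, ∫⁻ r in Ioi (0:ℝ), ENNReal.ofReal (r ^ (n - 1)) *
      (Metric.ball 0 R).indicator ((fun x => ENNReal.ofReal (‖x‖ ^ α)) * (fun x => g ‖x‖)) (r • (θ : Euc n))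
      = ∫⁻ r in Ioo 0 R, ENNReal.ofReal (r ^ ((n:ℝ) + α - 1)) * g r := by
    intro θ
    rw [← Ioi_inter_Iio, inter_comm, ← Measure.restrict_restrict measurableSet_Iio, ← lintegral_indicator measurableSet_Iio]
    refine setLIntegral_congr_fun measurableSet_Ioi fun r hr => ?_
    have hr0 : 0 < r := hr
    have hnr : ‖r • (θ : Euc n)‖ = r := polE_norm θ r hr
    by_cases h : r < R
    · rw [indicator_of_mem (by simpa [hnr] using h), indicator_of_mem (by simpa using h)]
      simp only [Pi.mul_apply, hnr]
      rw [← mul_assoc, ← ENNReal.ofReal_mul (by positivity), ← Real.rpow_natCast, ← Real.rpow_add hr0]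
      congr 3
      rw [Nat.cast_sub hn]
      push_cast
      ring
    · rw [indicator_of_notMem (by simpa [hnr] using h), indicator_of_notMem (by simpa using h)]
      simp
  simp_rw [this]
  simp [mul_comm]

lemma lintegral_rpow_Ioo (N ρ : ℝ) (hN : 0 < N) (hρ : 0 ≤ ρ) :
    ∫⁻ r in Ioo 0 ρ, ENNReal.ofReal (r ^ (N - 1)) = ENNReal.ofReal (ρ ^ N / N) := by
  rw [Measure.restrict_congr_set Ioo_ae_eq_Ioc, ← ofReal_integral_eq_lintegral_ofReal,
    ← intervalIntegral.integral_of_le hρ, integral_rpow (Or.inl (by linarith))]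
  · simp [hN.ne']
  · exact (intervalIntegral.intervalIntegrable_rpow' (by linarith)).1
  · filter_upwards [ae_restrict_mem measurableSet_Ioc] with y hy
    exact Real.rpow_nonneg hy.1.le _

def VnA (n : ℕ) (α R : ℝ) : ℝ := (sigN n univ).toReal * (R ^ ((n:ℝ) + α) / ((n:ℝ) + α))

lemma VnA_pos (n : ℕ) (hn : 1 ≤ n) (α R : ℝ) (hα : 0 ≤ α) (hR : 0 < R) : 0 < VnA n α R := by
  have := sigN_pos n hn
  have : (1:ℝ) ≤ n := by exact_mod_cast hn
  unfold VnA
  positivity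

lemma nuA_norm_le (n : ℕ) (hn : 1 ≤ n) (α R ρ : ℝ) (hα : 0 ≤ α) (hR : 0 < R) (hρ : 0 ≤ ρ) (hρR : ρ ≤ R) :
    nuA n α R {x | ‖x‖ ≤ ρ} = ENNReal.ofReal (VnA n α ρ) := by
  have h := lintegral_nuA n hn α R ((Iic ρ).indicator 1) (measurable_one.indicator measurableSet_Iic)
  have hn' : (1:ℝ) ≤ n := by exact_mod_cast hn
  have e1 : ∫⁻ x, (Iic ρ).indicator 1 ‖x‖ ∂(nuA n α R) = nuA n α R {x | ‖x‖ ≤ ρ} := by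
    rw [← lintegral_indicator_one (measurableSet_le measurable_norm measurable_const)]
    rfl
  have e2 : ∫⁻ r in Ioo 0 R, ENNReal.ofReal (r ^ ((n:ℝ) + α - 1)) * (Iic ρ).indicator 1 r =
      ∫⁻ r in Ioo 0 ρ, ENNReal.ofReal (r ^ ((n:ℝ) + α - 1)) := by
    rw [← lintegral_indicator measurableSet_Ioo, ← lintegral_indicator measurableSet_Ioo]
    apply lintegral_congr_ae
    have : ∀ᵐ r : ℝ, r ≠ ρ := by simp [ae_iff]
    filter_upwards [this] with r hr
    by_cases h0 : 0 < r
    · by_cases h1 : r < ρ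
      · have h2 : r < R := by linarith
        simp [indicator, h0, h1, h2, h1.le]
      · have h2 : ¬ r ≤ ρ := fun h => h1 (lt_of_le_of_ne h hr)
        simp [indicator, h0, h1, h2]
    · simp [indicator, h0]
  rw [e1, e2, lintegral_rpow_Ioo _ _ (by positivity) hρ] at h
  rw [h, VnA, ENNReal.ofReal_mul ENNReal.toReal_nonneg, ENNReal.ofReal_toReal (measure_ne_top _ _)]

lemma nuA_univ (n : ℕ) (hn : 1 ≤ n) (α R : ℝ) (hα : 0 ≤ α) (hR : 0 < R) :
    nuA n α R univ = ENNReal.ofReal (VnA n α R) := by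
  rw [← nuA_norm_le n hn α R R hα hR hR.le le_rfl]
  apply measure_congr
  have : ∀ᵐ x ∂(nuA n α R), x ∈ Metric.ball (0 : Euc n) R := ae_restrict_mem measurableSet_ball
  filter_upwards [this] with x hx
  apply propext
  have : ‖x‖ < R := by simpa using hx
  exact ⟨fun _ => this.le, fun _ => trivial⟩

lemma nuA_ball (n : ℕ) (hn : 1 ≤ n) (α R : ℝ) (hα : 0 ≤ α) (hR : 0 < R) :
    (nuA n α R (Metric.ball (0 : Euc n) R)).toReal = VnA n α R := by
  have : nuA n α R (Metric.ball (0 : Euc n) R) = nuA n α R univ := by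
    simp [nuA]
  rw [this, nuA_univ n hn α R hα hR, ENNReal.toReal_ofReal (VnA_pos n hn α R hα hR).le]

def TnA (n : ℕ) (α R : ℝ) (x : Euc n) : ℝ := (‖x‖ / R) ^ ((n:ℝ) + α)

lemma TnA_meas (n : ℕ) (α R : ℝ) : Measurable (TnA n α R) := by
  unfold TnA; fun_prop

lemma map_TnA (n : ℕ) (hn : 1 ≤ n) (α R : ℝ) (hα : 0 ≤ α) (hR : 0 < R) :
    (nuA n α R).map (TnA n α R) = ENNReal.ofReal (VnA n α R) • μU := by
  have hn' : (1:ℝ) ≤ n := by exact_mod_cast hn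
  have hN : 0 < (n:ℝ) + α := by positivity
  have hu := nuA_univ n hn α R hα hR
  have : IsFiniteMeasure (nuA n α R) := ⟨by rw [hu]; exact ENNReal.ofReal_lt_top⟩
  apply Measure.ext_of_Iic
  intro s
  rw [Measure.map_apply (TnA_meas n α R) measurableSet_Iic, Measure.smul_apply, μU,
    Measure.restrict_apply measurableSet_Iic, smul_eq_mul]
  have hball : ∀ᵐ x ∂(nuA n α R), x ∈ Metric.ball (0 : Euc n) R := ae_restrict_mem measurableSet_ball
  rcases lt_or_ge s 0 with hs | hs
  · have e1 : TnA n α R ⁻¹' Iic s = ∅ := by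
      ext x
      have : 0 ≤ TnA n α R x := by unfold TnA; positivity
      simp only [mem_preimage, mem_Iic, mem_empty_iff_false, iff_false, not_le]
      linarith
    have e2 : Iic s ∩ Ioo (0:ℝ) 1 = ∅ := by
      ext t
      simp only [mem_inter_iff, mem_Iic, mem_Ioo, mem_empty_iff_false, iff_false]
      intro h; linarith [h.1, h.2.1]
    simp [e1, e2]
  rcases le_or_gt 1 s with hs1 | hs1
  · have e2 : Iic s ∩ Ioo (0:ℝ) 1 = Ioo 0 1 := by
      apply inter_eq_right.2
      intro t ht
      exact le_trans ht.2.le hs1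
    rw [e2]
    simp only [Real.volume_Ioo, sub_zero, ENNReal.ofReal_one, mul_one]
    rw [← hu]
    apply measure_congr
    filter_upwards [hball] with x hx
    apply propext
    have hx : ‖x‖ < R := by simpa using hx
    refine ⟨fun _ => trivial, fun _ => ?_⟩
    have : TnA n α R x ≤ 1 := Real.rpow_le_one (by positivity) ((div_le_one hR).2 hx.le) hN.le
    exact le_trans this hs1
  · have e2 : volume (Iic s ∩ Ioo (0:ℝ) 1) = ENNReal.ofReal s := by
      have : Iic s ∩ Ioo (0:ℝ) 1 = Ioc 0 s := by
        ext t
        simp only [mem_inter_iff, mem_Iic, mem_Ioo, mem_Ioc]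
        constructor
        · rintro ⟨h1, h2, h3⟩; exact ⟨h2, h1⟩
        · rintro ⟨h1, h2⟩; exact ⟨h2, h1, by linarith⟩
      rw [this]; simp
    have e1 : TnA n α R ⁻¹' Iic s = {x | ‖x‖ ≤ R * s ^ ((n:ℝ) + α)⁻¹} := by
      ext x
      simp only [mem_preimage, mem_Iic, TnA, mem_ofPred_eq]
      rw [← Real.le_rpow_inv_iff_of_pos (by positivity) hs hN, div_le_iff₀ hR, mul_comm]
    have hs' : s ^ ((n:ℝ) + α)⁻¹ ≤ 1 := Real.rpow_le_one hs hs1.le (by positivity)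
    rw [e1, e2, nuA_norm_le n hn α R _ hα hR (by positivity) (by nlinarith),
      ← ENNReal.ofReal_mul (VnA_pos n hn α R hα hR).le]
    congr 1
    unfold VnA
    rw [Real.mul_rpow hR.le (by positivity), ← Real.rpow_mul hs, inv_mul_cancel₀ hN.ne', Real.rpow_one]
    ring

lemma nuA_zero (n : ℕ) (R : ℝ) : nuA n 0 R = volume.restrict (Metric.ball (0 : Euc n) R) := by
  simp [nuA]

lemma omegaN_eq (n : ℕ) (hn : 1 ≤ n) (R : ℝ) (hR : 0 < R) : omegaN n * R ^ n = VnA n 0 R := by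
  rw [← nuA_ball n hn 0 R le_rfl hR, nuA_zero, Measure.restrict_apply_self,
    Measure.addHaar_ball_of_pos _ _ hR, finrank_euclideanSpace_fin, ENNReal.toReal_mul, omegaN,
    ENNReal.toReal_ofReal (by positivity), mul_comm]



abbrev Sm {n : ℕ} (φ : Euc n → ℝ) : Prop := ContDiff ℝ (⊤ : ℕ∞) φ

lemma pd_sm {n : ℕ} {φ : Euc n → ℝ} (h : Sm φ) (i : Fin n) : Sm (pderiv1 i φ) := by
  unfold pderiv1
  exact (h.fderiv_right (m := (⊤:ℕ∞)) (by simp)).clm_apply contDiff_const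

lemma pd_tsupp {n : ℕ} (φ : Euc n → ℝ) (i : Fin n) : tsupport (pderiv1 i φ) ⊆ tsupport φ :=
  tsupport_fderiv_apply_subset ℝ _

lemma pd_cs {n : ℕ} {φ : Euc n → ℝ} (h : HasCompactSupport φ) (i : Fin n) :
    HasCompactSupport (pderiv1 i φ) :=
  h.fderiv_apply ℝ _

lemma pd_comm {n : ℕ} {φ : Euc n → ℝ} (h : Sm φ) (i j : Fin n) :
    pderiv1 i (pderiv1 j φ) = pderiv1 j (pderiv1 i φ) := by
  funext x
  have hd : ∀ y, DifferentiableAt ℝ (fderiv ℝ φ) y := fun y =>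
    ((h.fderiv_right (m := (⊤:ℕ∞)) (by simp)).differentiable (by simp)) y
  have hs : IsSymmSndFDerivAt ℝ φ x := (h.contDiffAt).isSymmSndFDerivAt (by
    simp only [minSmoothness_of_isRCLikeNormedField]; exact WithTop.coe_le_coe.2 le_top)
  have e : ∀ a b : Euc n, fderiv ℝ (fun y => fderiv ℝ φ y a) x b = fderiv ℝ (fderiv ℝ φ) x b a := by
    intro a b
    rw [fderiv_clm_apply (hd x) (differentiableAt_const _)]
    simp
  change fderiv ℝ (fun y => fderiv ℝ φ y _) x _ = fderiv ℝ (fun y => fderiv ℝ φ y _) x _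
  rw [e, e]
  exact hs _ _

lemma it_sm {n : ℕ} {φ : Euc n → ℝ} (h : Sm φ) (i : Fin n) (k : ℕ) : Sm (iterPderiv i k φ) := by
  induction k with
  | zero => exact h
  | succ k ih => exact pd_sm ih i

lemma it_comm {n : ℕ} {φ : Euc n → ℝ} (h : Sm φ) (i j : Fin n) (k : ℕ) :
    iterPderiv i k (pderiv1 j φ) = pderiv1 j (iterPderiv i k φ) := by
  induction k with
  | zero => rfl
  | succ k ih => simp only [iterPderiv]; rw [ih, pd_comm (it_sm h i k)]

def mpL {n : ℕ} (L : List (Fin n)) (γ : Fin n → ℕ) (φ : Euc n → ℝ) : Euc n → ℝ :=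
  L.foldr (fun i ψ => iterPderiv i (γ i) ψ) φ

lemma mpL_sm {n : ℕ} {φ : Euc n → ℝ} (h : Sm φ) (L : List (Fin n)) (γ : Fin n → ℕ) :
    Sm (mpL L γ φ) := by
  induction L with
  | nil => exact h
  | cons j L ih => exact it_sm ih _ _

lemma mpL_comm {n : ℕ} {φ : Euc n → ℝ} (h : Sm φ) (L : List (Fin n)) (γ : Fin n → ℕ) (i : Fin n) :
    mpL L γ (pderiv1 i φ) = pderiv1 i (mpL L γ φ) := by
  induction L with
  | nil => rfl
  | cons j L ih =>
    change iterPderiv j (γ j) (mpL L γ (pderiv1 i φ)) = pderiv1 i (iterPderiv j (γ j) (mpL L γ φ))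
    rw [ih, it_comm (mpL_sm h L γ)]

lemma mpL_add {n : ℕ} {φ : Euc n → ℝ} (h : Sm φ) (L : List (Fin n)) (hL : L.Nodup) (γ : Fin n → ℕ)
    (i : Fin n) :
    (i ∈ L → mpL L (γ + Pi.single i 1) φ = mpL L γ (pderiv1 i φ)) ∧
    (i ∉ L → mpL L (γ + Pi.single i 1) φ = mpL L γ φ) := by
  induction L with
  | nil => simp [mpL]
  | cons j L ih =>
    obtain ⟨hj, hL'⟩ := List.nodup_cons.1 hL
    obtain ⟨ih1, ih2⟩ := ih hL'
    have e : ∀ γ ψ, mpL (j :: L) γ ψ = iterPderiv j (γ j) (mpL L γ ψ) := fun _ _ => rfl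
    by_cases hij : i = j
    · subst hij
      refine ⟨fun _ => ?_, fun h => absurd (by simp) h⟩
      rw [e, e, ih2 hj, mpL_comm h, it_comm (mpL_sm h L γ)]
      simp [iterPderiv]
    · have : (γ + Pi.single i 1 : Fin n → ℕ) j = γ j := by simp [Pi.single_apply, Ne.symm hij]
      refine ⟨fun hi => ?_, fun hi => ?_⟩
      · have : i ∈ L := by simpa [hij] using hi
        rw [e, e, ih1 this]; congr 1
      · have : i ∉ L := fun h => hi (by simp [h])
        rw [e, e, ih2 this]; congr 1

lemma mp_add {n : ℕ} {φ : Euc n → ℝ} (h : Sm φ) (γ : Fin n → ℕ) (i : Fin n) :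
    multiPderiv (γ + Pi.single i 1) φ = multiPderiv γ (pderiv1 i φ) :=
  (mpL_add h (List.finRange n) (List.nodup_finRange n) γ i).1 (by simp)

lemma mp_comm {n : ℕ} {φ : Euc n → ℝ} (h : Sm φ) (γ : Fin n → ℕ) (i : Fin n) :
    multiPderiv γ (pderiv1 i φ) = pderiv1 i (multiPderiv γ φ) :=
  mpL_comm h _ γ i

lemma mp_sm {n : ℕ} {φ : Euc n → ℝ} (h : Sm φ) (γ : Fin n → ℕ) : Sm (multiPderiv γ φ) :=
  mpL_sm h _ γ

lemma mp_zero {n : ℕ} (φ : Euc n → ℝ) : multiPderiv (0 : Fin n → ℕ) φ = φ := by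
  have : ∀ L : List (Fin n), mpL L 0 φ = φ := by
    intro L
    induction L with
    | nil => rfl
    | cons j L ih => exact ih
  exact this _

lemma mdeg_add {n : ℕ} (γ : Fin n → ℕ) (i : Fin n) : mdeg (γ + Pi.single i 1) = mdeg γ + 1 := by
  simp [mdeg, Finset.sum_add_distrib, Finset.sum_pi_single']

lemma mdeg_zero {n : ℕ} : mdeg (0 : Fin n → ℕ) = 0 := by simp [mdeg]

lemma midx_ind {n : ℕ} {P : (Fin n → ℕ) → Prop} (h0 : P 0)
    (hs : ∀ γ i, P γ → P (γ + Pi.single i 1)) (γ : Fin n → ℕ) : P γ := by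
  have : ∀ k γ, mdeg γ = k → P γ := by
    intro k
    induction k with
    | zero =>
      intro γ h
      have : γ = 0 := by
        funext i
        have := (Finset.sum_eq_zero_iff.1 h) i (Finset.mem_univ i)
        simpa using this
      rw [this]; exact h0
    | succ k ih =>
      intro γ h
      have : ∃ i, γ i ≠ 0 := by
        by_contra! hc
        have : mdeg γ = 0 := Finset.sum_eq_zero fun i _ => hc i
        omega
      obtain ⟨i, hi⟩ := this
      have e : γ = (γ - Pi.single i 1) + Pi.single i 1 := by
        funext j
        by_cases hj : j = i
        · subst hj; simp; omega
        · simp [Pi.single_apply, hj]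
      rw [e]
      apply hs
      apply ih
      have := mdeg_add (γ - Pi.single i 1) i
      rw [← e] at this
      omega
  exact this _ γ rfl

lemma mp_tsupp {n : ℕ} {φ : Euc n → ℝ} (h : Sm φ) (γ : Fin n → ℕ) :
    tsupport (multiPderiv γ φ) ⊆ tsupport φ := by
  induction γ using midx_ind with
  | h0 => rw [mp_zero]
  | hs γ i ih => rw [mp_add h, mp_comm h]; exact (pd_tsupp _ _).trans ih

lemma mp_cs {n : ℕ} {φ : Euc n → ℝ} (h : Sm φ) (hc : HasCompactSupport φ) (γ : Fin n → ℕ) :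
    HasCompactSupport (multiPderiv γ φ) :=
  hc.of_isClosed_subset (isClosed_tsupport _) (mp_tsupp h γ)

lemma pd_scale {n : ℕ} {φ : Euc n → ℝ} (h : Sm φ) (c : ℝ) (i : Fin n) :
    pderiv1 i (fun x => φ (c • x)) = fun x => c * pderiv1 i φ (c • x) := by
  funext x
  simp only [pderiv1]
  rw [fderiv_comp_smul]
  simp

lemma pd_const_mul {n : ℕ} (φ : Euc n → ℝ) (c : ℝ) (i : Fin n) :
    pderiv1 i (fun x => c * φ x) = fun x => c * pderiv1 i φ x := by
  funext x
  simp only [pderiv1]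
  have e : (fun x => c * φ x) = c • φ := rfl
  rw [e, fderiv_const_smul_field]; simp

lemma mp_scale {n : ℕ} {φ : Euc n → ℝ} (h : Sm φ) (c : ℝ) (γ : Fin n → ℕ) :
    multiPderiv γ (fun x => φ (c • x)) = fun x => c ^ mdeg γ * multiPderiv γ φ (c • x) := by
  have h' : Sm (fun x => φ (c • x)) := h.comp (contDiff_const_smul c)
  induction γ using midx_ind with
  | h0 => simp [mp_zero, mdeg_zero]
  | hs γ i ih =>
    rw [mp_add h', mp_comm h', ih, pd_const_mul, pd_scale (mp_sm h γ), mp_add h, mp_comm h, mdeg_add]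
    funext x; ring

lemma pd_ibp {n : ℕ} {φ ψ : Euc n → ℝ} (h : Sm φ) (h' : Sm ψ) (hc : HasCompactSupport ψ)
    (i : Fin n) : ∫ x, φ x * pderiv1 i ψ x = - ∫ x, pderiv1 i φ x * ψ x := by
  apply integral_mul_fderiv_eq_neg_fderiv_mul_of_integrable
  · exact ((pd_sm h i).continuous.mul h'.continuous).integrable_of_hasCompactSupport hc.mul_left
  · exact (h.continuous.mul (pd_sm h' i).continuous).integrable_of_hasCompactSupport (pd_cs hc i).mul_left
  · exact (h.continuous.mul h'.continuous).integrable_of_hasCompactSupport hc.mul_left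
  · exact fun x _ => h.differentiable (by simp) x
  · exact fun x _ => h'.differentiable (by simp) x

lemma mp_ibp {n : ℕ} {φ ψ : Euc n → ℝ} (h : Sm φ) (h' : Sm ψ) (hc : HasCompactSupport ψ)
    (γ : Fin n → ℕ) : ∫ x, φ x * multiPderiv γ ψ x = (-1) ^ mdeg γ * ∫ x, multiPderiv γ φ x * ψ x := by
  induction γ using midx_ind generalizing φ with
  | h0 => simp [mp_zero, mdeg_zero]
  | hs γ i ih =>
    rw [mp_add h', mp_comm h', pd_ibp h (mp_sm h' γ) (mp_cs h' hc γ), ih (pd_sm h i), mp_add h, mdeg_add]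
    ring

lemma pd_coord_mul {n : ℕ} {ψ : Euc n → ℝ} (h : Sm ψ) (i k : Fin n) :
    pderiv1 i (fun x => x k * ψ x) = fun x => (if i = k then ψ x else 0) + x k * pderiv1 i ψ x := by
  funext x
  simp only [pderiv1]
  have e : (fun x : Euc n => x k) = fun x => EuclideanSpace.proj (𝕜 := ℝ) k x := rfl
  have hd : DifferentiableAt ℝ (fun x : Euc n => x k) x := by rw [e]; fun_prop
  rw [fderiv_fun_mul hd (h.differentiable (by simp) x)]
  rw [e, ContinuousLinearMap.fderiv]
  simp [Pi.single_apply, eq_comm]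
  ring

lemma coord_sm {n : ℕ} (k : Fin n) : Sm (fun x : Euc n => x k) :=
  (EuclideanSpace.proj (𝕜 := ℝ) k : Euc n →L[ℝ] ℝ).contDiff


lemma lint_scale (a p q : ℝ) (ha : 0 < a) (g : ℝ → ℝ≥0∞) :
    ∫⁻ x in Ioo (a*p) (a*q), g x = ENNReal.ofReal a * ∫⁻ s in Ioo p q, g (a*s) := by
  rw [← image_mul_left_Ioo ha p q,
    lintegral_image_eq_lintegral_abs_deriv_mul (f := fun x => a * x) (f' := fun _ => a) measurableSet_Ioo
    (fun x _ => by simpa using ((hasDerivAt_id x).const_mul a).hasDerivWithinAt)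
    (fun x _ y _ h => mul_left_cancel₀ ha.ne' h), abs_of_pos ha, lintegral_const_mul' _ _ ENNReal.ofReal_ne_top]

lemma lint_fract (G : ℝ → ℝ≥0∞) (ω : ℝ) :
    ∫⁻ s in Ioo (0:ℝ) 1, G (Int.fract (s + ω)) = ∫⁻ s in Ioo (0:ℝ) 1, G s := by
  rw [Measure.restrict_congr_set Ioo_ae_eq_Ioc]
  have h1 : ∫⁻ s in Ioc (0:ℝ) 1, G (Int.fract (s + ω)) = ∫⁻ s in Ioc ω (ω + 1), G (Int.fract s) := by
    have := (measurePreserving_add_right volume ω).setLIntegral_comp_preimage_emb (measurableEmbedding_addRight ω)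
      (fun s => G (Int.fract s)) (Ioc ω (ω+1))
    rw [← this]
    simp [add_comm ω 1]
  have h2 := (isAddFundamentalDomain_Ioc one_pos ω).setLIntegral_eq (isAddFundamentalDomain_Ioc one_pos (0:ℝ)) (fun s => G (Int.fract s)) (by
    rintro ⟨g, hg⟩ x
    obtain ⟨k, rfl⟩ := AddSubgroup.mem_zmultiples_iff.1 hg
    simp only [AddSubgroup.vadd_def, vadd_eq_add, zsmul_one]
    rw [Int.fract_intCast_add])
  rw [h1, h2, zero_add]
  rw [← Measure.restrict_congr_set Ioo_ae_eq_Ioc]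
  refine setLIntegral_congr_fun measurableSet_Ioo fun s hs => ?_
  rw [Int.fract_eq_self.2 ⟨hs.1.le, hs.2⟩]

lemma N_avg (X : RINorm μU) (f : ℝ → ℝ≥0∞) (hf : Measurable f) (b : ℝ) (hb : 0 < b) (hb1 : b ≤ 1) :
    X.N (fun τ => (Iio b).indicator (fun _ => ENNReal.ofReal b⁻¹ * ∫⁻ z in Ioo 0 b, f z) τ) ≤ X.N f := by
  have hJ := N_jensen X μU (fun τ ω => (Iio b).indicator (fun τ => f (b * Int.fract (τ / b + ω))) τ)
    (by
      have hm : Measurable (fun p : ℝ × ℝ => f (b * Int.fract (p.1 / b + p.2))) := by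
        apply hf.comp
        apply measurable_const.mul
        exact measurable_fract.comp (by fun_prop)
      exact hm.indicator (measurable_fst measurableSet_Iio)) (X.N f) (by
      refine Eventually.of_forall fun ω => ?_
      have hm : Measurable (fun τ : ℝ => f (b * Int.fract (τ / b + ω))) := by
        apply hf.comp
        apply measurable_const.mul
        exact measurable_fract.comp (by fun_prop)
      apply N_le_of_distr X _ _ hf (hm.indicator measurableSet_Iio)
      intro l
      have hl : MeasurableSet {z | l < f z} := measurableSet_lt measurable_const hf
      have h1 : μU {t | l < (Iio b).indicator (fun τ => f (b * Int.fract (τ / b + ω))) t} ≤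
          ∫⁻ τ in Ioo 0 b, {z | l < f z}.indicator 1 (b * Int.fract (τ / b + ω)) := by
        rw [← lintegral_indicator_one (measurableSet_lt measurable_const (hm.indicator measurableSet_Iio)), μU,
          ← lintegral_indicator measurableSet_Ioo, ← lintegral_indicator measurableSet_Ioo]
        apply lintegral_mono
        intro τ
        by_cases h0 : τ ∈ Ioo (0:ℝ) 1
        · by_cases h2 : τ < b
          · simp [indicator, h2, h0.1, h0.2]
          · simp [indicator, h2]
        · simp [indicator_of_notMem h0]
      refine h1.trans ?_
      have h2 := lint_scale b 0 1 hb (fun τ => {z | l < f z}.indicator 1 (b * Int.fract (τ / b + ω)))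
      have h3 := lint_scale b 0 1 hb (fun τ => {z | l < f z}.indicator 1 τ)
      have h4 := lint_fract (fun τ => {z | l < f z}.indicator 1 (b * τ)) ω
      simp only [mul_zero, mul_one, mul_div_cancel_left₀ _ hb.ne'] at h2 h3
      rw [h2, h4, ← h3]
      rw [lintegral_indicator_one hl]
      exact Measure.restrict_mono (Ioo_subset_Ioo_right hb1) le_rfl _)
  refine le_trans (le_of_eq ?_) hJ
  congr 1
  funext τ
  by_cases h : τ ∈ Iio b
  · simp only [indicator_of_mem h]
    have h4 := lint_fract (fun s => f (b * s)) (τ / b)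
    have h3 := lint_scale b 0 1 hb f
    simp only [mul_zero, mul_one] at h3
    simp only [add_comm _ (τ / b)] at h4
    rw [h3, μU, h4, ← mul_assoc, ← ENNReal.ofReal_mul (by positivity), inv_mul_cancel₀ hb.ne']
    simp
  · simp [indicator_of_notMem h]

lemma int_le_N (X : RINorm μU) : ∃ C : ℝ≥0∞, C < ∞ ∧ ∀ f : ℝ → ℝ≥0∞, Measurable f →
    ∫⁻ z in Ioo (0:ℝ) 1, f z ≤ C * X.N f := by
  obtain ⟨C, hC, h⟩ := X.exists_integral_le univ MeasurableSet.univ (by simp)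
  refine ⟨C, hC, fun f hf => ?_⟩
  simpa [μU] using h f hf

lemma N_one (X : RINorm μU) : X.N (fun _ => 1) < ∞ := by
  simpa using X.indicator_lt_top univ MeasurableSet.univ (by simp)

lemma N_const (X : RINorm μU) (c : ℝ≥0∞) (hc : c ≠ ∞) : X.N (fun _ => c) = c * X.N (fun _ => 1) := by
  lift c to ℝ≥0 using hc
  rw [← X.smul_eq c _ measurable_const]
  simp

lemma N_const_le (X : RINorm μU) (c : ℝ≥0∞) : X.N (fun _ => c) ≤ c * X.N (fun _ => 1) := by
  by_cases hc : c = ∞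
  · subst hc
    have : X.N (fun _ => 1) ≠ 0 := by
      intro h
      have h1 := (X.eq_zero_iff _ measurable_const).1 h
      have : ∀ᵐ x ∂μU, False := by filter_upwards [h1] with x hx; simp at hx
      have h2 : μU univ = 0 := by simpa [ae_iff] using this
      simp at h2
    rw [ENNReal.top_mul this]; exact le_top
  · exact (N_const X c hc).le

lemma rpow_repr (p z : ℝ) (hp : 0 < p) (hp1 : p < 1) (hz : 0 < z) (hz1 : z < 1) :
    ENNReal.ofReal (z ^ (p-1)) = 1 + ENNReal.ofReal (1-p) * ∫⁻ b in Ioo z 1, ENNReal.ofReal (b ^ (p-2)) := by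
  rw [Measure.restrict_congr_set Ioo_ae_eq_Ioc, ← ofReal_integral_eq_lintegral_ofReal,
    ← intervalIntegral.integral_of_le hz1.le, integral_rpow (Or.inr ⟨by linarith, ?_⟩),
    ← ENNReal.ofReal_mul (by linarith), ← ENNReal.ofReal_one, ← ENNReal.ofReal_add zero_le_one]
  · congr 1
    have : p - 1 ≠ 0 := by linarith
    rw [show p - 2 + 1 = p - 1 by ring, Real.one_rpow]
    field_simp
    ring
  · apply mul_nonneg (by linarith)
    rw [show p - 2 + 1 = p - 1 by ring, Real.one_rpow]
    apply div_nonneg_of_nonpos _ (by linarith)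
    have := Real.one_le_rpow_of_pos_of_le_one_of_nonpos hz hz1.le (by linarith : p - 1 ≤ 0)
    linarith
  · rw [uIcc_of_le hz1.le]
    exact fun h => absurd h.1 (by linarith)
  · apply (intervalIntegral.intervalIntegrable_rpow (Or.inr _)).1
    rw [uIcc_of_le hz1.le]
    exact fun h => absurd h.1 (by linarith)
  · filter_upwards [ae_restrict_mem measurableSet_Ioc] with y hy
    exact Real.rpow_nonneg (by linarith [hy.1]) _

lemma N_hardy1 (X : RINorm μU) (p : ℝ) (hp : 0 < p) (hp1 : p < 1) : ∃ C : ℝ≥0∞, C < ∞ ∧ ∀ f : ℝ → ℝ≥0∞, Measurable f →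
    X.N (fun τ => ∫⁻ z in Ioo τ 1, f z * ENNReal.ofReal (z ^ (p-1))) ≤ C * X.N f := by
  obtain ⟨C, hC, hCf⟩ := int_le_N X
  have hone := N_one X
  have hq : 0 ≤ (1 - p) / p := div_nonneg (by linarith) hp.le
  refine ⟨C * X.N (fun _ => 1) + ENNReal.ofReal ((1-p)/p), ENNReal.add_lt_top.2 ⟨ENNReal.mul_lt_top hC hone, ENNReal.ofReal_lt_top⟩,
    fun f hf => ?_⟩
  let P : Measure ℝ := μU.withDensity (fun b => ENNReal.ofReal (p * b ^ (p-1)))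
  have hdm : Measurable (fun b : ℝ => ENNReal.ofReal (p * b ^ (p-1))) := by fun_prop
  have hP : IsProbabilityMeasure P := ⟨by
    simp only [P]
    rw [withDensity_apply _ MeasurableSet.univ, Measure.restrict_univ, μU]
    simp_rw [ENNReal.ofReal_mul hp.le]
    rw [lintegral_const_mul' _ _ ENNReal.ofReal_ne_top, lintegral_rpow_Ioo p 1 hp zero_le_one,
      ← ENNReal.ofReal_mul hp.le, Real.one_rpow, mul_one_div_cancel hp.ne', ENNReal.ofReal_one]⟩
  let H : ℝ → ℝ≥0∞ := fun b => ENNReal.ofReal b⁻¹ * ∫⁻ z in Ioo 0 b, f z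
  have hH : Measurable H := by
    apply Measurable.mul (by fun_prop)
    have : (fun b => ∫⁻ z in Ioo 0 b, f z) = fun b => ∫⁻ z, {q : ℝ × ℝ | 0 < q.2 ∧ q.2 < q.1}.indicator (fun q => f q.2) (b, z) := by
      funext b
      rw [← lintegral_indicator measurableSet_Ioo]
      rfl
    rw [this]
    apply Measurable.lintegral_prod_right' (f := fun q => {q : ℝ × ℝ | 0 < q.2 ∧ q.2 < q.1}.indicator (fun q => f q.2) q)
    apply (hf.comp measurable_snd).indicator
    exact (measurableSet_lt measurable_const measurable_snd).inter (measurableSet_lt measurable_snd measurable_fst)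
  have hJm : Measurable (Function.uncurry fun τ b : ℝ => (Iio b).indicator (fun _ => H b) τ) := by
    have : (Function.uncurry fun τ b : ℝ => (Iio b).indicator (fun _ => H b) τ) =
        {q : ℝ × ℝ | q.1 < q.2}.indicator (fun q => H q.2) := rfl
    rw [this]
    exact (hH.comp measurable_snd).indicator (measurableSet_lt measurable_fst measurable_snd)
  have hJ := N_jensen X P (fun τ b => (Iio b).indicator (fun _ => H b) τ) hJm (X.N f) (by
      have : ∀ᵐ b ∂P, b ∈ Ioo (0:ℝ) 1 :=
        (withDensity_absolutelyContinuous _ _).ae_le (ae_restrict_mem measurableSet_Ioo)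
      filter_upwards [this] with b hb
      exact N_avg X f hf b hb.1 hb.2.le)
  set A : ℝ → ℝ≥0∞ := fun τ => ∫⁻ b, (Iio b).indicator (fun _ => H b) τ ∂P with hA
  have hAm : Measurable A := Measurable.lintegral_prod_right hJm
  have hKm : Measurable (fun τ => ∫⁻ z in Ioo τ 1, f z * ENNReal.ofReal (z ^ (p-1))) := by
    apply Antitone.measurable
    intro a b hab
    exact lintegral_mono_set (Ioo_subset_Ioo_left hab)
  set I := ∫⁻ z in Ioo (0:ℝ) 1, f z with hI
  have key : ∀ τ ∈ Ioo (0:ℝ) 1, ∫⁻ z in Ioo τ 1, f z * ENNReal.ofReal (z ^ (p-1)) ≤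
      I + (((1-p)/p).toNNReal : ℝ≥0∞) * A τ := by
    intro τ hτ
    have e1 : ∫⁻ z in Ioo τ 1, f z * ENNReal.ofReal (z ^ (p-1)) =
        ∫⁻ z in Ioo τ 1, (f z + ENNReal.ofReal (1-p) * (f z * ∫⁻ b in Ioo z 1, ENNReal.ofReal (b ^ (p-2)))) := by
      refine setLIntegral_congr_fun measurableSet_Ioo fun z hz => ?_
      rw [rpow_repr p z hp hp1 (hτ.1.trans hz.1) hz.2]
      ring
    rw [e1, lintegral_add_left hf, lintegral_const_mul' _ _ ENNReal.ofReal_ne_top]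
    apply add_le_add
    · exact lintegral_mono_set (Ioo_subset_Ioo_left hτ.1.le)
    have e2 : A τ = ENNReal.ofReal p * ∫⁻ b in Ioo τ 1, ENNReal.ofReal (b ^ (p-2)) * ∫⁻ z in Ioo 0 b, f z := by
      simp only [hA, P]
      have hmm : Measurable fun b => (Iio b).indicator (fun _ => H b) τ := hJm.comp (measurable_const.prodMk measurable_id)
      rw [lintegral_withDensity_eq_lintegral_mul _ hdm hmm]
      rw [μU, ← lintegral_const_mul' _ _ ENNReal.ofReal_ne_top, ← lintegral_indicator measurableSet_Ioo, ← lintegral_indicator measurableSet_Ioo]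
      congr 1
      funext b
      by_cases hb : b ∈ Ioo (0:ℝ) 1
      · by_cases hb2 : τ < b
        · rw [indicator_of_mem hb, indicator_of_mem (show b ∈ Ioo τ 1 from ⟨hb2, hb.2⟩)]
          simp only [Pi.mul_apply, indicator_of_mem (show τ ∈ Iio b from hb2), H]
          rw [← mul_assoc, ← mul_assoc, ← ENNReal.ofReal_mul (by have := hb.1; positivity), ← ENNReal.ofReal_mul hp.le]
          congr 2
          rw [mul_assoc, ← Real.rpow_neg_one b, ← Real.rpow_add hb.1]
          congr 2; ring
        · rw [indicator_of_mem hb, indicator_of_notMem (fun h : b ∈ Ioo τ 1 => hb2 h.1)]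
          simp [hb2]
      · rw [indicator_of_notMem hb, indicator_of_notMem (fun h : b ∈ Ioo τ 1 => hb ⟨hτ.1.trans h.1, h.2⟩)]
    have e3 : (((1-p)/p).toNNReal : ℝ≥0∞) * A τ = ENNReal.ofReal (1-p) * ∫⁻ b in Ioo τ 1, ENNReal.ofReal (b ^ (p-2)) * ∫⁻ z in Ioo 0 b, f z := by
      rw [e2, ← mul_assoc]
      congr 1
      change ENNReal.ofReal _ * _ = _
      rw [← ENNReal.ofReal_mul hq, div_mul_cancel₀ _ hp.ne']
    rw [e3]
    apply mul_le_mul_right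
    have e4 : ∫⁻ z in Ioo τ 1, f z * ∫⁻ b in Ioo z 1, ENNReal.ofReal (b ^ (p-2)) =
        ∫⁻ z in Ioo τ 1, ∫⁻ b in Ioo τ 1, (if z < b then f z * ENNReal.ofReal (b ^ (p-2)) else 0) := by
      refine setLIntegral_congr_fun measurableSet_Ioo fun z hz => ?_
      rw [← lintegral_const_mul _ (by fun_prop), ← lintegral_indicator measurableSet_Ioo, ← lintegral_indicator measurableSet_Ioo]
      congr 1; funext b
      simp only [indicator, mem_Ioo]
      by_cases h1 : z < b
      · have := hz.1.trans h1
        simp [h1, this]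
      · simp [h1]
    rw [e4, lintegral_lintegral_swap]
    · refine setLIntegral_mono' measurableSet_Ioo fun b hb => ?_
      rw [← lintegral_const_mul _ hf, ← lintegral_indicator measurableSet_Ioo, ← lintegral_indicator measurableSet_Ioo]
      apply lintegral_mono
      intro z
      simp only [indicator, mem_Ioo]
      by_cases h1 : τ < z ∧ z < 1
      · have : 0 < z := hτ.1.trans h1.1
        by_cases h2 : z < b
        · simp [h1, h2, this, mul_comm]
        · simp [h2]
      · simp [h1]
    · apply Measurable.aemeasurable
      apply Measurable.ite (measurableSet_lt measurable_fst measurable_snd)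
      · exact (hf.comp measurable_fst).mul (by fun_prop)
      · exact measurable_const
  calc _ ≤ X.N (fun τ => I + (((1-p)/p).toNNReal : ℝ≥0∞) * A τ) := by
        apply X.mono _ _ hKm (measurable_const.add (hAm.const_mul _))
        filter_upwards [ae_restrict_mem measurableSet_Ioo] with τ hτ using key τ hτ
    _ ≤ X.N (fun _ => I) + X.N (fun τ => (((1-p)/p).toNNReal : ℝ≥0∞) * A τ) := X.add_le _ _ measurable_const (hAm.const_mul _)
    _ ≤ (C * X.N f) * X.N (fun _ => 1) + (((1-p)/p).toNNReal : ℝ≥0∞) * X.N f := by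
        rw [X.smul_eq _ _ hAm]
        gcongr
        exact (N_const_le X I).trans (by gcongr; exact hCf f hf)
    _ = _ := by
        change _ + ENNReal.ofReal _ * _ = _
        ring

lemma N_hardy (X : RINorm μU) (p : ℝ) (hp : 0 < p) : ∃ C : ℝ≥0∞, C < ∞ ∧ ∀ f : ℝ → ℝ≥0∞, Measurable f →
    X.N (fun τ => ∫⁻ z in Ioo τ 1, f z * ENNReal.ofReal (z ^ (p-1))) ≤ C * X.N f := by
  obtain ⟨C, hC, h⟩ := N_hardy1 X (min p (1/2)) (by positivity) (lt_of_le_of_lt (min_le_right _ _) (by norm_num))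
  refine ⟨C, hC, fun f hf => le_trans ?_ (h f hf)⟩
  have hKm : ∀ p : ℝ, Measurable (fun τ => ∫⁻ z in Ioo τ 1, f z * ENNReal.ofReal (z ^ (p-1))) := by
    intro p
    apply Antitone.measurable
    intro a b hab
    exact lintegral_mono_set (Ioo_subset_Ioo_left hab)
  apply X.mono _ _ (hKm _) (hKm _)
  filter_upwards [ae_restrict_mem measurableSet_Ioo] with τ hτ
  refine setLIntegral_mono' measurableSet_Ioo fun z hz => ?_
  refine mul_le_mul_right (ENNReal.ofReal_le_ofReal ?_) _
  apply Real.rpow_le_rpow_of_exponent_ge (hτ.1.trans hz.1) hz.2.le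
  have := min_le_left p (1/2)
  linarith

lemma N_dil (X : RINorm μU) (f : ℝ → ℝ≥0∞) (hf : Measurable f) (y : ℝ) (hy : 1 ≤ y) :
    X.N (fun s => (Iio (1:ℝ)).indicator f (y * s)) ≤ X.N f := by
  have hfm : Measurable ((Iio (1:ℝ)).indicator f) := hf.indicator measurableSet_Iio
  have hm : Measurable (fun s => (Iio (1:ℝ)).indicator f (y * s)) :=
    hfm.comp (measurable_const.mul measurable_id)
  apply N_le_of_distr X _ _ hf hm
  intro l
  have hl : MeasurableSet {z | l < (Iio (1:ℝ)).indicator f z} := measurableSet_lt measurable_const hfm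
  have hy0 : 0 < y := by linarith
  have h := lint_scale y 0 1 hy0 ({z | l < (Iio (1:ℝ)).indicator f z}.indicator 1)
  have e : ∫⁻ s in Ioo (0:ℝ) 1, {z | l < (Iio (1:ℝ)).indicator f z}.indicator 1 (y * s) = μU {t | l < (Iio (1:ℝ)).indicator f (y * t)} := by
    rw [← lintegral_indicator_one (measurableSet_lt measurable_const hm)]; rfl
  rw [e] at h
  have h2 : μU {t | l < (Iio (1:ℝ)).indicator f (y * t)} ≤ ENNReal.ofReal y * μU {t | l < (Iio (1:ℝ)).indicator f (y * t)} := by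
    conv_lhs => rw [← one_mul (μU _)]
    gcongr
    rw [← ENNReal.ofReal_one]
    exact ENNReal.ofReal_le_ofReal hy
  refine h2.trans ?_
  rw [← h, ← lintegral_indicator_one (measurableSet_lt measurable_const hf), μU, ← lintegral_indicator measurableSet_Ioo, ← lintegral_indicator measurableSet_Ioo]
  apply lintegral_mono
  intro z
  simp only [mul_zero, mul_one, indicator, mem_Ioo, mem_ofPred_eq, mem_Iio]
  by_cases h1 : z < 1
  · by_cases h0 : 0 < z
    · have : z < y := by linarith
      simp [h1, h0, this]
    · simp [h0]
  · simp [h1]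

lemma N_ann (X : RINorm μU) (f : ℝ → ℝ≥0∞) (hf : Measurable f) :
    X.N (fun τ => ∫⁻ z in Ioo τ (2*τ), (Iio (1:ℝ)).indicator f z * ENNReal.ofReal z⁻¹) ≤ X.N f := by
  have hfm : Measurable ((Iio (1:ℝ)).indicator f) := hf.indicator measurableSet_Iio
  let P : Measure ℝ := volume.restrict (Ioo (1:ℝ) 2)
  have hP : IsProbabilityMeasure P := ⟨by simp [P]; norm_num⟩
  have hFm : Measurable (Function.uncurry fun s y : ℝ => (Iio (1:ℝ)).indicator f (y * s)) :=
    hfm.comp (measurable_snd.mul measurable_fst)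
  have hJ := N_jensen X P (fun s y => (Iio (1:ℝ)).indicator f (y * s)) hFm (X.N f) (by
    filter_upwards [ae_restrict_mem measurableSet_Ioo] with y hy
    exact N_dil X f hf y hy.1.le)
  refine le_trans ?_ hJ
  apply X.mono
  · have : (fun τ => ∫⁻ z in Ioo τ (2*τ), (Iio (1:ℝ)).indicator f z * ENNReal.ofReal z⁻¹) =
      fun τ => ∫⁻ z, {q : ℝ × ℝ | q.1 < q.2 ∧ q.2 < 2 * q.1}.indicator (fun q => (Iio (1:ℝ)).indicator f q.2 * ENNReal.ofReal q.2⁻¹) (τ, z) := by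
      funext b
      rw [← lintegral_indicator measurableSet_Ioo]
      rfl
    rw [this]
    apply Measurable.lintegral_prod_right' (f := fun q => {q : ℝ × ℝ | q.1 < q.2 ∧ q.2 < 2 * q.1}.indicator (fun q => (Iio (1:ℝ)).indicator f q.2 * ENNReal.ofReal q.2⁻¹) q)
    apply Measurable.indicator
    · exact (hfm.comp measurable_snd).mul (by fun_prop)
    · exact (measurableSet_lt measurable_fst measurable_snd).inter (measurableSet_lt measurable_snd (by fun_prop))
  · exact Measurable.lintegral_prod_right hFm
  · filter_upwards [ae_restrict_mem measurableSet_Ioo] with τ hτ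
    have h := lint_scale τ 1 2 hτ.1 (fun z => (Iio (1:ℝ)).indicator f z * ENNReal.ofReal z⁻¹)
    rw [mul_one, mul_comm τ 2] at h
    rw [h, ← lintegral_const_mul' _ _ ENNReal.ofReal_ne_top]
    refine setLIntegral_mono' measurableSet_Ioo fun y hy => ?_
    rw [mul_comm y τ, mul_comm, mul_assoc, ← ENNReal.ofReal_mul (by have := hτ.1; have := hy.1; positivity)]
    conv_rhs => rw [← mul_one ((Iio (1:ℝ)).indicator f (τ * y))]
    gcongr
    rw [← ENNReal.ofReal_one]
    apply ENNReal.ofReal_le_ofReal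
    have := hτ.1; have hy1 := hy.1
    rw [mul_inv, mul_comm τ⁻¹, mul_assoc, inv_mul_cancel₀ this.ne', mul_one]
    exact inv_le_one_of_one_le₀ hy1.le


def bumpF (n : ℕ) (a R : ℝ) (y : Euc n) : ℝ := Real.smoothTransition ((R^2 - ‖y‖^2) / (R^2 - a^2))

lemma bumpF_sm (n : ℕ) (a R : ℝ) : Sm (bumpF n a R) := by
  unfold bumpF
  apply Real.smoothTransition.contDiff.comp
  exact (contDiff_const.sub (contDiff_norm_sq ℝ)).div_const _

lemma bumpF_one {n : ℕ} {a R : ℝ} (ha : 0 < a) (haR : a < R) (y : Euc n) (hy : ‖y‖ ≤ a) :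
    bumpF n a R y = 1 := by
  apply Real.smoothTransition.one_of_one_le
  rw [le_div_iff₀ (by nlinarith)]
  nlinarith [norm_nonneg y]

lemma bumpF_zero {n : ℕ} {a R : ℝ} (ha : 0 < a) (haR : a < R) (y : Euc n) (hy : R ≤ ‖y‖) :
    bumpF n a R y = 0 := by
  apply Real.smoothTransition.zero_of_nonpos
  apply div_nonpos_of_nonpos_of_nonneg <;> nlinarith

lemma bumpF_nonneg {n : ℕ} {a R : ℝ} (y : Euc n) : 0 ≤ bumpF n a R y := Real.smoothTransition.nonneg _
lemma bumpF_le_one {n : ℕ} {a R : ℝ} (y : Euc n) : bumpF n a R y ≤ 1 := Real.smoothTransition.le_one _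

lemma bumpF_tsupp {n : ℕ} {a R : ℝ} (ha : 0 < a) (haR : a < R) :
    tsupport (bumpF n a R) ⊆ Metric.closedBall 0 R := by
  apply closure_minimal _ Metric.isClosed_closedBall
  intro y hy
  by_contra hc
  simp only [Metric.mem_closedBall, dist_zero_right, not_le] at hc
  exact hy (bumpF_zero ha haR y hc.le)

lemma bumpF_cs {n : ℕ} {a R : ℝ} (ha : 0 < a) (haR : a < R) : HasCompactSupport (bumpF n a R) :=
  (isCompact_closedBall (0 : Euc n) R).of_isClosed_subset (isClosed_tsupport _) (bumpF_tsupp ha haR)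

lemma bumpF_mp {n : ℕ} {a R : ℝ} (ha : 0 < a) (haR : a < R) (γ : Fin n → ℕ) (hγ : 1 ≤ mdeg γ) (y : Euc n)
    (hy : multiPderiv γ (bumpF n a R) y ≠ 0) : a ≤ ‖y‖ ∧ ‖y‖ ≤ R := by
  have hsm := bumpF_sm n a R
  constructor
  · have h1 : ∃ (γ' : Fin n → ℕ) (i : Fin n), γ = γ' + Pi.single i 1 := by
      revert hγ
      induction γ using midx_ind with
      | h0 => simp [mdeg_zero]
      | hs γ i ih => exact fun _ => ⟨γ, i, rfl⟩
    obtain ⟨γ', i, rfl⟩ := h1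
    rw [mp_add hsm] at hy
    have h2 := mp_tsupp (pd_sm hsm i) γ' (subset_tsupport _ hy)
    have h3 : tsupport (pderiv1 i (bumpF n a R)) ⊆ (Metric.ball 0 a)ᶜ := by
      apply closure_minimal _ Metric.isOpen_ball.isClosed_compl
      intro z hz hzb
      apply hz
      have : bumpF n a R =ᶠ[𝓝 z] fun _ => (1:ℝ) := by
        filter_upwards [Metric.isOpen_ball.mem_nhds hzb] with w hw
        exact bumpF_one ha haR w (by simpa using (Metric.mem_ball.1 hw).le)
      simp [pderiv1, this.fderiv_eq]
    simpa using h3 h2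
  · have := bumpF_tsupp ha haR (mp_tsupp hsm γ (subset_tsupport _ hy))
    simpa using this

def convU {n : ℕ} (S : Set ℝ) (k c : ℝ → ℝ) (Ψ : Euc n → ℝ) (x : Euc n) : ℝ :=
  ∫ z in S, k z * Ψ (c z • x)

lemma convU_joint {n : ℕ} {S : Set ℝ} {k c : ℝ → ℝ} {Ψ φ : Euc n → ℝ} (hk : IntegrableOn k S) (hc : Measurable c)
    (hΨ : Continuous Ψ) (hΨc : HasCompactSupport Ψ) (hφ : Integrable φ) :
    Integrable (fun q : Euc n × ℝ => k q.2 * Ψ (c q.2 • q.1) * φ q.1) (volume.prod (volume.restrict S)) := by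
  obtain ⟨M, hM⟩ := hΨc.exists_bound_of_continuous hΨ
  have h1 : Integrable (fun q : Euc n × ℝ => φ q.1 * k q.2) (volume.prod (volume.restrict S)) :=
    hφ.mul_prod hk
  have hm : Measurable (fun q : Euc n × ℝ => Ψ (c q.2 • q.1)) :=
    hΨ.measurable.comp ((hc.comp measurable_snd).smul measurable_fst)
  have h2 := h1.bdd_mul (c := M) hm.aestronglyMeasurable (Eventually.of_forall fun q => hM _)
  refine h2.congr (Eventually.of_forall fun q => ?_)
  simp only
  ring

lemma convU_fubini {n : ℕ} {S : Set ℝ} {k c : ℝ → ℝ} {Ψ φ : Euc n → ℝ} (hk : IntegrableOn k S) (hc : Measurable c)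
    (hΨ : Continuous Ψ) (hΨc : HasCompactSupport Ψ) (hφ : Integrable φ) :
    ∫ x, convU S k c Ψ x * φ x = ∫ z in S, k z * ∫ x, Ψ (c z • x) * φ x := by
  have h := convU_joint hk hc hΨ hΨc hφ
  have := integral_integral_swap (f := fun x z => k z * Ψ (c z • x) * φ x) h
  unfold convU
  simp_rw [← integral_mul_const, ← integral_const_mul]
  rw [this]
  simp_rw [mul_assoc]

lemma convU_li {n : ℕ} {S : Set ℝ} {k c : ℝ → ℝ} {Ψ : Euc n → ℝ} (hk : IntegrableOn k S) (hc : Measurable c)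
    (hΨ : Continuous Ψ) (hΨc : HasCompactSupport Ψ) : LocallyIntegrable (convU S k c Ψ) := by
  rw [locallyIntegrable_iff]
  intro A hA
  have hφ : Integrable (A.indicator fun _ => (1:ℝ)) (volume : Measure (Euc n)) := by
    rw [integrable_indicator_iff hA.measurableSet]
    exact integrableOn_const hA.measure_lt_top.ne
  have h := (convU_joint hk hc hΨ hΨc hφ).integral_prod_left
  rw [← integrable_indicator_iff hA.measurableSet]
  refine h.congr (Eventually.of_forall fun x => ?_)
  by_cases hx : x ∈ A <;> simp [hx, convU]

lemma convU_weak {n : ℕ} {S : Set ℝ} {k c : ℝ → ℝ} {Φ : Euc n → ℝ} (m : ℕ)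
    (hk : ∀ j, IntegrableOn (fun z => k z * c z ^ j) S) (hc : Measurable c)
    (hΦ : Sm Φ) (hΦc : HasCompactSupport Φ) (Ω : Set (Euc n)) :
    HasWeakDerivsOn Ω m (convU S k c Φ)
      (fun γ => convU S (fun z => k z * c z ^ mdeg γ) c (multiPderiv γ Φ)) := by
  have hk0 : IntegrableOn k S := by simpa using hk 0
  refine ⟨(convU_li hk0 hc hΦ.continuous hΦc).locallyIntegrableOn _, fun γ _ =>
    (convU_li (hk _) hc (mp_sm hΦ γ).continuous (mp_cs hΦ hΦc γ)).locallyIntegrableOn _, ?_⟩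
  intro γ _ φ hφ hφc hφΩ
  have hz : ∀ x ∉ Ω, φ x = 0 := fun x hx => image_eq_zero_of_notMem_tsupport fun h => hx (hφΩ h)
  have hz' : ∀ x ∉ Ω, multiPderiv γ φ x = 0 := fun x hx =>
    image_eq_zero_of_notMem_tsupport fun h => hx (hφΩ (mp_tsupp hφ γ h))
  rw [setIntegral_eq_integral_of_forall_compl_eq_zero (fun x hx => by rw [hz' x hx, mul_zero]),
    setIntegral_eq_integral_of_forall_compl_eq_zero (fun x hx => by rw [hz x hx, mul_zero]),
    convU_fubini hk0 hc hΦ.continuous hΦc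
      ((mp_sm hφ γ).continuous.integrable_of_hasCompactSupport (mp_cs hφ hφc γ)),
    convU_fubini (hk _) hc (mp_sm hΦ γ).continuous (mp_cs hΦ hΦc γ)
      (hφ.continuous.integrable_of_hasCompactSupport hφc), ← integral_const_mul]
  congr 1
  funext z
  rw [mp_ibp (φ := fun x => Φ (c z • x)) (hΦ.comp (contDiff_const_smul _)) hφ hφc γ, mp_scale hΦ]
  simp_rw [mul_assoc]
  rw [integral_const_mul]
  ring

lemma DmLen_le {n : ℕ} (m : ℕ) (Du : (Fin n → ℕ) → Euc n → ℝ) (x : Euc n) (B : ℝ≥0∞)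
    (h : ∀ γ, 1 ≤ mdeg γ → mdeg γ ≤ m → ENNReal.ofReal |Du γ x| ≤ B) :
    ENNReal.ofReal |DmLen m Du x| ≤ (((m+1)^n : ℕ) : ℝ≥0) * B := by
  by_cases hB : B = ∞
  · rw [hB, ENNReal.mul_top (by simp)]; exact le_top
  lift B to ℝ≥0 using hB
  have h' : ∀ γ, 1 ≤ mdeg γ → mdeg γ ≤ m → |Du γ x| ≤ B := by
    intro γ h1 h2
    have := h γ h1 h2
    rw [← ENNReal.ofReal_coe_nnreal] at this
    exact (ENNReal.ofReal_le_ofReal_iff B.2).1 this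
  have hN : (1:ℝ) ≤ (((m+1)^n : ℕ) : ℝ) := by exact_mod_cast Nat.one_le_pow _ _ (by omega)
  have : DmLen m Du x ≤ (((m+1)^n : ℕ) : ℝ) * B := by
    unfold DmLen
    apply Real.sqrt_le_iff.2 ⟨mul_nonneg (by positivity) B.2, ?_⟩
    calc _ ≤ ∑ g : Fin n → Fin (m + 1), (B:ℝ)^2 := by
          apply Finset.sum_le_sum
          intro g _
          split_ifs with hg
          · have := h' _ hg.1 hg.2
            rw [← sq_abs]
            gcongr
          · positivity
      _ = (((m+1)^n : ℕ) : ℝ) * B^2 := by simp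
      _ ≤ _ := by
          rw [mul_pow]
          exact mul_le_mul_of_nonneg_right (by nlinarith) (by positivity)
  rw [abs_of_nonneg (show 0 ≤ DmLen m Du x from Real.sqrt_nonneg _)]
  refine (ENNReal.ofReal_le_ofReal this).trans ?_
  rw [ENNReal.ofReal_mul (by positivity), ENNReal.ofReal_natCast, ENNReal.ofReal_coe_nnreal]
  simp


lemma root_facts (n : ℕ) (hn : 1 ≤ n) (z : ℝ) (hz : 0 < z) :
    0 < z ^ ((n:ℝ)⁻¹) ∧ (z ^ ((n:ℝ)⁻¹)) ^ n = z := by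
  refine ⟨Real.rpow_pos_of_pos hz _, ?_⟩
  rw [Real.rpow_inv_natCast_pow hz.le (by omega)]

lemma scale_le_iff (n : ℕ) (hn : 1 ≤ n) (z : ℝ) (hz : 0 < z) (x : Euc n) (b : ℝ) (hb : 0 < b) :
    ‖(z ^ ((n:ℝ)⁻¹))⁻¹ • x‖ ≤ b ↔ (‖x‖ / b) ^ n ≤ z := by
  obtain ⟨h1, h2⟩ := root_facts n hn z hz
  rw [norm_smul, Real.norm_eq_abs, abs_of_pos (inv_pos.2 h1), inv_mul_le_iff₀ h1, ← div_le_iff₀ hb]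
  conv_rhs => rw [← h2]
  exact (pow_le_pow_iff_left₀ (by positivity) h1.le (by omega)).symm

lemma scale_ge_iff (n : ℕ) (hn : 1 ≤ n) (z : ℝ) (hz : 0 < z) (x : Euc n) (b : ℝ) (hb : 0 < b) :
    b ≤ ‖(z ^ ((n:ℝ)⁻¹))⁻¹ • x‖ ↔ z ≤ (‖x‖ / b) ^ n := by
  obtain ⟨h1, h2⟩ := root_facts n hn z hz
  rw [norm_smul, Real.norm_eq_abs, abs_of_pos (inv_pos.2 h1), le_inv_mul_iff₀ h1, ← le_div_iff₀ hb]
  conv_rhs => rw [← h2]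
  exact (pow_le_pow_iff_left₀ h1.le (by positivity) (by omega)).symm

lemma dir1_core (m n : ℕ) (hn : 1 ≤ n) (R β : ℝ) (hR : 0 < R) (hβ : 0 < β) (hβ1 : β ≤ 1) :
    ∃ C : ℝ≥0, ∀ (f : ℝ → ℝ≥0∞), Measurable f → ∀ δ : ℝ, 0 < δ → δ < 1 → ∀ M : ℝ≥0, (∀ z, f z ≤ M) →
      (∀ z ≤ δ, f z = 0) → ∃ (u : Euc n → ℝ) (Du : (Fin n → ℕ) → Euc n → ℝ),
        (∀ x y : Euc n, ‖x‖ = ‖y‖ → u x = u y) ∧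
        HasWeakDerivsOn (Metric.ball (0 : Euc n) R) m u Du ∧
        (∀ x, ∫⁻ z in Ioo (2 ^ β * (‖x‖ / R) ^ n) 1, f z * ENNReal.ofReal (z ^ ((m:ℝ)/n - 1)) ≤ ENNReal.ofReal |u x|) ∧
        (∀ x, ENNReal.ofReal |u x| ≤ ∫⁻ z in Ioo ((‖x‖ / R) ^ n) 1, f z * ENNReal.ofReal (z ^ ((m:ℝ)/n - 1))) ∧
        (∀ x, ENNReal.ofReal |DmLen m Du x| ≤ C *
          ∫⁻ z in Ioo ((‖x‖ / R) ^ n) (2 * (‖x‖ / R) ^ n), (Iio (1:ℝ)).indicator f z * ENNReal.ofReal z⁻¹) := by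
  have hn0 : (0:ℝ) < n := by exact_mod_cast hn
  set a : ℝ := R * 2 ^ (-(β / n)) with ha_def
  have ha : 0 < a := by positivity
  have haR : a < R := by
    have : (2:ℝ) ^ (-(β / n)) < 1 := Real.rpow_lt_one_of_one_lt_of_neg (by norm_num) (by
      have : 0 < β / n := by positivity
      linarith)
    nlinarith
  have hac : ∀ r : ℝ, (r / a) ^ n = 2 ^ β * (r / R) ^ n := by
    intro r
    rw [ha_def, div_mul_eq_div_div, div_pow, ← Real.rpow_natCast (2 ^ (-(β / n)) : ℝ) n, ← Real.rpow_mul (by norm_num),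
      neg_mul, div_mul_cancel₀ _ hn0.ne', Real.rpow_neg (by norm_num), div_inv_eq_mul, mul_comm]
  set Φ := bumpF n a R with hΦ
  have hsm : Sm Φ := bumpF_sm n a R
  have hcs : HasCompactSupport Φ := bumpF_cs ha haR
  have hbd : ∀ γ : Fin n → ℕ, ∃ M : ℝ≥0, ∀ y, |multiPderiv γ Φ y| ≤ M := by
    intro γ
    obtain ⟨M, hM⟩ := (mp_cs hsm hcs γ).exists_bound_of_continuous (mp_sm hsm γ).continuous
    exact ⟨M.toNNReal, fun y => (hM y).trans (Real.le_coe_toNNReal M)⟩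
  choose Mγ hMγ using hbd
  obtain ⟨Mx, hMx⟩ : ∃ Mx : ℝ≥0, ∀ γ : Fin n → ℕ, mdeg γ ≤ m → Mγ γ ≤ Mx := by
    refine ⟨∑ g : Fin n → Fin (m+1), Mγ (fun i => (g i : ℕ)), fun γ hγ => ?_⟩
    have hlt : ∀ i, γ i < m + 1 := fun i => by
      have : γ i ≤ mdeg γ := Finset.single_le_sum (f := γ) (fun _ _ => Nat.zero_le _) (Finset.mem_univ i)
      omega
    exact Finset.single_le_sum (f := fun g : Fin n → Fin (m+1) => Mγ (fun i => (g i : ℕ))) (fun _ _ => zero_le) (Finset.mem_univ (fun i => ⟨γ i, hlt i⟩))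
  refine ⟨(((m+1)^n : ℕ) : ℝ≥0) * Mx, fun f hf δ hδ hδ1 M hM hfδ => ?_⟩
  set k : ℝ → ℝ := fun z => (f z).toReal * z ^ ((m:ℝ)/n - 1) with hk_def
  set c : ℝ → ℝ := fun z => (z ^ ((n:ℝ)⁻¹))⁻¹ with hc_def
  have hcm : Measurable c := by simp only [hc_def]; fun_prop
  have hfM : ∀ z, f z ≠ ∞ := fun z => ne_top_of_le_ne_top ENNReal.coe_ne_top (hM z)
  have hki : ∀ j, IntegrableOn (fun z => k z * c z ^ j) (Ioo δ 1) := by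
    intro j
    have h1 : IntegrableOn (fun z : ℝ => z ^ ((m:ℝ)/n - 1) * c z ^ j) (Ioo δ 1) := by
      have : ContinuousOn (fun z : ℝ => z ^ ((m:ℝ)/n - 1) * c z ^ j) (Icc δ 1) := by
        have hne : ∀ z ∈ Icc δ 1, z ≠ 0 := fun z hz => by linarith [hz.1]
        apply ContinuousOn.mul
        · exact ContinuousOn.rpow_const continuousOn_id fun z hz => Or.inl (hne z hz)
        · apply ContinuousOn.pow
          apply ContinuousOn.inv₀
          · exact ContinuousOn.rpow_const continuousOn_id fun z hz => Or.inl (hne z hz)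
          · intro z hz
            exact (Real.rpow_pos_of_pos (by linarith [hz.1]) _).ne'
      exact (this.integrableOn_Icc).mono_set Ioo_subset_Icc_self
    have h2 := Integrable.bdd_mul (c := (M:ℝ)) h1 (f := fun z => (f z).toReal) hf.ennreal_toReal.aestronglyMeasurable
      (Eventually.of_forall fun z => by
        rw [Real.norm_eq_abs, abs_of_nonneg ENNReal.toReal_nonneg]
        exact ENNReal.toReal_mono ENNReal.coe_ne_top (hM z))
    refine h2.congr (Eventually.of_forall fun z => ?_)
    simp only [hk_def]; ring
  have hk0 : IntegrableOn k (Ioo δ 1) := by simpa using hki 0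
  have hko : ∀ z ∈ Ioo δ 1, 0 ≤ k z := fun z hz => by
    have : 0 < z := hδ.trans hz.1
    simp only [hk_def]; positivity
  have hkE : ∀ z ∈ Ioo δ 1, ENNReal.ofReal (k z) = f z * ENNReal.ofReal (z ^ ((m:ℝ)/n - 1)) := fun z hz => by
    simp only [hk_def]
    rw [ENNReal.ofReal_mul ENNReal.toReal_nonneg, ENNReal.ofReal_toReal (hfM z)]
  refine ⟨convU (Ioo δ 1) k c Φ, fun γ => convU (Ioo δ 1) (fun z => k z * c z ^ mdeg γ) c (multiPderiv γ Φ),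
    ?_, convU_weak m hki hcm hsm hcs _, ?_, ?_, ?_⟩
  · intro x y hxy
    unfold convU
    congr 1; funext z
    simp only [hΦ, bumpF, norm_smul, hxy]
  · intro x
    have hint : IntegrableOn (fun z => k z * Φ (c z • x)) (Ioo δ 1) := by
      have := Integrable.bdd_mul (c := 1) hk0 (f := fun z => Φ (c z • x))
        (hsm.continuous.measurable.comp (hcm.smul_const x)).aestronglyMeasurable
        (Eventually.of_forall fun z => by
          rw [Real.norm_eq_abs, abs_of_nonneg (bumpF_nonneg _)]; exact bumpF_le_one _)
      exact this.congr (Eventually.of_forall fun z => mul_comm _ _)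
    have hnn : ∀ z ∈ Ioo δ 1, 0 ≤ k z * Φ (c z • x) := fun z hz => mul_nonneg (hko z hz) (bumpF_nonneg _)
    have hu0 : 0 ≤ convU (Ioo δ 1) k c Φ x := setIntegral_nonneg measurableSet_Ioo hnn
    rw [abs_of_nonneg hu0, convU, ofReal_integral_eq_lintegral_ofReal hint
      (by filter_upwards [ae_restrict_mem measurableSet_Ioo] with z hz using hnn z hz),
      ← lintegral_indicator measurableSet_Ioo, ← lintegral_indicator measurableSet_Ioo]
    apply lintegral_mono
    intro z
    by_cases hz : z ∈ Ioo (2 ^ β * (‖x‖ / R) ^ n) 1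
    · by_cases hzδ : z ≤ δ
      · simp [indicator_of_mem hz, hfδ z hzδ]
      · have hzS : z ∈ Ioo δ 1 := ⟨not_le.1 hzδ, hz.2⟩
        simp only [indicator_of_mem hz, indicator_of_mem hzS]
        have : Φ (c z • x) = 1 := by
          apply bumpF_one ha haR
          rw [scale_le_iff n hn z (hδ.trans hzS.1) x a ha, hac]
          exact hz.1.le
        rw [this, mul_one, hkE z hzS]
    · simp [indicator_of_notMem hz]
  · intro x
    have h1 : ENNReal.ofReal |convU (Ioo δ 1) k c Φ x| ≤ ∫⁻ z in Ioo δ 1, ‖k z * Φ (c z • x)‖ₑ := by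
      rw [← Real.enorm_eq_ofReal_abs]
      exact enorm_integral_le_lintegral_enorm _
    refine h1.trans ?_
    rw [← lintegral_indicator measurableSet_Ioo, ← lintegral_indicator measurableSet_Ioo]
    apply lintegral_mono
    intro z
    by_cases hzS : z ∈ Ioo δ 1
    · have hz0 : 0 < z := hδ.trans hzS.1
      simp only [indicator_of_mem hzS]
      by_cases hz : z ∈ Ioo ((‖x‖ / R) ^ n) 1
      · simp only [indicator_of_mem hz]
        rw [← hkE z hzS, Real.enorm_eq_ofReal_abs]
        apply ENNReal.ofReal_le_ofReal
        rw [abs_mul, abs_of_nonneg (hko z hzS), abs_of_nonneg (bumpF_nonneg _)]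
        exact mul_le_of_le_one_right (hko z hzS) (bumpF_le_one _)
      · have : Φ (c z • x) = 0 := by
          apply bumpF_zero ha haR
          rw [scale_ge_iff n hn z hz0 x R hR]
          by_contra hc
          exact hz ⟨not_le.1 hc, hzS.2⟩
        simp [this]
    · simp [indicator_of_notMem hzS]
  · intro x
    have h2 : ENNReal.ofReal |DmLen m (fun γ => convU (Ioo δ 1) (fun z => k z * c z ^ mdeg γ) c (multiPderiv γ Φ)) x| ≤
        (((m+1)^n : ℕ) : ℝ≥0) * ((Mx : ℝ≥0∞) * ∫⁻ z in Ioo ((‖x‖ / R) ^ n) (2 * (‖x‖ / R) ^ n), (Iio (1:ℝ)).indicator f z * ENNReal.ofReal z⁻¹) := by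
      apply DmLen_le
      intro γ h1 hm
      have h1 : ENNReal.ofReal |convU (Ioo δ 1) (fun z => k z * c z ^ mdeg γ) c (multiPderiv γ Φ) x| ≤
          ∫⁻ z in Ioo δ 1, ‖k z * c z ^ mdeg γ * multiPderiv γ Φ (c z • x)‖ₑ := by
        rw [← Real.enorm_eq_ofReal_abs]
        exact enorm_integral_le_lintegral_enorm _
      refine h1.trans ?_
      rw [← lintegral_const_mul' _ _ ENNReal.coe_ne_top, Measure.restrict_congr_set (Ioo_ae_eq_Icc (a := (‖x‖ / R) ^ n)),
        ← lintegral_indicator measurableSet_Ioo, ← lintegral_indicator measurableSet_Icc]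
      apply lintegral_mono
      intro z
      by_cases hzS : z ∈ Ioo δ 1
      swap
      · simp [indicator_of_notMem hzS]
      by_cases h0 : multiPderiv γ Φ (c z • x) = 0
      · simp [indicator_of_mem hzS, h0]
      have hz0 : 0 < z := hδ.trans hzS.1
      obtain ⟨hA, hB⟩ := bumpF_mp ha haR γ (by assumption) _ h0
      rw [scale_ge_iff n hn z hz0 x a ha, hac] at hA
      rw [scale_le_iff n hn z hz0 x R hR] at hB
      have h2β : (2:ℝ) ^ β ≤ 2 := by
        conv_rhs => rw [← Real.rpow_one 2]
        exact Real.rpow_le_rpow_of_exponent_le (by norm_num) hβ1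
      have hz : z ∈ Icc ((‖x‖ / R) ^ n) (2 * (‖x‖ / R) ^ n) := ⟨hB, hA.trans (by gcongr)⟩
      simp only [indicator_of_mem hz, indicator_of_mem hzS, indicator_of_mem (show z ∈ Iio (1:ℝ) from hzS.2)]
      rw [Real.enorm_eq_ofReal_abs]
      have e1 : f z = ENNReal.ofReal (f z).toReal := (ENNReal.ofReal_toReal (hfM z)).symm
      rw [e1, ← ENNReal.ofReal_mul ENNReal.toReal_nonneg, ← ENNReal.ofReal_coe_nnreal, ← ENNReal.ofReal_mul (NNReal.coe_nonneg Mx)]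
      apply ENNReal.ofReal_le_ofReal
      obtain ⟨q1, q2⟩ := root_facts n hn z hz0
      have hcz : 0 < c z := inv_pos.2 q1
      rw [abs_mul, abs_mul, abs_of_nonneg (hko z hzS), abs_of_pos (pow_pos hcz _), mul_comm]
      apply mul_le_mul ((hMγ γ _).trans (by exact_mod_cast hMx γ hm)) _ (mul_nonneg (hko z hzS) (pow_pos hcz _).le) (NNReal.coe_nonneg Mx)
      simp only [hk_def, hc_def]
      rw [mul_assoc]
      apply mul_le_mul_of_nonneg_left _ ENNReal.toReal_nonneg
      have e2 : z ^ ((m:ℝ)/n - 1) = (z ^ ((n:ℝ)⁻¹)) ^ m * z⁻¹ := by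
        rw [← Real.rpow_natCast, ← Real.rpow_mul hz0.le, ← Real.rpow_neg_one z, ← Real.rpow_add hz0]
        congr 1
        rw [div_eq_inv_mul]; ring
      have q3 : z ^ ((n:ℝ)⁻¹) ≤ 1 := Real.rpow_le_one hz0.le hzS.2.le (by positivity)
      rw [e2, mul_right_comm]
      apply mul_le_of_le_one_left (by positivity)
      rw [inv_pow, ← div_eq_mul_inv]
      apply div_le_one_of_le₀ _ (by positivity)
      exact pow_le_pow_of_le_one q1.le q3 hm
    refine h2.trans (le_of_eq ?_)
    push_cast
    ring


lemma ann_meas (g : ℝ → ℝ≥0∞) (hg : Measurable g) : Measurable (fun τ : ℝ => ∫⁻ z in Ioo τ (2*τ), g z) := by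
  have hS : MeasurableSet {p : ℝ × ℝ | p.2 ∈ Ioo p.1 (2 * p.1)} :=
    (measurableSet_lt measurable_fst measurable_snd).inter
      (measurableSet_lt measurable_snd (measurable_const.mul measurable_fst))
  have hmm : Measurable fun p : ℝ × ℝ => {p : ℝ × ℝ | p.2 ∈ Ioo p.1 (2 * p.1)}.indicator (fun p => g p.2) p :=
    (hg.comp measurable_snd).indicator hS
  have := hmm.lintegral_prod_right' (ν := volume)
  convert this using 1
  funext τ
  rw [← lintegral_indicator measurableSet_Ioo]
  rfl

lemma kern_anti (g : ℝ → ℝ≥0∞) : Antitone (fun τ : ℝ => ∫⁻ z in Ioo τ 1, g z) :=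
  fun a b hab => lintegral_mono_set (Ioo_subset_Ioo_left hab)

lemma dir1 (m n : ℕ) (hm : 1 ≤ m) (hn : 2 ≤ n)
    (α R : ℝ) (hα : 0 ≤ α) (hR : 0 < R) (X Y : RINorm μU) (CS : ℝ)
    (H : ∀ (u : Euc n → ℝ) (Du : (Fin n → ℕ) → Euc n → ℝ),
          (∀ x y : Euc n, ‖x‖ = ‖y‖ → u x = u y) →
          HasWeakDerivsOn (Metric.ball (0 : Euc n) R) m u Du →
          Y.N (fun t => rearrR (nuA n α R) u
              ((nuA n α R (Metric.ball (0 : Euc n) R)).toReal * t))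
            ≤ ENNReal.ofReal CS *
                (X.N (fun t => rearrR (volume.restrict (Metric.ball (0 : Euc n) R)) u
                    (omegaN n * R ^ n * t)) +
                  X.N (fun t => rearrR (volume.restrict (Metric.ball (0 : Euc n) R))
                    (DmLen m Du) (omegaN n * R ^ n * t)))) :
    (∃ CH : ℝ, 0 < CH ∧
        ∀ f : ℝ → ℝ≥0∞, Measurable f →
          Y.N (fun t => ∫⁻ s in Set.Ioo (t ^ ((n : ℝ) / ((n : ℝ) + α))) 1,
              f s * ENNReal.ofReal (s ^ ((m : ℝ) / (n : ℝ) - 1)))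
            ≤ ENNReal.ofReal CH * X.N f) := by
  have hn1 : 1 ≤ n := by omega
  have hn0 : (0:ℝ) < n := by exact_mod_cast hn1
  have hm0 : (0:ℝ) < m := by exact_mod_cast hm
  set β : ℝ := (n : ℝ) / ((n : ℝ) + α) with hβ_def
  have hβ : 0 < β := by positivity
  have hβ1 : β ≤ 1 := div_le_one_of_le₀ (by linarith) (by positivity)
  obtain ⟨C, hC⟩ := dir1_core m n hn1 R β hR hβ hβ1
  obtain ⟨Ch, hCh, hardy⟩ := N_hardy X ((m:ℝ)/n) (by positivity)
  -- the measurable kernels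
  have hmt : ∀ f : ℝ → ℝ≥0∞, Measurable f → Measurable (fun s : ℝ => f s * ENNReal.ofReal (s ^ ((m : ℝ) / (n : ℝ) - 1))) :=
    fun f hf => hf.mul (by fun_prop)
  have hKβ : ∀ f : ℝ → ℝ≥0∞, Measurable (fun t : ℝ => ∫⁻ s in Set.Ioo (t ^ β) 1,
              f s * ENNReal.ofReal (s ^ ((m : ℝ) / (n : ℝ) - 1))) := fun f =>
    (kern_anti _).measurable.comp (by fun_prop)
  have key : ∀ (f : ℝ → ℝ≥0∞), Measurable f → ∀ δ : ℝ, 0 < δ → δ < 1 → ∀ M : ℝ≥0, (∀ z, f z ≤ M) →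
      (∀ z ≤ δ, f z = 0) → Y.N (fun t => ∫⁻ s in Set.Ioo (t ^ β) 1,
              f s * ENNReal.ofReal (s ^ ((m : ℝ) / (n : ℝ) - 1))) ≤
        2 * (ENNReal.ofReal CS * (Ch + C)) * X.N f := by
    intro f hf δ h1 h2 M h3 h4
    obtain ⟨u, Du, hrad, hw, hlow, hup, hD⟩ := hC f hf δ h1 h2 M h3 h4
    have hH := H u Du hrad hw
    rw [nuA_ball n hn1 α R hα hR, omegaN_eq n hn1 R hR, ← nuA_zero] at hH
    unfold rearrR at hH
    have hT0 : ∀ x, TnA n 0 R x = (‖x‖ / R) ^ n := by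
      intro x; rw [TnA, add_zero, Real.rpow_natCast]
    have hTβ : ∀ x, TnA n α R x ^ β = (‖x‖ / R) ^ n := by
      intro x
      rw [TnA, ← Real.rpow_mul (by positivity), hβ_def, mul_div_cancel₀ _ (by positivity), Real.rpow_natCast]
    set K : ℝ → ℝ≥0∞ := fun τ => ∫⁻ z in Ioo τ 1, f z * ENNReal.ofReal (z ^ ((m:ℝ)/n - 1)) with hK
    have hKa : Antitone K := kern_anti _
    have hKm : Measurable K := hKa.measurable
    set A : ℝ → ℝ≥0∞ := fun τ => ∫⁻ z in Ioo τ (2*τ), (Iio (1:ℝ)).indicator f z * ENNReal.ofReal z⁻¹ with hA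
    have hAm : Measurable A := ann_meas _ ((hf.indicator measurableSet_Iio).mul (by fun_prop))
    have x1 : X.N (fun t => rearr (nuA n 0 R) (fun x => ENNReal.ofReal |u x|) (VnA n 0 R * t)) ≤ Ch * X.N f := by
      refine (N_rearr_mono X _ _ _ (fun x => K (TnA n 0 R x)) (Eventually.of_forall fun x => ?_)).trans ?_
      · simp only [hT0]; exact hup x
      · rw [N_rearr_comp X _ _ (VnA_pos n hn1 0 R le_rfl hR) _ (TnA_meas n 0 R) (map_TnA n hn1 0 R le_rfl hR) K hKm]
        exact hardy f hf
    have x2 : X.N (fun t => rearr (nuA n 0 R) (fun x => ENNReal.ofReal |DmLen m Du x|) (VnA n 0 R * t)) ≤ C * X.N f := by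
      refine (N_rearr_smul X _ _ _ (fun x => A (TnA n 0 R x)) C (Eventually.of_forall fun x => ?_)).trans ?_
      · simp only [hT0]; exact hD x
      · rw [N_rearr_comp X _ _ (VnA_pos n hn1 0 R le_rfl hR) _ (TnA_meas n 0 R) (map_TnA n hn1 0 R le_rfl hR) A hAm]
        gcongr
        exact N_ann X f hf
    set G : ℝ → ℝ≥0∞ := fun s => K (2 ^ β * s ^ β) with hG
    have hGm : Measurable G := hKm.comp (by fun_prop)
    have hGa : AntitoneOn G (Ioi 0) := by
      intro a ha b hb hab
      apply hKa
      have : (0:ℝ) < a := ha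
      gcongr
    have y1 : Y.N (fun t => K (t ^ β)) ≤ 2 * Y.N G := by
      refine le_trans (Y.mono _ _ (hKβ f) (hGm.comp (measurable_id.div_const 2)) ?_) (N_dilate Y G hGa hGm)
      rw [μU, ae_restrict_iff' measurableSet_Ioo]
      refine Eventually.of_forall fun t ht => le_of_eq ?_
      simp only [hG, Function.comp_apply, id]
      rw [← Real.mul_rpow (by norm_num) (by linarith [ht.1]), mul_div_cancel₀ _ (by norm_num)]
    have y2 : Y.N G ≤ Y.N (fun t => rearr (nuA n α R) (fun x => ENNReal.ofReal |u x|) (VnA n α R * t)) := by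
      rw [← N_rearr_comp Y _ _ (VnA_pos n hn1 α R hα hR) _ (TnA_meas n α R) (map_TnA n hn1 α R hα hR) G hGm]
      refine N_rearr_mono Y _ _ _ _ (Eventually.of_forall fun x => ?_)
      simp only [hG, hTβ]
      exact hlow x
    calc Y.N (fun t => K (t ^ β)) ≤ 2 * Y.N G := y1
      _ ≤ 2 * (ENNReal.ofReal CS * (Ch * X.N f + C * X.N f)) := by
        gcongr
        exact y2.trans (hH.trans (by gcongr))
      _ = _ := by ring
  set B : ℝ≥0∞ := 2 * (ENNReal.ofReal CS * (Ch + C)) with hB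
  have hBt : B < ∞ := by
    simp only [hB]
    exact ENNReal.mul_lt_top (by norm_num) (ENNReal.mul_lt_top ENNReal.ofReal_lt_top
      (ENNReal.add_lt_top.2 ⟨hCh, ENNReal.coe_lt_top⟩))
  refine ⟨B.toReal + 1, by positivity, fun f hf => ?_⟩
  have hBle : B ≤ ENNReal.ofReal (B.toReal + 1) := by
    conv_lhs => rw [← ENNReal.ofReal_toReal hBt.ne]
    exact ENNReal.ofReal_le_ofReal (by linarith)
  refine le_trans ?_ (mul_le_mul_left hBle _)
  let F : ℕ → ℝ → ℝ≥0∞ := fun k => (Ioi (1 / ((k:ℝ) + 2))).indicator fun z => min (f z) k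
  have hFm : ∀ k, Measurable (F k) := fun k => (hf.min measurable_const).indicator measurableSet_Ioi
  have hFf : ∀ k z, F k z ≤ f z := by
    intro k z
    simp only [F, indicator]
    split_ifs <;> simp
  have hFmono : ∀ z, Monotone fun k => F k z := by
    intro z k l hkl
    simp only [F]
    have hkl' : (k:ℝ) ≤ l := by exact_mod_cast hkl
    have hsub : 1 / ((l:ℝ) + 2) ≤ 1 / ((k:ℝ) + 2) := by gcongr
    by_cases hz : 1 / ((k:ℝ) + 2) < z
    · rw [indicator_of_mem (show z ∈ Ioi _ from hz), indicator_of_mem (show z ∈ Ioi _ from hsub.trans_lt hz)]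
      gcongr
    · rw [indicator_of_notMem (show z ∉ Ioi _ from hz)]; exact zero_le
  have hFsup : ∀ z, 0 < z → (⨆ k, F k z) = f z := by
    intro z hz
    apply le_antisymm (iSup_le fun k => hFf k z)
    apply le_of_forall_lt
    intro c hc
    obtain ⟨k1, hk1⟩ := ENNReal.exists_nat_gt (ne_top_of_lt hc)
    obtain ⟨k2, hk2⟩ := exists_nat_one_div_lt hz
    refine lt_of_lt_of_le ?_ (le_iSup _ (max k1 k2))
    simp only [F]
    rw [indicator_of_mem]
    · refine lt_min hc (hk1.trans_le (by simp))
    · refine lt_of_le_of_lt ?_ hk2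
      have : (k2:ℝ) ≤ ((max k1 k2 : ℕ):ℝ) := by exact_mod_cast le_max_right _ _
      apply one_div_le_one_div_of_le (by positivity)
      linarith
  have hfat := Y.fatou (fun k t => ∫⁻ s in Set.Ioo (t ^ β) 1,
              F k s * ENNReal.ofReal (s ^ ((m : ℝ) / (n : ℝ) - 1))) (fun t => ∫⁻ s in Set.Ioo (t ^ β) 1,
              f s * ENNReal.ofReal (s ^ ((m : ℝ) / (n : ℝ) - 1))) (fun k => hKβ _) (hKβ f)
      (Eventually.of_forall fun t k l hkl => lintegral_mono fun s => by
        have := hFmono s hkl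
        simp only at this ⊢
        gcongr) (by
      rw [μU, ae_restrict_iff' measurableSet_Ioo]
      refine Eventually.of_forall fun t ht => ?_
      rw [← lintegral_iSup (fun k => hmt _ (hFm k))]
      · apply setLIntegral_congr_fun measurableSet_Ioo
        intro s hs
        have hs0 : 0 < s := lt_trans (Real.rpow_pos_of_pos ht.1 _) hs.1
        simp only
        rw [← ENNReal.iSup_mul, hFsup s hs0]
      · intro k l hkl s
        have := hFmono s hkl
        simp only at this ⊢
        gcongr)
  rw [← hfat]
  refine iSup_le fun k => ?_
  refine (key (F k) (hFm k) (1 / ((k:ℝ)+2)) (by positivity) ?_ k ?_ ?_).trans ?_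
  · rw [div_lt_one (by positivity)]
    have : (0:ℝ) ≤ k := by positivity
    linarith
  · intro z
    simp only [F, indicator]
    split_ifs <;> simp
  · intro z hz
    exact indicator_of_notMem (by simpa using hz) _
  · gcongr
    exact X.mono _ _ (hFm k) hf (Eventually.of_forall (hFf k))


lemma lamP_pos_ae (n : ℕ) : ∀ᵐ r ∂(lamP n), 0 < r := by
  have : lamP n ≪ volume.restrict (Ioi (0:ℝ)) := withDensity_absolutelyContinuous _ _
  exact this.ae_le (ae_restrict_mem measurableSet_Ioi)

lemma prod_pos_ae (n : ℕ) : ∀ᵐ p ∂((sigN n).prod (lamP n)), 0 < p.2 :=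
  (Measure.quasiMeasurePreserving_snd (μ := sigN n) (ν := lamP n)).ae (lamP_pos_ae n)

lemma polar_integrable (n : ℕ) (hn : 1 ≤ n) (F : Euc n → ℝ) (hF : Integrable F) :
    Integrable (fun p => F (polE n p)) ((sigN n).prod (lamP n)) := by
  have mp := polE_mp n hn
  rw [← mp.map_eq] at hF
  exact hF.comp_measurable mp.measurable

lemma polar_int (n : ℕ) (hn : 1 ≤ n) (F : Euc n → ℝ) (hF : Integrable F) :
    ∫ x, F x = ∫ θ, (∫ r, F (polE n (θ, r)) ∂(lamP n)) ∂(sigN n) := by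
  have mp := polE_mp n hn
  rw [← integral_prod _ (polar_integrable n hn F hF)]
  rw [← mp.map_eq] at hF
  conv_lhs => rw [← mp.map_eq]
  exact integral_map mp.measurable.aemeasurable hF.aestronglyMeasurable

lemma map_norm_vol (n : ℕ) (hn : 1 ≤ n) : (volume : Measure (Euc n)).map (fun x => ‖x‖) = sigN n univ • lamP n := by
  have mp := polE_mp n hn
  rw [← mp.map_eq, Measure.map_map measurable_norm mp.measurable, ← Measure.map_snd_prod]
  apply Measure.map_congr
  filter_upwards [prod_pos_ae n] with p hp
  exact polE_norm p.1 p.2 hp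

lemma norm_qmp (n : ℕ) (hn : 1 ≤ n) : Measure.QuasiMeasurePreserving (fun x : Euc n => ‖x‖) volume (lamP n) := by
  refine ⟨measurable_norm, ?_⟩
  rw [map_norm_vol n hn]
  exact Measure.smul_absolutelyContinuous

lemma int_norm (n : ℕ) (hn : 1 ≤ n) (v : ℝ → ℝ) (hv : Integrable v (lamP n)) :
    Integrable (fun x : Euc n => v ‖x‖) := by
  have : Integrable v ((volume : Measure (Euc n)).map (fun x => ‖x‖)) := by
    rw [map_norm_vol n hn]
    exact hv.smul_measure (measure_ne_top _ _)
  exact this.comp_measurable measurable_norm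

lemma int_mul_cs {E : Type*} [TopologicalSpace E] [MeasurableSpace E] [OpensMeasurableSpace E] (μ : Measure E) (V : E → ℝ) (hV : Integrable V μ)
    (Ψ : E → ℝ) (hc : Continuous Ψ) (hs : HasCompactSupport Ψ) : Integrable (fun x => V x * Ψ x) μ := by
  obtain ⟨C, hC⟩ := hs.exists_bound_of_continuous hc
  exact hV.mul_bdd hc.measurable.aestronglyMeasurable (Eventually.of_forall hC)

def eul {n : ℕ} (Ψ : Euc n → ℝ) (x : Euc n) : ℝ := fderiv ℝ Ψ x x

lemma eul_cont {n : ℕ} {Ψ : Euc n → ℝ} (h : Sm Ψ) : Continuous (eul Ψ) := by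
  unfold eul
  have : Continuous (fderiv ℝ Ψ) := h.continuous_fderiv (by simp)
  fun_prop

lemma eul_cs {n : ℕ} {Ψ : Euc n → ℝ} (h : HasCompactSupport Ψ) : HasCompactSupport (eul Ψ) := by
  have := h.fderiv (𝕜 := ℝ)
  refine this.mono' ?_
  refine subset_trans ?_ subset_closure
  intro x hx h0
  apply hx
  simp only [eul, h0]; simp

lemma eul_ray {n : ℕ} {Ψ : Euc n → ℝ} (h : Sm Ψ) (θ : Euc n) (r : ℝ) :
    HasDerivAt (fun s : ℝ => Ψ (s • θ)) (fderiv ℝ Ψ (r • θ) θ) r := by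
  have h1 : HasFDerivAt Ψ (fderiv ℝ Ψ (r • θ)) (r • θ) := (h.differentiable (by simp) _).hasFDerivAt
  have h2 : HasDerivAt (fun s : ℝ => s • θ) θ r := by
    simpa using (hasDerivAt_id r).smul_const θ
  exact h1.comp_hasDerivAt r h2

lemma sm_norm {n : ℕ} (g : ℝ → ℝ) (hg : ContDiff ℝ (⊤:ℕ∞) g) (ρ : ℝ) (hs : tsupport g ⊆ Ioo 0 ρ) :
    Sm (fun x : Euc n => g ‖x‖) := by
  rw [Sm, contDiff_iff_contDiffAt]
  intro x
  by_cases hx : x = 0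
  · have h0 : (0:ℝ) ∉ tsupport g := fun h => lt_irrefl _ (hs h).1
    have h1 : g =ᶠ[𝓝 0] 0 := notMem_tsupport_iff_eventuallyEq.1 h0
    have h2 : (fun x : Euc n => g ‖x‖) =ᶠ[𝓝 x] fun _ => 0 := by
      have : Tendsto (fun x : Euc n => ‖x‖) (𝓝 x) (𝓝 0) := by
        have := (continuous_norm (E := Euc n)).tendsto x
        rwa [hx, norm_zero, ← hx] at this
      exact this.eventually h1
    exact contDiffAt_const.congr_of_eventuallyEq h2
  · exact hg.contDiffAt.comp x (contDiffAt_norm ℝ hx)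

lemma cs_norm {n : ℕ} (g : ℝ → ℝ) (ρ : ℝ) (hc : HasCompactSupport g) (hs : tsupport g ⊆ Ioo 0 ρ) :
    HasCompactSupport (fun x : Euc n => g ‖x‖) ∧ tsupport (fun x : Euc n => g ‖x‖) ⊆ Metric.ball 0 ρ := by
  have h1 : tsupport (fun x : Euc n => g ‖x‖) ⊆ (fun x : Euc n => ‖x‖) ⁻¹' (tsupport g) := by
    apply closure_minimal
    · intro x hx
      exact subset_tsupport g hx
    · exact (isClosed_tsupport g).preimage continuous_norm
  have h2 : tsupport (fun x : Euc n => g ‖x‖) ⊆ Metric.ball 0 ρ := by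
    intro x hx
    have := (hs (h1 hx)).2
    simpa using this
  exact ⟨Metric.isCompact_of_isClosed_isBounded (isClosed_tsupport _) (Metric.isBounded_ball.subset h2), h2⟩

lemma ray_ev {n : ℕ} {Ψ : Euc n → ℝ} (h0 : (0 : Euc n) ∉ tsupport Ψ) (θ : Euc n) :
    (fun r : ℝ => Ψ (r • θ)) =ᶠ[𝓝 0] 0 := by
  have h1 : Ψ =ᶠ[𝓝 0] 0 := notMem_tsupport_iff_eventuallyEq.1 h0
  have : Tendsto (fun r : ℝ => r • θ) (𝓝 0) (𝓝 0) := by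
    have := (show Continuous (fun r : ℝ => r • θ) by fun_prop).tendsto 0
    rwa [zero_smul] at this
  exact this.eventually h1

lemma ray_test {n : ℕ} {Ψ : Euc n → ℝ} (h : Sm Ψ) (hc : HasCompactSupport Ψ) (ρ : ℝ)
    (hs : tsupport Ψ ⊆ Metric.ball 0 ρ \ {0}) (θ : SphE n) :
    ∃ g : ℝ → ℝ, ContDiff ℝ (⊤:ℕ∞) g ∧ HasCompactSupport g ∧ tsupport g ⊆ Ioo 0 ρ ∧
      ∀ r, 0 < r → g r = Ψ (polE n (θ, r)) ∧ r * deriv g r = eul Ψ (polE n (θ, r)) := by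
  have h0 : (0 : Euc n) ∉ tsupport Ψ := fun hh => (hs hh).2 rfl
  have hev := ray_ev h0 (θ : Euc n)
  let g : ℝ → ℝ := fun r => if 0 < r then Ψ (r • (θ : Euc n)) else 0
  have hgpos : ∀ r, 0 < r → g =ᶠ[𝓝 r] fun s => Ψ (s • (θ : Euc n)) := by
    intro r hr
    filter_upwards [lt_mem_nhds hr] with s hs
    simp [g, hs]
  have hg0 : g =ᶠ[𝓝 0] 0 := by
    filter_upwards [hev] with s hs
    simp only [g]; split_ifs
    · exact hs
    · rfl
  have hgneg : ∀ r, r < 0 → g =ᶠ[𝓝 r] 0 := by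
    intro r hr
    filter_upwards [gt_mem_nhds hr] with s hs
    simp [g, hs.le]
  have hgnonpos : ∀ r, r ≤ 0 → g =ᶠ[𝓝 r] 0 := by
    intro r hr
    rcases hr.lt_or_eq with h | h
    · exact hgneg r h
    · rw [h]; exact hg0
  have hcd : ContDiff ℝ (⊤:ℕ∞) g := by
    rw [contDiff_iff_contDiffAt]
    intro r
    by_cases hr : 0 < r
    · refine ContDiffAt.congr_of_eventuallyEq ?_ (hgpos r hr)
      have h' : ContDiff ℝ (⊤:ℕ∞) Ψ := h
      exact (h'.comp (contDiff_id.smul contDiff_const)).contDiffAt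
    · exact (contDiffAt_const (c := (0:ℝ))).congr_of_eventuallyEq (hgnonpos r (not_lt.1 hr))
  have hts : tsupport g ⊆ Ioo 0 ρ := by
    intro r hr
    have hr0 : 0 < r := by
      by_contra hcon
      exact notMem_tsupport_iff_eventuallyEq.2 (hgnonpos r (not_lt.1 hcon)) hr
    refine ⟨hr0, ?_⟩
    have hin : r • (θ : Euc n) ∈ tsupport Ψ := by
      by_contra hcon
      have h1 := notMem_tsupport_iff_eventuallyEq.1 hcon
      have h2 : Tendsto (fun s : ℝ => s • (θ : Euc n)) (𝓝 r) (𝓝 (r • (θ : Euc n))) :=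
        (show Continuous (fun r : ℝ => r • (θ : Euc n)) by fun_prop).tendsto r
      apply notMem_tsupport_iff_eventuallyEq.2 _ hr
      exact (hgpos r hr0).trans (h2.eventually h1)
    have := (hs hin).1
    have e := polE_norm θ r hr0
    rw [polE] at e
    simp only [Metric.mem_ball, dist_zero_right] at this
    simp only at e
    rwa [e] at this
  refine ⟨g, hcd, ?_, hts, fun r hr => ⟨by simp [g, hr, polE], ?_⟩⟩
  · exact Metric.isCompact_of_isClosed_isBounded (isClosed_tsupport _) ((Metric.isBounded_Ioo 0 ρ).subset hts)
  · rw [(hgpos r hr).deriv_eq, (eul_ray h (θ : Euc n) r).deriv, eul, polE]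
    simp

def sav (n : ℕ) (V : Euc n → ℝ) (r : ℝ) : ℝ := (sigN n univ).toReal⁻¹ * ∫ θ, V (polE n (θ, r)) ∂(sigN n)

lemma sav_int (n : ℕ) (hn : 1 ≤ n) (V : Euc n → ℝ) (hV : Integrable V) : Integrable (sav n V) (lamP n) :=
  ((polar_integrable n hn V hV).integral_prod_right).const_mul _

lemma radial_step (n : ℕ) (hn : 1 ≤ n) (ρ : ℝ) (c : ℝ) (V V' : Euc n → ℝ) (v : ℝ → ℝ)
    (hV : Integrable V) (hV' : Integrable V') (hV'0 : ∀ x, ρ ≤ ‖x‖ → V' x = 0)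
    (hv : ∀ᵐ x, V x = v ‖x‖)
    (hid : ∀ Ψ : Euc n → ℝ, Sm Ψ → HasCompactSupport Ψ → tsupport Ψ ⊆ Metric.ball 0 ρ →
      ∫ x, V' x * Ψ x = - ∫ x, V x * (c * Ψ x + eul Ψ x)) :
    ∃ v' : ℝ → ℝ, v' = sav n V' ∧ Integrable v' (lamP n) ∧ (∀ᵐ x, V' x = v' ‖x‖) ∧
      ∀ g : ℝ → ℝ, ContDiff ℝ (⊤:ℕ∞) g → HasCompactSupport g → tsupport g ⊆ Ioo 0 ρ →
        ∫ r, v' r * g r ∂(lamP n) = - ∫ r, v r * (c * g r + r * deriv g r) ∂(lamP n) := by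
  have hσ := sigN_pos n hn
  set σ := (sigN n univ).toReal with hσd
  have hV'p := polar_integrable n hn V' hV'
  have hvp : ∀ᵐ p ∂((sigN n).prod (lamP n)), V (polE n p) = v p.2 := by
    filter_upwards [(polE_mp n hn).quasiMeasurePreserving.ae hv, prod_pos_ae n] with p hp hp2
    rw [hp, polE_norm p.1 p.2 hp2]
  have hvpp : ∀ᵐ θ ∂(sigN n), ∀ᵐ r ∂(lamP n), V (polE n (θ, r)) = v r := Measure.ae_ae_of_ae_prod hvp
  have hF : ∀ Ψ : Euc n → ℝ, Sm Ψ → HasCompactSupport Ψ → Integrable fun x => V x * (c * Ψ x + eul Ψ x) := by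
    intro Ψ h1 h2
    have h1c : Continuous Ψ := h1.continuous
    have := eul_cont h1
    refine int_mul_cs _ V hV _ (by fun_prop) ?_
    exact (h2.mul_left (f := fun _ => c)).add (eul_cs h2)
  let v' : ℝ → ℝ := fun r => σ⁻¹ * ∫ θ, V' (polE n (θ, r)) ∂(sigN n)
  have hv'i : Integrable v' (lamP n) := (hV'p.integral_prod_right).const_mul _
  have h1d : ∀ g : ℝ → ℝ, ContDiff ℝ (⊤:ℕ∞) g → HasCompactSupport g → tsupport g ⊆ Ioo 0 ρ →
        ∫ r, v' r * g r ∂(lamP n) = - ∫ r, v r * (c * g r + r * deriv g r) ∂(lamP n) := by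
    intro g hg hgc hgs
    have hΨ : Sm (fun x : Euc n => g ‖x‖) := sm_norm g hg ρ hgs
    obtain ⟨hΨc, hΨs⟩ := cs_norm (n := n) g ρ hgc hgs
    have key := hid _ hΨ hΨc hΨs
    rw [polar_int n hn _ (int_mul_cs _ _ hV' _ hΨ.continuous hΨc), polar_int n hn _ (hF _ hΨ hΨc)] at key
    have e1 : ∫ θ, (∫ r, V (polE n (θ, r)) * (c * g ‖polE n (θ, r)‖ + eul (fun x : Euc n => g ‖x‖) (polE n (θ, r))) ∂(lamP n)) ∂(sigN n)
        = σ * ∫ r, v r * (c * g r + r * deriv g r) ∂(lamP n) := by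
      have : ∀ᵐ θ ∂(sigN n), (∫ r, V (polE n (θ, r)) * (c * g ‖polE n (θ, r)‖ + eul (fun x : Euc n => g ‖x‖) (polE n (θ, r))) ∂(lamP n)) = ∫ r, v r * (c * g r + r * deriv g r) ∂(lamP n) := by
        filter_upwards [hvpp] with θ hθ
        apply integral_congr_ae
        filter_upwards [hθ, lamP_pos_ae n] with r hr hr0
        rw [hr, polE_norm θ r hr0]
        congr 2
        have d1 := (eul_ray hΨ (θ : Euc n) r).deriv
        have d2 : (fun s : ℝ => g ‖s • (θ : Euc n)‖) =ᶠ[𝓝 r] g := by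
          filter_upwards [lt_mem_nhds hr0] with s hs
          have := polE_norm θ s hs
          rw [polE] at this
          rw [this]
        rw [d2.deriv_eq] at d1
        rw [eul, polE, d1]; simp
      rw [integral_congr_ae this, integral_const]
      simp [Measure.real, hσd]
    have e2 : ∫ θ, (∫ r, V' (polE n (θ, r)) * g ‖polE n (θ, r)‖ ∂(lamP n)) ∂(sigN n)
        = σ * ∫ r, v' r * g r ∂(lamP n) := by
      have hi := polar_integrable n hn _ (int_mul_cs _ _ hV' _ hΨ.continuous hΨc)
      rw [← integral_prod _ hi, integral_prod_symm _ hi, ← integral_const_mul]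
      apply integral_congr_ae
      filter_upwards [lamP_pos_ae n] with r hr0
      simp only [polE_norm _ r hr0]
      rw [integral_mul_const]
      simp only [v']
      field_simp
    rw [e1, e2] at key
    have := mul_left_cancel₀ hσ.ne' (key.trans (mul_neg _ _).symm)
    exact this
  refine ⟨v', rfl, hv'i, ?_, h1d⟩
  have hv'n := int_norm n hn v' hv'i
  set D : Euc n → ℝ := fun x => V' x - v' ‖x‖ with hD
  have hDi : Integrable D := hV'.sub hv'n
  have hU : IsOpen (Metric.ball (0 : Euc n) ρ \ {0}) := Metric.isOpen_ball.sdiff isClosed_singleton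
  have hz : ∀ᵐ x, x ∈ Metric.ball (0 : Euc n) ρ \ {0} → D x = 0 := by
    apply hU.ae_eq_zero_of_integral_contDiff_smul_eq_zero (hDi.locallyIntegrable.locallyIntegrableOn _)
    intro Ψ hΨ hΨc hΨs
    have hΨ' : Sm Ψ := hΨ
    have i1 := int_mul_cs _ _ hV' _ hΨ.continuous hΨc
    have i2 := int_mul_cs _ _ hv'n _ hΨ.continuous hΨc
    have : ∀ x, Ψ x • D x = V' x * Ψ x - v' ‖x‖ * Ψ x := by
      intro x; simp only [hD, smul_eq_mul]; ring
    simp only [this]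
    rw [integral_sub i1 i2, hid Ψ hΨ' hΨc (hΨs.trans sdiff_subset), sub_eq_zero,
      polar_int n hn _ i2, polar_int n hn _ (hF Ψ hΨ' hΨc), ← integral_neg]
    apply integral_congr_ae
    filter_upwards [hvpp] with θ hθ
    obtain ⟨g, hg, hgc, hgs, hgr⟩ := ray_test hΨ' hΨc ρ hΨs θ
    have a1 : ∫ r, v' ‖polE n (θ, r)‖ * Ψ (polE n (θ, r)) ∂(lamP n) = ∫ r, v' r * g r ∂(lamP n) := by
      apply integral_congr_ae
      filter_upwards [lamP_pos_ae n] with r hr0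
      rw [polE_norm _ r hr0, (hgr r hr0).1]
    rw [a1, h1d g hg hgc hgs]
    congr 1
    apply integral_congr_ae
    filter_upwards [hθ, lamP_pos_ae n] with r hr hr0
    rw [hr, (hgr r hr0).1, (hgr r hr0).2]
  have h00 : ∀ᵐ x : Euc n, x ≠ 0 := by
    have : Nonempty (Fin n) := ⟨⟨0, hn⟩⟩
    exact Measure.ae_ne volume 0
  filter_upwards [hz, h00] with x hx hx0
  by_cases hb : ‖x‖ < ρ
  · have := hx ⟨by simpa using hb, hx0⟩
    simp only [hD] at this
    linarith
  · push Not at hb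
    rw [hV'0 x hb]
    simp only [v']
    have : ∀ θ : SphE n, V' (polE n (θ, ‖x‖)) = 0 := fun θ =>
      hV'0 _ (by rwa [polE_norm θ _ (norm_pos_iff.2 hx0)])
    simp [this]


def Vrec {n : ℕ} (U : (Fin n → ℕ) → Euc n → ℝ) : ℕ → (Fin n → ℕ) → Euc n → ℝ
  | 0, γ => U γ
  | j + 1, γ => fun x => ∑ i, x i * Vrec U j (γ + Pi.single i 1) x

def TestF {n : ℕ} (ρ : ℝ) (Ψ : Euc n → ℝ) : Prop :=
  Sm Ψ ∧ HasCompactSupport Ψ ∧ tsupport Ψ ⊆ Metric.ball 0 ρ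

lemma TestF.pd {n : ℕ} {ρ : ℝ} {Ψ : Euc n → ℝ} (h : TestF ρ Ψ) (i : Fin n) : TestF ρ (pderiv1 i Ψ) :=
  ⟨pd_sm h.1 i, pd_cs h.2.1 i, (pd_tsupp Ψ i).trans h.2.2⟩

lemma TestF.coord {n : ℕ} {ρ : ℝ} {Ψ : Euc n → ℝ} (h : TestF ρ Ψ) (k : Fin n) : TestF ρ (fun x => x k * Ψ x) :=
  ⟨ContDiff.mul (coord_sm k) h.1, h.2.1.mul_left, (tsupport_mul_subset_right).trans h.2.2⟩

lemma abs_coord_le {n : ℕ} (x : Euc n) (i : Fin n) : |x i| ≤ ‖x‖ := by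
  simpa using EuclideanSpace.norm_eq x ▸ (Real.abs_le_sqrt (by
    have := Finset.single_le_sum (f := fun i => ‖x i‖ ^ 2) (fun j _ => by positivity) (Finset.mem_univ i)
    simpa using this) : |x i| ≤ Real.sqrt (∑ i, ‖x i‖ ^ 2))

lemma Vrec_zero {n : ℕ} (U : (Fin n → ℕ) → Euc n → ℝ) (ρ : ℝ) (hz : ∀ γ x, ρ ≤ ‖x‖ → U γ x = 0) (j : ℕ) :
    ∀ γ x, ρ ≤ ‖x‖ → Vrec U j γ x = 0 := by
  induction j with
  | zero => exact hz
  | succ j ih =>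
    intro γ x hx
    simp only [Vrec]
    exact Finset.sum_eq_zero fun i _ => by rw [ih _ x hx, mul_zero]

lemma Vrec_int {n : ℕ} (m : ℕ) (U : (Fin n → ℕ) → Euc n → ℝ) (ρ : ℝ) (hz : ∀ γ x, ρ ≤ ‖x‖ → U γ x = 0)
    (hU : ∀ γ, mdeg γ ≤ m → Integrable (U γ)) (j : ℕ) :
    ∀ γ, mdeg γ + j ≤ m → Integrable (Vrec U j γ) := by
  induction j with
  | zero => exact fun γ h => hU γ h
  | succ j ih =>
    intro γ h
    refine integrable_finsetSum _ fun i _ => ?_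
    have h1 := ih (γ + Pi.single i 1) (by rw [mdeg_add]; omega)
    refine (h1.norm.const_mul |ρ|).mono' ?_ (Eventually.of_forall fun x => ?_)
    · exact (show Continuous fun x : Euc n => x i by fun_prop).aestronglyMeasurable.mul h1.aestronglyMeasurable
    · rw [norm_mul]
      by_cases hx : ρ ≤ ‖x‖
      · rw [Vrec_zero U ρ hz j _ x hx]; simp
      · apply mul_le_mul_of_nonneg_right _ (norm_nonneg _)
        rw [Real.norm_eq_abs]
        exact (abs_coord_le x i).trans ((not_le.1 hx).le.trans (le_abs_self _))

lemma Vrec_bound {n : ℕ} (m : ℕ) (U : (Fin n → ℕ) → Euc n → ℝ) (x : Euc n) (M : ℝ)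
    (hM : ∀ γ, 1 ≤ mdeg γ → mdeg γ ≤ m → |U γ x| ≤ M) (j : ℕ) :
    ∀ γ, 1 ≤ mdeg γ + j → mdeg γ + j ≤ m → |Vrec U j γ x| ≤ (n * ‖x‖) ^ j * M := by
  induction j with
  | zero => intro γ h1 h2; simpa [Vrec] using hM γ h1 h2
  | succ j ih =>
    intro γ h1 h2
    simp only [Vrec]
    refine (Finset.abs_sum_le_sum_abs _ _).trans ?_
    have : ∀ i ∈ Finset.univ, |x i * Vrec U j (γ + Pi.single i 1) x| ≤ ‖x‖ * ((n * ‖x‖) ^ j * M) := by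
      intro i _
      rw [abs_mul]
      exact mul_le_mul (abs_coord_le x i) (ih _ (by rw [mdeg_add]; omega) (by rw [mdeg_add]; omega)) (abs_nonneg _) (norm_nonneg _)
    refine (Finset.sum_le_sum this).trans (le_of_eq ?_)
    simp
    ring

lemma Vrec_succ_int {n : ℕ} (m : ℕ) (U : (Fin n → ℕ) → Euc n → ℝ) (ρ : ℝ) (hz : ∀ γ x, ρ ≤ ‖x‖ → U γ x = 0)
    (hU : ∀ γ, mdeg γ ≤ m → Integrable (U γ)) (j : ℕ) (γ) (h : mdeg γ + j + 1 ≤ m) (Ψ : Euc n → ℝ) (hΨ : TestF ρ Ψ) :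
    ∫ x, Vrec U (j+1) γ x * Ψ x = ∑ k, ∫ x, Vrec U j (γ + Pi.single k 1) x * (x k * Ψ x) := by
  rw [← integral_finsetSum]
  · congr 1; funext x
    simp only [Vrec, Finset.sum_mul]
    exact Finset.sum_congr rfl fun k _ => by ring
  · intro k _
    have := hΨ.coord k
    exact int_mul_cs _ _ (Vrec_int m U ρ hz hU j _ (by rw [mdeg_add]; omega)) _ this.1.continuous this.2.1

lemma Vrec_ibp {n : ℕ} (m : ℕ) (U : (Fin n → ℕ) → Euc n → ℝ) (ρ : ℝ) (hz : ∀ γ x, ρ ≤ ‖x‖ → U γ x = 0)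
    (hU : ∀ γ, mdeg γ ≤ m → Integrable (U γ))
    (hw : ∀ γ, mdeg γ ≤ m → ∀ Ψ : Euc n → ℝ, TestF ρ Ψ →
      ∫ x, U 0 x * multiPderiv γ Ψ x = (-1 : ℝ) ^ mdeg γ * ∫ x, U γ x * Ψ x) (j : ℕ) :
    ∀ γ i, mdeg γ + j + 1 ≤ m → ∀ Ψ : Euc n → ℝ, TestF ρ Ψ →
      ∫ x, Vrec U j γ x * pderiv1 i Ψ x = - (∫ x, Vrec U j (γ + Pi.single i 1) x * Ψ x)
        - j * ∫ x, Vrec U (j-1) (γ + Pi.single i 1) x * Ψ x := by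
  induction j with
  | zero =>
    intro γ i h Ψ hΨ
    have h1 := hw γ (by omega) _ (hΨ.pd i)
    have h2 := hw (γ + Pi.single i 1) (by rw [mdeg_add]; omega) Ψ hΨ
    rw [mp_add hΨ.1, h1, mdeg_add, pow_succ] at h2
    have h3 : ((-1:ℝ) ^ mdeg γ) ≠ 0 := pow_ne_zero _ (by norm_num)
    simp only [Vrec, Nat.cast_zero, zero_mul, sub_zero]
    rw [mul_assoc] at h2
    rw [mul_left_cancel₀ h3 h2]; ring
  | succ j ih =>
    intro γ i h Ψ hΨ
    rw [Vrec_succ_int m U ρ hz hU j γ (by omega) _ (hΨ.pd i),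
      Vrec_succ_int m U ρ hz hU j _ (by rw [mdeg_add]; omega) _ hΨ]
    have e : ∀ k, ∫ x, Vrec U j (γ + Pi.single k 1) x * (x k * pderiv1 i Ψ x) =
        - (∫ x, Vrec U j (γ + Pi.single i 1 + Pi.single k 1) x * (x k * Ψ x)) -
          j * (∫ x, Vrec U (j-1) (γ + Pi.single i 1 + Pi.single k 1) x * (x k * Ψ x)) -
          if i = k then ∫ x, Vrec U j (γ + Pi.single i 1) x * Ψ x else 0 := by
      intro k
      have hk := ih (γ + Pi.single k 1) i (by rw [mdeg_add]; omega) _ (hΨ.coord k)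
      rw [add_right_comm] at hk
      rw [← hk, pd_coord_mul hΨ.1]
      have hI := Vrec_int m U ρ hz hU j (γ + Pi.single k 1) (by rw [mdeg_add]; omega)
      have i1 := int_mul_cs _ _ hI _ hΨ.1.continuous hΨ.2.1
      have i2 := int_mul_cs _ _ hI _ ((hΨ.pd i).coord k).1.continuous ((hΨ.pd i).coord k).2.1
      split_ifs with hik
      · subst hik
        rw [eq_sub_iff_add_eq, ← integral_add i2 i1]
        congr 1; funext x; ring
      · simp
    simp only [e]
    rw [Finset.sum_sub_distrib, Finset.sum_sub_distrib, Finset.sum_neg_distrib, Finset.sum_ite_eq]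
    simp only [Finset.mem_univ, if_true, Nat.add_sub_cancel]
    have : ∑ k, (j:ℝ) * (∫ x, Vrec U (j-1) (γ + Pi.single i 1 + Pi.single k 1) x * (x k * Ψ x)) = j * ∫ x, Vrec U j (γ + Pi.single i 1) x * Ψ x := by
      rw [← Finset.mul_sum]
      rcases j with _ | j
      · simp
      · rw [Vrec_succ_int m U ρ hz hU j _ (by rw [mdeg_add]; omega) _ hΨ]; rfl
    rw [this]; push_cast; ring

lemma eul_eq {n : ℕ} (Ψ : Euc n → ℝ) (x : Euc n) : eul Ψ x = ∑ i, x i * pderiv1 i Ψ x := by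
  have : x = ∑ i, x i • EuclideanSpace.single i (1:ℝ) := by
    ext k
    simp [Finset.sum_apply, Pi.single_apply]
  unfold eul pderiv1
  conv_lhs => rw [show (fderiv ℝ Ψ x) x = (fderiv ℝ Ψ x) (∑ i, x i • EuclideanSpace.single i (1:ℝ)) from congrArg _ this]
  rw [map_sum]
  simp

lemma Vrec_eul {n : ℕ} (m : ℕ) (U : (Fin n → ℕ) → Euc n → ℝ) (ρ : ℝ) (hz : ∀ γ x, ρ ≤ ‖x‖ → U γ x = 0)
    (hU : ∀ γ, mdeg γ ≤ m → Integrable (U γ))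
    (hw : ∀ γ, mdeg γ ≤ m → ∀ Ψ : Euc n → ℝ, TestF ρ Ψ →
      ∫ x, U 0 x * multiPderiv γ Ψ x = (-1 : ℝ) ^ mdeg γ * ∫ x, U γ x * Ψ x) (j : ℕ) (hj : j + 1 ≤ m)
      (Ψ : Euc n → ℝ) (hΨ : TestF ρ Ψ) :
    ∫ x, Vrec U (j+1) 0 x * Ψ x = - ∫ x, Vrec U j 0 x * ((n + j : ℝ) * Ψ x + eul Ψ x) := by
  have hI := Vrec_int m U ρ hz hU j 0 (by rw [mdeg_zero]; omega)
  have e : ∀ i, ∫ x, Vrec U j 0 x * pderiv1 i (fun x => x i * Ψ x) x = _ := fun i =>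
    Vrec_ibp m U ρ hz hU hw j 0 i (by rw [mdeg_zero]; omega) _ (hΨ.coord i)
  have s1 := Finset.sum_congr (rfl : (Finset.univ : Finset (Fin n)) = _) fun i _ => e i
  rw [Finset.sum_sub_distrib, Finset.sum_neg_distrib, ← Vrec_succ_int m U ρ hz hU j 0 (by rw [mdeg_zero]; omega) _ hΨ] at s1
  have : ∑ k, (j:ℝ) * (∫ x, Vrec U (j-1) (0 + Pi.single k 1) x * (x k * Ψ x)) = j * ∫ x, Vrec U j 0 x * Ψ x := by
    rw [← Finset.mul_sum]
    rcases j with _ | j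
    · simp
    · rw [Vrec_succ_int m U ρ hz hU j _ (by rw [mdeg_zero]; omega) _ hΨ]; rfl
  rw [this, ← integral_finsetSum] at s1
  · have e2 : ∀ x, ∑ i, Vrec U j 0 x * pderiv1 i (fun x => x i * Ψ x) x = Vrec U j 0 x * ((n:ℝ) * Ψ x + eul Ψ x) := by
      intro x
      rw [← Finset.mul_sum, eul_eq]
      congr 1
      simp only [pd_coord_mul hΨ.1, if_true]
      rw [Finset.sum_add_distrib]
      simp
    simp only [e2] at s1
    have i1 := int_mul_cs _ _ hI _ hΨ.1.continuous hΨ.2.1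
    have i3 : Integrable fun x => Vrec U j 0 x * ((n:ℝ) * Ψ x + eul Ψ x) := by
      have := eul_cont hΨ.1
      have := hΨ.1.continuous
      exact int_mul_cs _ _ hI _ (by fun_prop) ((hΨ.2.1.mul_left (f := fun _ => (n:ℝ))).add (eul_cs hΨ.2.1))
    have : ∫ x, Vrec U j 0 x * ((n + j : ℝ) * Ψ x + eul Ψ x) = (∫ x, Vrec U j 0 x * ((n:ℝ) * Ψ x + eul Ψ x)) + j * ∫ x, Vrec U j 0 x * Ψ x := by
      rw [← integral_const_mul, ← integral_add i3 (i1.const_mul _)]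
      congr 1; funext x; ring
    rw [this]
    linarith
  · intro i _
    have := (hΨ.coord i).pd i
    exact int_mul_cs _ _ hI _ this.1.continuous this.2.1

lemma Du_le_DmLen {n : ℕ} (m : ℕ) (Du : (Fin n → ℕ) → Euc n → ℝ) (x : Euc n) (γ : Fin n → ℕ)
    (h1 : 1 ≤ mdeg γ) (h2 : mdeg γ ≤ m) : |Du γ x| ≤ DmLen m Du x := by
  apply Real.abs_le_sqrt
  have hγ : ∀ i, γ i < m + 1 := fun i => by
    have : γ i ≤ mdeg γ := Finset.single_le_sum (f := γ) (fun _ _ => Nat.zero_le _) (Finset.mem_univ i)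
    omega
  have := Finset.single_le_sum (f := fun g : Fin n → Fin (m+1) => if 1 ≤ mdeg (fun i => (g i : ℕ)) ∧ mdeg (fun i => (g i : ℕ)) ≤ m
      then Du (fun i => (g i : ℕ)) x ^ 2 else 0) (fun g _ => by positivity) (Finset.mem_univ (fun i => ⟨γ i, hγ i⟩))
  refine le_trans ?_ this
  simp only
  rw [if_pos ⟨h1, h2⟩]


lemma lamP_integral (n : ℕ) (h : ℝ → ℝ) : ∫ r, h r ∂(lamP n) = ∫ r in Ioi (0:ℝ), r ^ (n-1) * h r := by
  rw [lamP, integral_withDensity_eq_integral_toReal_smul (by fun_prop) (Eventually.of_forall fun r => ENNReal.ofReal_lt_top)]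
  apply setIntegral_congr_fun measurableSet_Ioi
  intro r hr
  have : (0:ℝ) < r := hr
  simp only [smul_eq_mul]
  rw [ENNReal.toReal_ofReal (by positivity)]

lemma lamP_integrable (n : ℕ) (h : ℝ → ℝ) (hh : Integrable h (lamP n)) : IntegrableOn (fun r => r ^ (n-1) * h r) (Ioi (0:ℝ)) := by
  rw [lamP, integrable_withDensity_iff_integrable_smul' (by fun_prop) (Eventually.of_forall fun r => ENNReal.ofReal_lt_top)] at hh
  refine (integrable_congr ?_).1 hh
  filter_upwards [ae_restrict_mem measurableSet_Ioi] with r hr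
  have : (0:ℝ) < r := hr
  simp only [smul_eq_mul]
  rw [ENNReal.toReal_ofReal (by positivity)]

lemma div_test (k : ℕ) (hk : 1 ≤ k) (φ : ℝ → ℝ) (hφ : ContDiff ℝ (⊤:ℕ∞) φ) (ρ : ℝ)
    (hs : tsupport φ ⊆ Ioo 0 ρ) : ∃ g : ℝ → ℝ, ContDiff ℝ (⊤:ℕ∞) g ∧ HasCompactSupport g ∧ tsupport g ⊆ Ioo 0 ρ ∧
      ∀ r, 0 < r → g r = φ r / r ^ k ∧ k * g r + r * deriv g r = deriv φ r / r ^ (k-1) := by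
  have hts : tsupport (fun r => φ r / r ^ k) ⊆ tsupport φ := by
    simp only [div_eq_mul_inv]
    exact tsupport_mul_subset_left
  have hcd : ContDiff ℝ (⊤:ℕ∞) (fun r => φ r / r ^ k) := by
    rw [contDiff_iff_contDiffAt]
    intro r
    by_cases hr : r = 0
    · have h0 : r ∉ tsupport φ := fun h => by
        have := (hs h).1; rw [hr] at this; exact lt_irrefl _ this
      have h1 : φ =ᶠ[𝓝 r] 0 := notMem_tsupport_iff_eventuallyEq.1 h0
      refine (contDiffAt_const (c := (0:ℝ))).congr_of_eventuallyEq ?_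
      filter_upwards [h1] with s hs
      simp [hs]
    · exact hφ.contDiffAt.div (contDiffAt_id.pow k) (pow_ne_zero k hr)
  refine ⟨fun r => φ r / r ^ k, hcd, ?_, hts.trans hs, fun r hr => ⟨rfl, ?_⟩⟩
  · exact Metric.isCompact_of_isClosed_isBounded (isClosed_tsupport _) ((Metric.isBounded_Ioo 0 ρ).subset (hts.trans hs))
  · have hd : HasDerivAt φ (deriv φ r) r := (hφ.differentiable (by simp) r).hasDerivAt
    have := (hd.div (hasDerivAt_pow k r) (pow_ne_zero k hr.ne')).deriv
    have e : deriv (fun r => φ r / r ^ k) r = deriv (φ / fun x => x ^ k) r := rfl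
    rw [e, this]
    obtain ⟨l, rfl⟩ : ∃ l, k = l + 1 := ⟨k - 1, by omega⟩
    simp only [Nat.add_sub_cancel]
    field_simp
    ring

lemma radial_1d (m n : ℕ) (hn : 1 ≤ n) (U : (Fin n → ℕ) → Euc n → ℝ) (ρ : ℝ) (hz : ∀ γ x, ρ ≤ ‖x‖ → U γ x = 0)
    (hU : ∀ γ, mdeg γ ≤ m → Integrable (U γ)) (hrad : ∀ x y, ‖x‖ = ‖y‖ → U 0 x = U 0 y)
    (hw : ∀ γ, mdeg γ ≤ m → ∀ Ψ : Euc n → ℝ, TestF ρ Ψ →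
      ∫ x, U 0 x * multiPderiv γ Ψ x = (-1 : ℝ) ^ mdeg γ * ∫ x, U γ x * Ψ x) :
    ∃ w : ℕ → ℝ → ℝ, (∀ j ≤ m, ∀ᵐ x : Euc n, Vrec U j 0 x = ‖x‖ ^ j * w j ‖x‖) ∧
      (∀ j ≤ m, ∀ a : ℝ, 0 < a → IntegrableOn (w j) (Ioi a) ∧
        ∫⁻ r in Ioi a, ‖w j r‖ₑ ≤ ENNReal.ofReal ((a ^ (n - 1 + j))⁻¹) * ((sigN n univ)⁻¹ * ∫⁻ x, ‖Vrec U j 0 x‖ₑ)) ∧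
      ∀ j < m, ∀ φ : ℝ → ℝ, ContDiff ℝ (⊤:ℕ∞) φ → tsupport φ ⊆ Ioo 0 ρ →
        ∫ r in Ioi (0:ℝ), w (j+1) r * φ r = - ∫ r in Ioi (0:ℝ), w j r * deriv φ r := by
  have hσ := sigN_pos n hn
  have hVI : ∀ j ≤ m, Integrable (Vrec U j 0) := fun j hj => Vrec_int m U ρ hz hU j 0 (by rw [mdeg_zero]; omega)
  have h00 : ∀ᵐ x : Euc n, x ≠ 0 := by
    have : Nonempty (Fin n) := ⟨⟨0, hn⟩⟩
    exact Measure.ae_ne volume 0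
  let v : ℕ → ℝ → ℝ := fun j => sav n (Vrec U j 0)
  have hvI : ∀ j ≤ m, Integrable (v j) (lamP n) := fun j hj => sav_int n hn _ (hVI j hj)
  have step : ∀ j, j + 1 ≤ m → (∀ᵐ x, Vrec U j 0 x = v j ‖x‖) → (∀ᵐ x, Vrec U (j+1) 0 x = v (j+1) ‖x‖) ∧
      ∀ g : ℝ → ℝ, ContDiff ℝ (⊤:ℕ∞) g → HasCompactSupport g → tsupport g ⊆ Ioo 0 ρ →
        ∫ r, v (j+1) r * g r ∂(lamP n) = - ∫ r, v j r * ((n + j : ℝ) * g r + r * deriv g r) ∂(lamP n) := by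
    intro j hj h
    obtain ⟨v', rfl, _, h1, h2⟩ := radial_step n hn ρ (n + j) (Vrec U j 0) (Vrec U (j+1) 0) (v j) (hVI j (by omega)) (hVI _ hj)
      (Vrec_zero U ρ hz _ _) h (fun Ψ a b c => Vrec_eul m U ρ hz hU hw j hj Ψ ⟨a, b, c⟩)
    exact ⟨h1, h2⟩
  have hvV : ∀ j ≤ m, ∀ᵐ x, Vrec U j 0 x = v j ‖x‖ := by
    intro j
    induction j with
    | zero =>
      intro _
      filter_upwards [h00] with x hx0
      have : ∀ θ : SphE n, U 0 (polE n (θ, ‖x‖)) = U 0 x := fun θ =>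
        hrad _ _ (polE_norm θ _ (norm_pos_iff.2 hx0))
      simp only [v, sav, Vrec, this, integral_const, smul_eq_mul, Measure.real]
      field_simp
    | succ j ih => exact fun hj => (step j hj (ih (by omega))).1
  refine ⟨fun j r => v j r / r ^ j, ?_, ?_, ?_⟩
  · intro j hj
    filter_upwards [hvV j hj, h00] with x hx hx0
    rw [hx]
    have := norm_pos_iff.2 hx0
    field_simp
  · intro j hj a ha
    have h1 := (lamP_integrable n _ (hvI j hj)).mono_set (Ioi_subset_Ioi ha.le)
    have hb : ∀ r ∈ Ioi a, v j r / r ^ j = (r ^ (n-1) * v j r) * (r ^ (n - 1 + j))⁻¹ := by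
      intro r hr
      have : 0 < r := ha.trans hr
      rw [pow_add]; field_simp
    have hb2 : ∀ r ∈ Ioi a, ‖(r ^ (n - 1 + j))⁻¹‖ ≤ (a ^ (n-1+j))⁻¹ := by
      intro r hr
      have h3 : a < r := hr
      have : 0 < r := ha.trans hr
      rw [Real.norm_of_nonneg (by positivity)]
      gcongr
    constructor
    · rw [IntegrableOn, integrable_congr ((ae_restrict_mem measurableSet_Ioi).mono hb)]
      refine Integrable.mul_bdd h1 ?_ ((ae_restrict_mem measurableSet_Ioi).mono hb2)
      exact (Measurable.inv (by fun_prop)).aestronglyMeasurable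
    · have e1 : ∫⁻ r in Ioi a, ‖v j r / r ^ j‖ₑ ≤ ∫⁻ r in Ioi a, ENNReal.ofReal ((a ^ (n - 1 + j))⁻¹) * (ENNReal.ofReal (r ^ (n-1)) * ‖v j r‖ₑ) := by
        apply setLIntegral_mono' measurableSet_Ioi
        intro r hr
        have : 0 < r := ha.trans hr
        rw [hb r hr, enorm_mul, enorm_mul, mul_comm, Real.enorm_eq_ofReal (show 0 ≤ r ^ (n-1) by positivity)]
        gcongr
        rw [← ofReal_norm]
        exact ENNReal.ofReal_le_ofReal (hb2 r hr)
      refine e1.trans ?_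
      rw [lintegral_const_mul' _ _ ENNReal.ofReal_ne_top]
      gcongr
      have e2 : ∫⁻ x, ‖Vrec U j 0 x‖ₑ = sigN n univ * ∫⁻ r, ‖v j r‖ₑ ∂(lamP n) := by
        rw [lintegral_congr_ae ((hvV j hj).mono fun x hx => congrArg _ hx), ← smul_eq_mul, ← lintegral_smul_measure, ← map_norm_vol n hn]
        refine (lintegral_map' (f := fun r => ‖v j r‖ₑ) ?_ measurable_norm.aemeasurable).symm
        rw [map_norm_vol n hn]
        exact ((hvI j hj).aestronglyMeasurable.enorm).smul_measure _
      rw [e2, ← mul_assoc, ENNReal.inv_mul_cancel (fun h => by rw [h] at hσ; simp at hσ) (measure_ne_top _ _), one_mul, lamP,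
        lintegral_withDensity_eq_lintegral_mul₀ (by fun_prop)]
      · exact lintegral_mono_set (Ioi_subset_Ioi ha.le)
      · have h2 := lamP_integrable n _ (hvI j hj)
        have h3 : AEMeasurable (fun r => (r ^ (n-1))⁻¹ * (r ^ (n-1) * v j r)) (volume.restrict (Ioi 0)) :=
          (Measurable.inv (by fun_prop)).aemeasurable.mul h2.aestronglyMeasurable.aemeasurable
        have h4 : AEMeasurable (v j) (volume.restrict (Ioi 0)) := by
          refine h3.congr ?_
          filter_upwards [ae_restrict_mem measurableSet_Ioi] with r hr
          have : (0:ℝ) < r := hr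
          field_simp
        exact h4.enorm
  · intro j hj φ hφ hs
    obtain ⟨g, hg, hgc, hgs, hgr⟩ := div_test (n + j) (by omega) φ hφ ρ hs
    have := (step j hj (hvV j hj.le)).2 g hg hgc hgs
    rw [lamP_integral, lamP_integral] at this
    convert this using 1
    · apply setIntegral_congr_fun measurableSet_Ioi
      intro r hr
      have h0 : (0:ℝ) < r := hr
      simp only [(hgr r h0).1]
      obtain ⟨l, rfl⟩ : ∃ l, n = l + 1 := ⟨n - 1, by omega⟩
      simp only [Nat.add_sub_cancel]
      field_simp
      ring
    · congr 1
      apply setIntegral_congr_fun measurableSet_Ioi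
      intro r hr
      have h0 : (0:ℝ) < r := hr
      have := (hgr r h0).2
      push_cast at this
      simp only [this]
      obtain ⟨l, rfl⟩ : ∃ l, n = l + 1 := ⟨n - 1, by omega⟩
      simp only [Nat.add_sub_cancel, show l + 1 + j - 1 = l + j by omega, pow_add]
      field_simp


lemma compact_Ioo (ρ : ℝ) (hρ : 0 < ρ) (K : Set ℝ) (hK : IsCompact K) (hs : K ⊆ Ioo 0 ρ) :
    ∃ a b, 0 < a ∧ a < b ∧ b < ρ ∧ K ⊆ Ioo a b := by
  have h1 : IsCompact (insert (ρ/2) K) := hK.insert _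
  have h2 : insert (ρ/2) K ⊆ Ioo 0 ρ := insert_subset ⟨by linarith, by linarith⟩ hs
  obtain ⟨p, hp, hpl⟩ := h1.exists_isLeast (insert_nonempty _ _)
  obtain ⟨q, hq, hql⟩ := h1.exists_isGreatest (insert_nonempty _ _)
  have h3 := h2 hp
  have h4 := h2 hq
  have h5 := hpl hq
  refine ⟨p / 2, (q + ρ) / 2, by linarith [h3.1], by linarith [h3.1, h4.2], by linarith [h4.2], fun x hx => ⟨?_, ?_⟩⟩
  · have := hpl (mem_insert_of_mem _ hx); linarith [h3.1]
  · have := hql (mem_insert_of_mem _ hx); linarith [h4.2]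

lemma primit (a b : ℝ) (hab : a < b) (η : ℝ → ℝ) (hη : ContDiff ℝ (⊤:ℕ∞) η) (hs : tsupport η ⊆ Ioo a b)
    (h0 : ∫ x, η x = 0) : ∃ φ : ℝ → ℝ, ContDiff ℝ (⊤:ℕ∞) φ ∧ tsupport φ ⊆ Icc a b ∧ (∀ x, deriv φ x = η x) ∧
      (∀ x ≤ a, φ x = 0) ∧ (∀ x, b ≤ x → φ x = 0) := by
  have hd : ∀ x, HasDerivAt (fun r => ∫ t in a..r, η t) (η x) x := fun x =>
    intervalIntegral.integral_hasDerivAt_right (hη.continuous.intervalIntegrable _ _)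
      (hη.continuous.stronglyMeasurable.stronglyMeasurableAtFilter) hη.continuous.continuousAt
  have hz : ∀ x, x ∉ Ioo a b → η x = 0 := fun x hx => image_eq_zero_of_notMem_tsupport fun h => hx (hs h)
  have hl : ∀ x ≤ a, ∫ t in a..x, η t = 0 := by
    intro x hx
    rw [intervalIntegral.integral_congr (g := fun _ => 0)]
    · simp
    · intro t ht
      rw [uIcc_of_ge hx] at ht
      exact hz t fun h => by linarith [h.1, ht.2]
  have hr : ∀ x, b ≤ x → ∫ t in a..x, η t = 0 := by
    intro x hx
    rw [intervalIntegral.integral_of_le (hab.le.trans hx), setIntegral_eq_integral_of_forall_compl_eq_zero, h0]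
    intro t ht
    exact hz t fun h => ht ⟨h.1, h.2.le.trans hx⟩
  refine ⟨fun r => ∫ t in a..r, η t, ?_, ?_, fun x => (hd x).deriv, hl, hr⟩
  · rw [contDiff_infty_iff_deriv]
    refine ⟨fun x => (hd x).differentiableAt, ?_⟩
    rw [show deriv (fun r => ∫ t in a..r, η t) = η from funext fun x => (hd x).deriv]
    exact hη
  · apply closure_minimal _ isClosed_Icc
    intro x hx
    by_contra hcon
    apply hx
    rw [mem_Icc, not_and_or] at hcon
    rcases hcon with h | h
    · exact hl x (by linarith)
    · exact hr x (by linarith)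

lemma dbr (ρ : ℝ) (hρ : 0 < ρ) (w w' : ℝ → ℝ) (hw : ∀ a > 0, IntegrableOn w (Ioi a)) (hw' : ∀ a > 0, IntegrableOn w' (Ioi a))
    (hid : ∀ φ : ℝ → ℝ, ContDiff ℝ (⊤:ℕ∞) φ → tsupport φ ⊆ Ioo 0 ρ →
        ∫ r in Ioi (0:ℝ), w' r * φ r = - ∫ r in Ioi (0:ℝ), w r * deriv φ r) :
    ∃ c : ℝ, ∀ᵐ r, r ∈ Ioo 0 ρ → w r = c + ∫ s in ρ..r, w' s := by
  set F : ℝ → ℝ := fun r => ∫ s in ρ..r, w' s with hF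
  have hii : ∀ a, 0 < a → a < ρ → IntervalIntegrable w' volume a ρ := by
    intro a ha haρ
    rw [intervalIntegrable_iff_integrableOn_Ioc_of_le haρ.le]
    exact (hw' a ha).mono_set Ioc_subset_Ioi_self
  have hAC : ∀ a, 0 < a → a < ρ → AbsolutelyContinuousOnInterval F a ρ := fun a ha haρ =>
    (hii a ha haρ).absolutelyContinuousOnInterval_intervalIntegral (by simp)
  have conv : ∀ a, 0 < a → a < ρ → ∀ f : ℝ → ℝ, (∀ x, x ∉ Ioo a ρ → f x = 0) →
      ∫ r in Ioi (0:ℝ), f r = ∫ r in a..ρ, f r ∧ ∫ r, f r = ∫ r in a..ρ, f r := by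
    intro a ha haρ f hf
    have e2 : ∫ r, f r = ∫ r in a..ρ, f r := by
      rw [intervalIntegral.integral_of_le haρ.le, setIntegral_eq_integral_of_forall_compl_eq_zero]
      exact fun x hx => hf x fun h => hx ⟨h.1, h.2.le⟩
    refine ⟨?_, e2⟩
    rw [← e2, setIntegral_eq_integral_of_forall_compl_eq_zero]
    exact fun x hx => hf x fun h => hx (ha.trans h.1)
  let bmp : ContDiffBump (ρ/2) := ⟨ρ/8, ρ/4, by positivity, by linarith⟩
  let χ : ℝ → ℝ := bmp.normed volume
  have hχ : ContDiff ℝ (⊤:ℕ∞) χ := bmp.contDiff_normed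
  have hχ1 : ∫ x, χ x = 1 := bmp.integral_normed
  have hχs : tsupport χ ⊆ Ioo 0 ρ := by
    rw [bmp.tsupport_normed_eq, Real.closedBall_eq_Icc]
    intro x hx
    have h1 : ρ/2 - ρ/4 ≤ x := hx.1
    have h2 : x ≤ ρ/2 + ρ/4 := hx.2
    exact ⟨by linarith, by linarith⟩
  have hχc : HasCompactSupport χ := bmp.hasCompactSupport_normed
  let c : ℝ := ∫ x, (w x - F x) * χ x
  refine ⟨c, ?_⟩
  have hmain : ∀ᵐ r, r ∈ Ioo 0 ρ → w r - F r - c = 0 := by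
    apply isOpen_Ioo.ae_eq_zero_of_integral_contDiff_smul_eq_zero
    · rw [locallyIntegrableOn_iff isOpen_Ioo.isLocallyClosed]
      intro K hK hKc
      obtain ⟨a, b, ha, hab, hb, hKs⟩ := compact_Ioo ρ hρ K hKc hK
      have i1 : IntegrableOn w (Icc a b) := (hw (a/2) (by positivity)).mono_set fun x hx => by
        have := hx.1; simp only [mem_Ioi]; linarith
      have i2 : IntegrableOn F (Icc a b) := by
        have := (hAC a ha (hab.trans hb)).continuousOn
        rw [uIcc_of_le (hab.trans hb).le] at this
        exact (this.mono (Icc_subset_Icc_right hb.le)).integrableOn_compact isCompact_Icc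
      have i3 : IntegrableOn (fun _ : ℝ => c) (Icc a b) := integrableOn_const (by simp)
      exact (((i1.sub i2).sub i3)).mono_set (hKs.trans Ioo_subset_Icc_self)
    · intro ψ hψ hψc hψs
      obtain ⟨a, b, ha, hab, hb, hKs⟩ := compact_Ioo ρ hρ (tsupport ψ ∪ tsupport χ) (hψc.isCompact.union hχc.isCompact) (union_subset hψs hχs)
      have haρ := hab.trans hb
      have hψ0 : ∀ x, x ∉ Ioo a b → ψ x = 0 := fun x hx => image_eq_zero_of_notMem_tsupport fun h => hx (hKs (Or.inl h))
      have hχ0 : ∀ x, x ∉ Ioo a b → χ x = 0 := fun x hx => image_eq_zero_of_notMem_tsupport fun h => hx (hKs (Or.inr h))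
      set I := ∫ x, ψ x with hI
      have hψi : Integrable ψ := hψ.continuous.integrable_of_hasCompactSupport hψc
      have hχi : Integrable χ := hχ.continuous.integrable_of_hasCompactSupport hχc
      let η : ℝ → ℝ := fun x => ψ x - I * χ x
      have hη : ContDiff ℝ (⊤:ℕ∞) η := hψ.sub (contDiff_const.mul hχ)
      have hηs : tsupport η ⊆ Ioo a b := by
        refine (closure_minimal ?_ ((isClosed_tsupport ψ).union (isClosed_tsupport χ))).trans hKs
        intro x hx
        by_contra hcon
        rw [mem_union, not_or] at hcon
        apply hx
        simp [η, image_eq_zero_of_notMem_tsupport hcon.1, image_eq_zero_of_notMem_tsupport hcon.2]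
      have hη0 : ∫ x, η x = 0 := by
        simp only [η]
        rw [integral_sub hψi (hχi.const_mul _), integral_const_mul, hχ1]; simp [hI]
      obtain ⟨φ, hφ, hφs, hφd, hφl, hφr⟩ := primit a b hab η hη hηs hη0
      have hφs' : tsupport φ ⊆ Ioo 0 ρ := fun x hx => ⟨ha.trans_le (hφs hx).1, (hφs hx).2.trans_lt hb⟩
      have h1 := hid φ hφ hφs'
      have hφ0 : ∀ x, x ∉ Ioo a ρ → φ x = 0 := by
        intro x hx
        rw [mem_Ioo, not_and_or, not_lt, not_lt] at hx
        rcases hx with h | h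
        · exact hφl x h
        · exact hφr x (hb.le.trans h)
      have hη00 : ∀ x, x ∉ Ioo a ρ → η x = 0 := fun x hx => image_eq_zero_of_notMem_tsupport fun h => hx ⟨(hηs h).1, (hηs h).2.trans hb⟩
      simp only [hφd] at h1
      rw [(conv a ha haρ (fun r => w' r * φ r) fun x hx => by simp [hφ0 x hx]).1,
        (conv a ha haρ (fun r => w r * η r) fun x hx => by simp [hη00 x hx]).1] at h1
      have hφAC : AbsolutelyContinuousOnInterval φ a ρ :=
        ContDiffOn.absolutelyContinuousOnInterval ((hφ.of_le (by simp)).contDiffOn)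
      have h2 := (hAC a ha haρ).integral_mul_deriv_eq_deriv_mul hφAC
      rw [hφl a le_rfl, hφr ρ hb.le] at h2
      simp only [hφd] at h2
      have h3 : ∫ x in a..ρ, deriv F x * φ x = ∫ x in a..ρ, w' x * φ x := by
        apply intervalIntegral.integral_congr_ae
        filter_upwards [(hii a ha haρ).ae_hasDerivAt_integral] with x hx hxm
        rw [(hx (uIoc_subset_uIcc hxm) ρ (by simp)).deriv]
      rw [h3, h1] at h2
      -- integrability
      have hFc : ContinuousOn F (uIcc a ρ) := (hAC a ha haρ).continuousOn
      have hwI : IntervalIntegrable w volume a ρ := by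
        rw [intervalIntegrable_iff_integrableOn_Ioc_of_le haρ.le]
        exact (hw a ha).mono_set Ioc_subset_Ioi_self
      have hhI : IntervalIntegrable (fun x => w x - F x) volume a ρ := hwI.sub hFc.intervalIntegrable
      have j1 := hhI.mul_continuousOn hψ.continuous.continuousOn
      have j2 := hhI.mul_continuousOn hχ.continuous.continuousOn
      have k1 : ∫ x in a..ρ, (w x - F x) * η x = 0 := by
        have : ∀ x, (w x - F x) * η x = w x * η x - F x * η x := fun x => by ring
        simp only [this]
        rw [intervalIntegral.integral_sub (hwI.mul_continuousOn hη.continuous.continuousOn) (hFc.intervalIntegrable.mul_continuousOn hη.continuous.continuousOn), h2]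
        ring
      have k2 : ∫ x in a..ρ, (w x - F x) * η x = (∫ x in a..ρ, (w x - F x) * ψ x) - I * ∫ x in a..ρ, (w x - F x) * χ x := by
        rw [← intervalIntegral.integral_const_mul, ← intervalIntegral.integral_sub j1 (j2.const_mul _)]
        congr 1; funext x; simp only [η]; ring
      have sub : ∀ x, x ∉ Ioo a ρ → x ∉ Ioo a b := fun x hx h => hx ⟨h.1, h.2.trans hb⟩
      have hc : c = ∫ x in a..ρ, (w x - F x) * χ x :=
        (conv a ha haρ (fun x => (w x - F x) * χ x) fun x hx => by simp [hχ0 x (sub x hx)]).2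
      have hI' : I = ∫ x in a..ρ, ψ x := (conv a ha haρ ψ fun x hx => hψ0 x (sub x hx)).2
      rw [(conv a ha haρ (fun x => ψ x • (w x - F x - c)) fun x hx => by simp [hψ0 x (sub x hx)]).2]
      have : ∀ x, ψ x • (w x - F x - c) = (w x - F x) * ψ x - c * ψ x := fun x => by simp only [smul_eq_mul]; ring
      simp only [this]
      rw [intervalIntegral.integral_sub j1 ((hψ.continuous.intervalIntegrable _ _).const_mul _), intervalIntegral.integral_const_mul, ← hI']
      rw [← hc] at k2
      linarith
  filter_upwards [hmain] with r hr hrm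
  have := hr hrm
  linarith

lemma dbr_bound (a ρ : ℝ) (ha : 0 < a) (haρ : 2 * a ≤ ρ) (w w' : ℝ → ℝ) (hw : ∀ a > 0, IntegrableOn w (Ioi a)) (hw' : ∀ a > 0, IntegrableOn w' (Ioi a))
    (hid : ∀ φ : ℝ → ℝ, ContDiff ℝ (⊤:ℕ∞) φ → tsupport φ ⊆ Ioo 0 ρ →
        ∫ r in Ioi (0:ℝ), w' r * φ r = - ∫ r in Ioi (0:ℝ), w r * deriv φ r) :
    ∀ᵐ r, r ∈ Ioo 0 ρ → ‖w r‖ₑ ≤ (ENNReal.ofReal a⁻¹ * (∫⁻ s in Ioi a, ‖w s‖ₑ) + ∫⁻ s in Ioi a, ‖w' s‖ₑ) +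
      ∫⁻ s in Ioo r ρ, ‖w' s‖ₑ := by
  obtain ⟨c, hc⟩ := dbr ρ (by linarith) w w' hw hw' hid
  have hb : ∀ r, r < ρ → ‖∫ s in ρ..r, w' s‖ₑ ≤ ∫⁻ s in Ioo r ρ, ‖w' s‖ₑ := by
    intro r hr
    rw [intervalIntegral.integral_of_ge hr.le, enorm_neg]
    refine (enorm_integral_le_lintegral_enorm _).trans (le_of_eq ?_)
    exact setLIntegral_congr Ioo_ae_eq_Ioc.symm
  have hcb : ‖c‖ₑ ≤ ENNReal.ofReal a⁻¹ * (∫⁻ s in Ioi a, ‖w s‖ₑ) + ∫⁻ s in Ioi a, ‖w' s‖ₑ := by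
    have e1 : ∀ᵐ s, s ∈ Ioo a (2*a) → ‖c‖ₑ ≤ ‖w s‖ₑ + ∫⁻ s in Ioi a, ‖w' s‖ₑ := by
      filter_upwards [hc] with s hs hsm
      have h1 := hs ⟨ha.trans hsm.1, hsm.2.trans_le haρ⟩
      have h2 : c = w s - ∫ s in ρ..s, w' s := by linarith
      rw [h2]
      refine (enorm_sub_le).trans ?_
      gcongr
      exact (hb s (hsm.2.trans_le haρ)).trans (lintegral_mono_set fun x hx => hsm.1.trans hx.1)
    have e2 : ∫⁻ _ in Ioo a (2*a), ‖c‖ₑ ≤ ∫⁻ s in Ioo a (2*a), (‖w s‖ₑ + ∫⁻ s in Ioi a, ‖w' s‖ₑ) :=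
      lintegral_mono_ae ((ae_restrict_iff' measurableSet_Ioo).2 e1)
    rw [lintegral_add_right _ measurable_const] at e2
    simp only [lintegral_const, Measure.restrict_apply_univ, Real.volume_Ioo] at e2
    rw [show 2 * a - a = a by ring] at e2
    have e3 : ∫⁻ s in Ioo a (2*a), ‖w s‖ₑ ≤ ∫⁻ s in Ioi a, ‖w s‖ₑ := lintegral_mono_set Ioo_subset_Ioi_self
    have e4 : ENNReal.ofReal a⁻¹ * ENNReal.ofReal a = 1 := by
      rw [← ENNReal.ofReal_mul (by positivity), inv_mul_cancel₀ ha.ne', ENNReal.ofReal_one]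
    calc ‖c‖ₑ = ENNReal.ofReal a⁻¹ * (‖c‖ₑ * ENNReal.ofReal a) := by rw [mul_left_comm, e4, mul_one]
      _ ≤ ENNReal.ofReal a⁻¹ * ((∫⁻ s in Ioi a, ‖w s‖ₑ) + (∫⁻ s in Ioi a, ‖w' s‖ₑ) * ENNReal.ofReal a) := by
        gcongr
        exact e2.trans (by gcongr)
      _ = _ := by rw [mul_add, mul_left_comm _ _ (ENNReal.ofReal a), e4, mul_one]
  filter_upwards [hc] with r hr hrm
  rw [hr hrm]
  refine (enorm_add_le _ _).trans ?_
  gcongr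
  exact hb r hrm.2


def cK (R : ℝ) : ℕ → ℝ≥0∞
  | 0 => 1
  | k + 1 => 1 + ENNReal.ofReal R * cK R k

lemma cK_ne_top (R : ℝ) (k : ℕ) : cK R k ≠ ∞ := by
  induction k with
  | zero => simp [cK]
  | succ k ih => simp only [cK]; finiteness

lemma tonelli_tri (r ρ : ℝ) (hr : 0 ≤ r) (g : ℝ → ℝ≥0∞) (hg : AEMeasurable g (volume.restrict (Ioo r ρ))) :
    ∫⁻ t in Ioo r ρ, ∫⁻ s in Ioo t ρ, g s ≤ ∫⁻ s in Ioo r ρ, ENNReal.ofReal s * g s := by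
  have e1 : ∀ t ∈ Ioo r ρ, ∫⁻ s in Ioo t ρ, g s = ∫⁻ s in Ioo r ρ, (Ioi t).indicator g s := by
    intro t ht
    rw [setLIntegral_indicator measurableSet_Ioi]
    congr 2
    ext s
    simp only [mem_inter_iff, mem_Ioi, mem_Ioo]
    constructor
    · rintro ⟨h1, h2⟩; exact ⟨h1, ht.1.trans h1, h2⟩
    · rintro ⟨h1, h2, h3⟩; exact ⟨h1, h3⟩
  rw [setLIntegral_congr_fun measurableSet_Ioo e1]
  rw [lintegral_lintegral_swap]
  · refine lintegral_mono_ae ?_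
    filter_upwards [ae_restrict_mem measurableSet_Ioo] with s hs
    calc ∫⁻ t in Ioo r ρ, (Ioi t).indicator g s = ∫⁻ t in Ioo r ρ, (Iio s).indicator (fun _ => g s) t := by
          apply lintegral_congr
          intro t
          simp [indicator]
      _ ≤ _ := by
          rw [setLIntegral_indicator measurableSet_Iio, setLIntegral_const, mul_comm]
          gcongr
          refine (measure_mono (show _ ⊆ Ioo r s from fun t ht => ⟨ht.2.1, ht.1⟩)).trans ?_
          rw [Real.volume_Ioo]
          exact ENNReal.ofReal_le_ofReal (by linarith)
  · have : (Function.uncurry fun t s => (Ioi t).indicator g s) = {p : ℝ × ℝ | p.1 < p.2}.indicator (fun p => g p.2) := by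
      ext ⟨t, s⟩
      simp [indicator]
    rw [this]
    exact (hg.comp_snd).indicator (measurableSet_lt measurable_fst measurable_snd)

lemma iter1 (m : ℕ) (a ρ R : ℝ) (ha : 0 < a) (haρ : 2 * a ≤ ρ) (hρR : ρ ≤ R) (w : ℕ → ℝ → ℝ)
    (hI : ∀ j ≤ m, ∀ a > 0, IntegrableOn (w j) (Ioi a)) (S : ℝ≥0∞)
    (hS : ∀ j ≤ m, ∫⁻ r in Ioi a, ‖w j r‖ₑ ≤ S)
    (hid : ∀ j < m, ∀ φ : ℝ → ℝ, ContDiff ℝ (⊤:ℕ∞) φ → tsupport φ ⊆ Ioo 0 ρ →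
        ∫ r in Ioi (0:ℝ), w (j+1) r * φ r = - ∫ r in Ioi (0:ℝ), w j r * deriv φ r) (k : ℕ) :
    ∀ j, j + (k + 1) = m → ∀ᵐ r, r ∈ Ioo 0 ρ → ‖w j r‖ₑ ≤ cK R k * (ENNReal.ofReal a⁻¹ * S + S) +
      ∫⁻ s in Ioo r ρ, ENNReal.ofReal (s ^ k) * ‖w m s‖ₑ := by
  have hb : ∀ j, j + 1 ≤ m → ∀ᵐ r, r ∈ Ioo 0 ρ → ‖w j r‖ₑ ≤ (ENNReal.ofReal a⁻¹ * S + S) +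
      ∫⁻ s in Ioo r ρ, ‖w (j+1) s‖ₑ := by
    intro j hj
    filter_upwards [dbr_bound a ρ ha haρ (w j) (w (j+1)) (hI j (by omega)) (hI (j+1) hj) (hid j hj)] with r h hr
    refine (h hr).trans ?_
    gcongr
    · exact hS j (by omega)
    · exact hS _ hj
  induction k with
  | zero =>
    intro j hj
    simpa [cK, ← hj] using hb j (by omega)
  | succ k ih =>
    intro j hj
    have h1 := ih (j+1) (by omega)
    filter_upwards [hb j (by omega)] with r h hr
    refine (h hr).trans ?_
    have hgm : AEMeasurable (fun s => ENNReal.ofReal (s ^ k) * ‖w m s‖ₑ) (volume.restrict (Ioo r ρ)) := by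
      refine AEMeasurable.mul (show Measurable fun s : ℝ => ENNReal.ofReal (s ^ k) by fun_prop).aemeasurable ?_
      exact (((hI m le_rfl r hr.1).mono_set (fun s hs => hs.1 : Ioo r ρ ⊆ Ioi r)).aestronglyMeasurable).enorm
    have h2 : ∫⁻ s in Ioo r ρ, ‖w (j+1) s‖ₑ ≤ ∫⁻ t in Ioo r ρ, (cK R k * (ENNReal.ofReal a⁻¹ * S + S) +
      ∫⁻ s in Ioo t ρ, ENNReal.ofReal (s ^ k) * ‖w m s‖ₑ) := by
      refine lintegral_mono_ae ?_
      rw [ae_restrict_iff' measurableSet_Ioo]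
      filter_upwards [h1] with t h ht
      exact h ⟨hr.1.trans ht.1, ht.2⟩
    rw [lintegral_add_left measurable_const] at h2
    have h3 := tonelli_tri r ρ hr.1.le _ hgm
    have h4 : ∫⁻ t in Ioo r ρ, cK R k * (ENNReal.ofReal a⁻¹ * S + S) ≤ ENNReal.ofReal R * (cK R k * (ENNReal.ofReal a⁻¹ * S + S)) := by
      rw [setLIntegral_const, mul_comm, Real.volume_Ioo]
      gcongr
      linarith [hr.1]
    have h5 : ∫⁻ s in Ioo r ρ, ENNReal.ofReal s * (ENNReal.ofReal (s ^ k) * ‖w m s‖ₑ) = ∫⁻ s in Ioo r ρ, (ENNReal.ofReal (s ^ (k+1)) * ‖w m s‖ₑ) := by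
      apply setLIntegral_congr_fun measurableSet_Ioo
      intro s hs
      have : 0 ≤ s := (hr.1.trans hs.1).le
      simp only
      rw [← mul_assoc, ← ENNReal.ofReal_mul this, pow_succ']
    rw [h5] at h3
    have h6 := h2.trans (add_le_add h4 h3)
    refine (add_le_add_right h6 _).trans (le_of_eq ?_)
    simp only [cK]
    ring


lemma DmLen_nonneg {n : ℕ} (m : ℕ) (Du : (Fin n → ℕ) → Euc n → ℝ) (x : Euc n) : 0 ≤ DmLen m Du x :=
  Real.sqrt_nonneg _

lemma norm_ae (n : ℕ) (hn : 1 ≤ n) {p : ℝ → Prop} (h : ∀ᵐ r : ℝ, p r) : ∀ᵐ x : Euc n, p ‖x‖ := by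
  apply (norm_qmp n hn).ae
  have : lamP n ≪ volume := (withDensity_absolutelyContinuous _ _).trans Measure.absolutelyContinuous_restrict
  exact this.ae_le h

def Utr {n : ℕ} (ρ : ℝ) (u : Euc n → ℝ) (Du : (Fin n → ℕ) → Euc n → ℝ) (γ : Fin n → ℕ) : Euc n → ℝ :=
  (Metric.ball (0 : Euc n) ρ).indicator (if γ = 0 then u else Du γ)

lemma Utr_weak {n : ℕ} (m : ℕ) (R ρ : ℝ) (hρR : ρ < R) (u : Euc n → ℝ) (Du : (Fin n → ℕ) → Euc n → ℝ)
    (hw : HasWeakDerivsOn (Metric.ball (0 : Euc n) R) m u Du) :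
    (∀ γ x, ρ ≤ ‖x‖ → Utr ρ u Du γ x = 0) ∧ (∀ γ, mdeg γ ≤ m → Integrable (Utr ρ u Du γ)) ∧
    ∀ γ, mdeg γ ≤ m → ∀ Ψ : Euc n → ℝ, TestF ρ Ψ →
      ∫ x, Utr ρ u Du 0 x * multiPderiv γ Ψ x = (-1 : ℝ) ^ mdeg γ * ∫ x, Utr ρ u Du γ x * Ψ x := by
  obtain ⟨h1, h2, h3⟩ := hw
  refine ⟨fun γ x hx => indicator_of_notMem (by simpa using hx) _, ?_, ?_⟩
  · intro γ hγ
    have hl : LocallyIntegrableOn (if γ = 0 then u else Du γ) (Metric.ball (0 : Euc n) R) volume := by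
      split_ifs
      · exact h1
      · exact h2 γ hγ
    rw [Utr, integrable_indicator_iff measurableSet_ball]
    exact (hl.integrableOn_compact_subset (Metric.closedBall_subset_ball hρR) (isCompact_closedBall 0 ρ)).mono_set
      Metric.ball_subset_closedBall
  · intro γ hγ Ψ hΨ
    by_cases h0 : γ = 0
    · rw [h0, mp_zero, mdeg_zero]; simp
    have hts : tsupport Ψ ⊆ Metric.ball (0 : Euc n) R := hΨ.2.2.trans (Metric.ball_subset_ball hρR.le)
    have key := h3 γ hγ Ψ hΨ.1 hΨ.2.1 hts
    have conv : ∀ (γ' : Fin n → ℕ) (Φ : Euc n → ℝ), tsupport Φ ⊆ tsupport Ψ →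
        ∫ x, Utr ρ u Du γ' x * Φ x = ∫ x in Metric.ball (0 : Euc n) R, (if γ' = 0 then u else Du γ') x * Φ x := by
      intro γ' Φ hΦ
      rw [← integral_indicator measurableSet_ball]
      congr 1
      ext x
      by_cases hx : x ∈ Metric.ball (0 : Euc n) ρ
      · rw [indicator_of_mem (Metric.ball_subset_ball hρR.le hx), Utr, indicator_of_mem hx]
      · have : Φ x = 0 := image_eq_zero_of_notMem_tsupport fun h => hx (hΨ.2.2 (hΦ h))
        simp [indicator, this]
    rw [conv 0 _ (mp_tsupp hΨ.1 γ), conv γ Ψ subset_rfl]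
    simpa [h0] using key

lemma Utr_le {n : ℕ} (m : ℕ) (ρ : ℝ) (u : Euc n → ℝ) (Du : (Fin n → ℕ) → Euc n → ℝ) (x : Euc n) (γ : Fin n → ℕ)
    (h1 : 1 ≤ mdeg γ) (h2 : mdeg γ ≤ m) : |Utr ρ u Du γ x| ≤ DmLen m Du x := by
  have h0 : γ ≠ 0 := by rintro rfl; simp [mdeg_zero] at h1
  simp only [Utr, h0, if_false, indicator]
  split_ifs
  · exact Du_le_DmLen m Du x γ h1 h2
  · simpa using DmLen_nonneg m Du x

lemma core_rho (m n : ℕ) (hm : 1 ≤ m) (hn : 1 ≤ n) (R : ℝ) (hR : 0 < R) : ∃ C : ℝ≥0∞, C ≠ ∞ ∧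
    ∀ (u : Euc n → ℝ) (Du : (Fin n → ℕ) → Euc n → ℝ), (∀ x y : Euc n, ‖x‖ = ‖y‖ → u x = u y) →
      HasWeakDerivsOn (Metric.ball (0 : Euc n) R) m u Du → ∀ ρ, R / 2 ≤ ρ → ρ < R →
      ∃ W : ℝ → ℝ≥0∞, Measurable W ∧
        (∀ᵐ x : Euc n, W ‖x‖ ≤ ((n : ℝ≥0) ^ m : ℝ≥0) * ENNReal.ofReal |DmLen m Du x|) ∧
        ∀ᵐ x : Euc n, ‖x‖ < ρ → ENNReal.ofReal |u x| ≤ C * (∫⁻ y in Metric.ball (0 : Euc n) R,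
          (ENNReal.ofReal |u y| + ENNReal.ofReal |DmLen m Du y|)) +
          ∫⁻ s in Ioo ‖x‖ R, ENNReal.ofReal (s ^ (m - 1)) * W s := by
  set a := R / 4 with ha_def
  have ha : 0 < a := by positivity
  set D : ℝ≥0∞ := ∑ j ∈ Finset.range (m + 1), ENNReal.ofReal ((a ^ (n - 1 + j))⁻¹) * ((sigN n univ)⁻¹ *
    (1 + ENNReal.ofReal ((n * R) ^ j))) with hD
  have hσ := sigN_pos n hn
  have hσ' : sigN n univ ≠ 0 := fun h => by simp [h] at hσ
  refine ⟨cK R (m - 1) * (ENNReal.ofReal a⁻¹ * D + D), ?_, ?_⟩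
  · have hDt : D ≠ ∞ := by
      rw [hD]
      refine ENNReal.sum_ne_top.2 fun j _ => ?_
      refine ENNReal.mul_ne_top ENNReal.ofReal_ne_top (ENNReal.mul_ne_top (ENNReal.inv_ne_top.2 hσ') (by finiteness))
    have := cK_ne_top R (m-1)
    finiteness
  intro u Du hrad hwk ρ h1 h2
  obtain ⟨hz, hU, hw⟩ := Utr_weak m R ρ h2 u Du hwk
  have hrad' : ∀ x y : Euc n, ‖x‖ = ‖y‖ → Utr ρ u Du 0 x = Utr ρ u Du 0 y := by
    intro x y hxy
    simp [Utr, indicator, hxy, hrad x y hxy]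
  obtain ⟨w, hw1, hw2, hw3⟩ := radial_1d m n hn (Utr ρ u Du) ρ hz hU hrad' hw
  set I := ∫⁻ y in Metric.ball (0 : Euc n) R,
          (ENNReal.ofReal |u y| + ENNReal.ofReal |DmLen m Du y|) with hI
  have hVb : ∀ j ≤ m, ∫⁻ x, ‖Vrec (Utr ρ u Du) j 0 x‖ₑ ≤ (1 + ENNReal.ofReal ((n * R) ^ j)) * I := by
    intro j hj
    rw [hI, ← lintegral_indicator measurableSet_ball, ← lintegral_const_mul' _ _ (by finiteness)]
    refine lintegral_mono fun x => ?_
    by_cases hx : ‖x‖ < ρ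
    · have hxR : x ∈ Metric.ball (0 : Euc n) R := by simpa using hx.trans h2
      simp only
      rw [indicator_of_mem hxR]
      rcases Nat.eq_zero_or_pos j with rfl | hj0
      · have : Vrec (Utr ρ u Du) 0 0 x = u x := by
          have : x ∈ Metric.ball (0 : Euc n) ρ := by simpa using hx
          simp [Vrec, Utr, this]
        rw [this, Real.enorm_eq_ofReal_abs]
        calc ENNReal.ofReal |u x| = 1 * ENNReal.ofReal |u x| := (one_mul _).symm
          _ ≤ _ := by gcongr <;> exact le_self_add
      · have hb := Vrec_bound m (Utr ρ u Du) x (DmLen m Du x) (fun γ a b => Utr_le m ρ u Du x γ a b) j 0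
          (by rw [mdeg_zero]; omega) (by rw [mdeg_zero]; omega)
        rw [Real.enorm_eq_ofReal_abs]
        have hb2 : (n * ‖x‖) ^ j * DmLen m Du x ≤ (n * R) ^ j * |DmLen m Du x| := by
          have := DmLen_nonneg m Du x
          rw [abs_of_nonneg this]
          gcongr
          exact (hx.trans h2).le
        refine (ENNReal.ofReal_le_ofReal (hb.trans hb2)).trans ?_
        rw [ENNReal.ofReal_mul (by positivity)]
        gcongr
        · exact le_add_self
        · exact le_add_self
    · rw [Vrec_zero _ ρ hz j 0 x (not_lt.1 hx)]; simp
  have hS : ∀ j ≤ m, ∫⁻ r in Ioi a, ‖w j r‖ₑ ≤ D * I := by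
    intro j hj
    refine (hw2 j hj a ha).2.trans ?_
    have e1 : ENNReal.ofReal ((a ^ (n - 1 + j))⁻¹) * ((sigN n univ)⁻¹ * ∫⁻ x, ‖Vrec (Utr ρ u Du) j 0 x‖ₑ) ≤
        ENNReal.ofReal ((a ^ (n - 1 + j))⁻¹) * ((sigN n univ)⁻¹ * (1 + ENNReal.ofReal ((n * R) ^ j))) * I := by
      rw [mul_assoc, mul_assoc]
      gcongr
      exact hVb j hj
    refine e1.trans ?_
    gcongr
    rw [hD]
    exact Finset.single_le_sum (f := fun j => ENNReal.ofReal ((a ^ (n - 1 + j))⁻¹) * ((sigN n univ)⁻¹ *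
      (1 + ENNReal.ofReal ((n * R) ^ j)))) (fun _ _ => zero_le) (Finset.mem_range.2 (by omega))
  have hit := iter1 m a ρ R ha (by rw [ha_def]; linarith) h2.le w (fun j hj b hb => (hw2 j hj b hb).1) (D * I) hS hw3 (m-1) 0 (by omega)
  have hmeas : AEMeasurable (fun r => ‖w m r‖ₑ) (volume.restrict (Ioo 0 ρ)) := by
    have hun : Ioo 0 ρ ⊆ ⋃ k : ℕ, Ioi (1 / ((k:ℝ) + 1)) := by
      intro r hr
      obtain ⟨k, hk⟩ := exists_nat_one_div_lt hr.1
      exact mem_iUnion.2 ⟨k, hk⟩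
    have : AEMeasurable (fun r => ‖w m r‖ₑ) (volume.restrict (⋃ k : ℕ, Ioi (1 / ((k:ℝ) + 1)))) := by
      rw [aemeasurable_iUnion_iff]
      intro k
      exact (hw2 m le_rfl _ (by positivity)).1.aestronglyMeasurable.enorm
    exact this.mono_measure (Measure.restrict_mono hun le_rfl)
  have hWe : ∀ᵐ r : ℝ, r ∈ Ioo 0 ρ → ‖w m r‖ₑ = hmeas.mk _ r := by
    have := hmeas.ae_eq_mk
    rwa [EventuallyEq, ae_restrict_iff' measurableSet_Ioo] at this
  have h00 : ∀ᵐ x : Euc n, x ≠ 0 := by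
    have : Nonempty (Fin n) := ⟨⟨0, hn⟩⟩
    exact Measure.ae_ne volume 0
  refine ⟨(Ioo 0 ρ).indicator (hmeas.mk _), hmeas.measurable_mk.indicator measurableSet_Ioo, ?_, ?_⟩
  · filter_upwards [norm_ae n hn hWe, hw1 m le_rfl, h00] with x hx hV hx0
    by_cases hxρ : ‖x‖ ∈ Ioo 0 ρ
    · rw [indicator_of_mem hxρ, ← hx hxρ]
      have hb := Vrec_bound m (Utr ρ u Du) x (DmLen m Du x) (fun γ a b => Utr_le m ρ u Du x γ a b) m 0
          (by rw [mdeg_zero]; omega) (by rw [mdeg_zero]; omega)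
      rw [hV, abs_mul, abs_of_pos (pow_pos hxρ.1 m), mul_pow, mul_comm ((n:ℝ)^m), mul_assoc] at hb
      have hb' := le_of_mul_le_mul_left hb (pow_pos hxρ.1 m)
      rw [Real.enorm_eq_ofReal_abs, abs_of_nonneg (DmLen_nonneg m Du x)]
      refine (ENNReal.ofReal_le_ofReal hb').trans (le_of_eq ?_)
      rw [ENNReal.ofReal_mul (by positivity)]
      congr 1
      rw [ENNReal.ofReal_pow (by positivity)]
      simp
    · rw [indicator_of_notMem hxρ]; exact zero_le
  · filter_upwards [norm_ae n hn hit, hw1 0 (by omega), h00] with x hx hV hx0 hxρ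
    have hxm : ‖x‖ ∈ Ioo 0 ρ := ⟨norm_pos_iff.2 hx0, hxρ⟩
    have hxb : x ∈ Metric.ball (0 : Euc n) ρ := by simpa using hxρ
    have hV' : u x = w 0 ‖x‖ := by
      simpa [Vrec, Utr, hxb] using hV
    rw [← Real.enorm_eq_ofReal_abs, hV']
    refine (hx hxm).trans (add_le_add (le_of_eq (by ring)) ?_)
    calc ∫⁻ s in Ioo ‖x‖ ρ, ENNReal.ofReal (s ^ (m-1)) * ‖w m s‖ₑ =
        ∫⁻ s in Ioo ‖x‖ ρ, ENNReal.ofReal (s ^ (m-1)) * (Ioo 0 ρ).indicator (hmeas.mk _) s := by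
          apply lintegral_congr_ae
          rw [EventuallyEq, ae_restrict_iff' measurableSet_Ioo]
          filter_upwards [hWe] with s hs hsm
          have : s ∈ Ioo 0 ρ := ⟨hxm.1.trans hsm.1, hsm.2⟩
          rw [indicator_of_mem this, hs this]
      _ ≤ _ := lintegral_mono_set (Ioo_subset_Ioo_right h2.le)

lemma core_R (m n : ℕ) (hm : 1 ≤ m) (hn : 1 ≤ n) (R : ℝ) (hR : 0 < R) : ∃ C : ℝ≥0∞, C ≠ ∞ ∧
    ∀ (u : Euc n → ℝ) (Du : (Fin n → ℕ) → Euc n → ℝ), (∀ x y : Euc n, ‖x‖ = ‖y‖ → u x = u y) →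
      HasWeakDerivsOn (Metric.ball (0 : Euc n) R) m u Du → 
      ∃ W : ℝ → ℝ≥0∞, Measurable W ∧
        (∀ᵐ x : Euc n, W ‖x‖ ≤ ((n : ℝ≥0) ^ m : ℝ≥0) * ENNReal.ofReal |DmLen m Du x|) ∧
        ∀ᵐ x : Euc n, ‖x‖ < R → ENNReal.ofReal |u x| ≤ C * (∫⁻ y in Metric.ball (0 : Euc n) R,
          (ENNReal.ofReal |u y| + ENNReal.ofReal |DmLen m Du y|)) +
          ∫⁻ s in Ioo ‖x‖ R, ENNReal.ofReal (s ^ (m - 1)) * W s := by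
  obtain ⟨C, hC, h⟩ := core_rho m n hm hn R hR
  refine ⟨C, hC, fun u Du hrad hw => ?_⟩
  have h' : ∀ k : ℕ, ∃ W : ℝ → ℝ≥0∞, Measurable W ∧
        (∀ᵐ x : Euc n, W ‖x‖ ≤ ((n : ℝ≥0) ^ m : ℝ≥0) * ENNReal.ofReal |DmLen m Du x|) ∧
        ∀ᵐ x : Euc n, ‖x‖ < R - (R / 2) / ((k:ℝ) + 1) → ENNReal.ofReal |u x| ≤ C * (∫⁻ y in Metric.ball (0 : Euc n) R,
          (ENNReal.ofReal |u y| + ENNReal.ofReal |DmLen m Du y|)) +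
          ∫⁻ s in Ioo ‖x‖ R, ENNReal.ofReal (s ^ (m - 1)) * W s := by
    intro k
    refine h u Du hrad hw _ ?_ ?_
    · have : (R / 2) / ((k:ℝ) + 1) ≤ R / 2 := div_le_self (by positivity) (by linarith [(Nat.cast_nonneg k : (0:ℝ) ≤ k)])
      linarith
    · have : 0 < (R / 2) / ((k:ℝ) + 1) := by positivity
      linarith
  choose W hWm hWa hWb using h'
  refine ⟨fun r => ⨆ k, W k r, Measurable.iSup hWm, ?_, ?_⟩
  · filter_upwards [ae_all_iff.2 hWa] with x hx
    exact iSup_le hx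
  · filter_upwards [ae_all_iff.2 hWb] with x hx hxR
    obtain ⟨k, hk⟩ := exists_nat_one_div_lt (show 0 < (R - ‖x‖) / (R / 2) by
      have : 0 < R - ‖x‖ := by linarith
      positivity)
    rw [lt_div_iff₀ (by positivity)] at hk
    have hk' : (R / 2) / ((k:ℝ) + 1) < R - ‖x‖ := by
      calc (R / 2) / ((k:ℝ) + 1) = 1 / ((k:ℝ)+1) * (R/2) := by ring
        _ < _ := hk
    refine (hx k (by linarith)).trans ?_
    gcongr
    exact le_iSup (fun k => W k _) k


lemma subst_le (m n : ℕ) (hm : 1 ≤ m) (hn : 1 ≤ n) (R r : ℝ) (hR : 0 < R) (hr : 0 < r) (W : ℝ → ℝ≥0∞) :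
    ∫⁻ s in Ioo r R, ENNReal.ofReal (s ^ (m - 1)) * W s ≤ ENNReal.ofReal (R ^ m / n) *
      ∫⁻ τ in Ioo ((r / R) ^ n) 1, W (R * τ ^ ((n:ℝ)⁻¹)) * ENNReal.ofReal (τ ^ ((m:ℝ) / (n:ℝ) - 1)) := by
  have hn0 : (0:ℝ) < n := by exact_mod_cast hn
  have hpos : ∀ τ ∈ Ioo ((r / R) ^ n) 1, 0 < τ := fun τ hτ => lt_trans (by positivity) hτ.1
  set g : ℝ → ℝ := fun τ => R * τ ^ ((n:ℝ)⁻¹) with hg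
  have hsub : Ioo r R ⊆ g '' Ioo ((r / R) ^ n) 1 := by
    intro s hs
    have hs0 : 0 < s := hr.trans hs.1
    refine ⟨(s / R) ^ n, ⟨?_, ?_⟩, ?_⟩
    · have := hs.1
      gcongr
    · exact pow_lt_one₀ (by positivity) ((div_lt_one hR).2 hs.2) (by omega)
    · simp only [hg]
      rw [Real.pow_rpow_inv_natCast (by positivity) (by omega)]
      field_simp
  refine (lintegral_mono_set hsub).trans (le_of_eq ?_)
  have hd : ∀ τ ∈ Ioo ((r / R) ^ n) 1, HasDerivWithinAt g (R * ((n:ℝ)⁻¹ * τ ^ ((n:ℝ)⁻¹ - 1))) (Ioo ((r / R) ^ n) 1) τ := by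
    intro τ hτ
    exact ((Real.hasDerivAt_rpow_const (Or.inl (hpos τ hτ).ne')).const_mul R).hasDerivWithinAt
  have hinj : InjOn g (Ioo ((r / R) ^ n) 1) := by
    intro x hx y hy hxy
    have : x ^ ((n:ℝ)⁻¹) = y ^ ((n:ℝ)⁻¹) := mul_left_cancel₀ hR.ne' hxy
    exact (Real.rpow_left_inj (hpos x hx).le (hpos y hy).le (by positivity)).1 this
  rw [lintegral_image_eq_lintegral_abs_deriv_mul measurableSet_Ioo hd hinj,
    ← lintegral_const_mul' _ _ ENNReal.ofReal_ne_top]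
  apply setLIntegral_congr_fun measurableSet_Ioo
  intro τ hτ
  have h0 := hpos τ hτ
  have e : R * ((n:ℝ)⁻¹ * τ ^ ((n:ℝ)⁻¹ - 1)) * (g τ) ^ (m - 1) = R ^ m / n * τ ^ ((m:ℝ) / (n:ℝ) - 1) := by
    simp only [hg]
    obtain ⟨k, rfl⟩ : ∃ k, m = k + 1 := ⟨m - 1, by omega⟩
    simp only [Nat.add_sub_cancel]
    rw [mul_pow, ← Real.rpow_natCast (τ ^ ((n:ℝ)⁻¹)) k, ← Real.rpow_mul h0.le]
    have : τ ^ (((k + 1 : ℕ) : ℝ) / (n:ℝ) - 1) = τ ^ ((n:ℝ)⁻¹ - 1) * τ ^ ((n:ℝ)⁻¹ * (k:ℝ)) := by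
      rw [← Real.rpow_add h0]
      congr 1
      push_cast
      field_simp
      ring
    rw [this]
    field_simp
    ring
  have hg0 : 0 ≤ g τ := by simp only [hg]; positivity
  calc ENNReal.ofReal |R * ((n:ℝ)⁻¹ * τ ^ ((n:ℝ)⁻¹ - 1))| * (ENNReal.ofReal (g τ ^ (m-1)) * W (g τ))
      = ENNReal.ofReal (R * ((n:ℝ)⁻¹ * τ ^ ((n:ℝ)⁻¹ - 1)) * (g τ) ^ (m - 1)) * W (g τ) := by
        rw [abs_of_nonneg (by positivity), ← mul_assoc, ← ENNReal.ofReal_mul (by positivity)]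
    _ = _ := by
        rw [e, ENNReal.ofReal_mul (by positivity)]
        ring

lemma dir2 (m n : ℕ) (hm : 1 ≤ m) (hn : 2 ≤ n)
    (α R : ℝ) (hα : 0 ≤ α) (hR : 0 < R) (X Y : RINorm μU) (CH : ℝ)
    (H : ∀ f : ℝ → ℝ≥0∞, Measurable f →
          Y.N (fun t => ∫⁻ s in Set.Ioo (t ^ ((n : ℝ) / ((n : ℝ) + α))) 1,
              f s * ENNReal.ofReal (s ^ ((m : ℝ) / (n : ℝ) - 1)))
            ≤ ENNReal.ofReal CH * X.N f) :
    ∃ CS : ℝ, 0 < CS ∧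
        ∀ (u : Euc n → ℝ) (Du : (Fin n → ℕ) → Euc n → ℝ),
          (∀ x y : Euc n, ‖x‖ = ‖y‖ → u x = u y) →
          HasWeakDerivsOn (Metric.ball (0 : Euc n) R) m u Du →
          Y.N (fun t => rearrR (nuA n α R) u
              ((nuA n α R (Metric.ball (0 : Euc n) R)).toReal * t))
            ≤ ENNReal.ofReal CS *
                (X.N (fun t => rearrR (volume.restrict (Metric.ball (0 : Euc n) R)) u
                    (omegaN n * R ^ n * t)) +
                  X.N (fun t => rearrR (volume.restrict (Metric.ball (0 : Euc n) R))
                    (DmLen m Du) (omegaN n * R ^ n * t))) := by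
  have hn1 : 1 ≤ n := by omega
  have hn0 : (0:ℝ) < n := by exact_mod_cast hn1
  obtain ⟨C, hC, hcore⟩ := core_R m n hm hn1 R hR
  obtain ⟨C0, hC0, hint⟩ := lintegral_le_N X
  have hY1 : Y.N (fun _ => 1) ≠ ∞ := by
    have := N_one Y
    exact this.ne
  set K : ℝ≥0 := Real.toNNReal (R ^ m / n) with hK
  set A : ℝ≥0∞ := C * (ENNReal.ofReal (VnA n 0 R) * C0) * Y.N (fun _ => 1) +
    K * (ENNReal.ofReal CH * ((n : ℝ≥0) ^ m : ℝ≥0)) with hA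
  have hAt : A ≠ ∞ := by
    have := hC0.ne
    rw [hA]; finiteness
  refine ⟨A.toReal + 1, by positivity, fun u Du hrad hw => ?_⟩
  obtain ⟨W, hWm, hWa, hWb⟩ := hcore u Du hrad hw
  have hu : AEMeasurable u (volume.restrict (Metric.ball (0 : Euc n) R)) :=
    hw.1.aestronglyMeasurable.aemeasurable
  have hD : AEMeasurable (DmLen m Du) (volume.restrict (Metric.ball (0 : Euc n) R)) := by
    have : AEMeasurable (fun x => ∑ g : Fin n → Fin (m + 1),
        if 1 ≤ mdeg (fun i => (g i : ℕ)) ∧ mdeg (fun i => (g i : ℕ)) ≤ m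
          then Du (fun i => (g i : ℕ)) x ^ 2 else 0) (volume.restrict (Metric.ball (0 : Euc n) R)) := by
      refine Finset.aemeasurable_fun_sum _ fun g _ => ?_
      by_cases hg : 1 ≤ mdeg (fun i => (g i : ℕ)) ∧ mdeg (fun i => (g i : ℕ)) ≤ m
      · simp only [hg, and_self, if_true]
        exact ((hw.2.1 _ hg.2).aestronglyMeasurable.aemeasurable).pow_const 2
      · simp only [hg, if_false]
        exact aemeasurable_const
    exact Real.continuous_sqrt.measurable.comp_aemeasurable this
  rw [nuA_ball n hn1 α R hα hR, omegaN_eq n hn1 R hR, ← nuA_zero]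
  rw [← nuA_zero] at hu hD
  unfold rearrR
  have hu' : AEMeasurable (fun x => ENNReal.ofReal |u x|) (nuA n 0 R) := by fun_prop
  have hD' : AEMeasurable (fun x => ENNReal.ofReal |DmLen m Du x|) (nuA n 0 R) := by fun_prop
  have hV0 := VnA_pos n hn1 0 R le_rfl hR
  have hVα := VnA_pos n hn1 α R hα hR
  set Xu := X.N (fun t => rearr (nuA n 0 R) (fun x => ENNReal.ofReal |u x|) (VnA n 0 R * t)) with hXu
  set XD := X.N (fun t => rearr (nuA n 0 R) (fun x => ENNReal.ofReal |DmLen m Du x|) (VnA n 0 R * t)) with hXD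
  set I := ∫⁻ y in Metric.ball (0 : Euc n) R,
          (ENNReal.ofReal |u y| + ENNReal.ofReal |DmLen m Du y|) with hI
  have hIle : I ≤ ENNReal.ofReal (VnA n 0 R) * C0 * (Xu + XD) := by
    rw [hI, ← nuA_zero, lintegral_add_left' hu', mul_add]
    exact add_le_add (hint _ _ hV0 (nuA_univ n hn1 0 R le_rfl hR) _ hu') (hint _ _ hV0 (nuA_univ n hn1 0 R le_rfl hR) _ hD')
  set f : ℝ → ℝ≥0∞ := fun τ => W (R * τ ^ ((n:ℝ)⁻¹)) with hf
  have hfm : Measurable f := hWm.comp (by fun_prop)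
  set h : ℝ → ℝ≥0∞ := fun t => ∫⁻ s in Set.Ioo (t ^ ((n : ℝ) / ((n : ℝ) + α))) 1,
              f s * ENNReal.ofReal (s ^ ((m : ℝ) / (n : ℝ) - 1)) with hh
  have hhm : Measurable h := (kern_anti _).measurable.comp (by fun_prop)
  have hnu : ∀ β, nuA n β R ≪ volume := fun β =>
    Measure.absolutelyContinuous_of_le Measure.restrict_le_self |>.trans (withDensity_absolutelyContinuous _ _)
  have hball : ∀ β, ∀ᵐ x ∂(nuA n β R), x ∈ Metric.ball (0 : Euc n) R := fun β => ae_restrict_mem measurableSet_ball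
  have h00 : ∀ᵐ x : Euc n, x ≠ 0 := by
    have : Nonempty (Fin n) := ⟨⟨0, hn1⟩⟩
    exact Measure.ae_ne volume 0
  have hfX : X.N f ≤ ((n : ℝ≥0) ^ m : ℝ≥0) * XD := by
    rw [← N_rearr_comp X (nuA n 0 R) (VnA n 0 R) hV0 (TnA n 0 R) (TnA_meas n 0 R) (map_TnA n hn1 0 R le_rfl hR) f hfm]
    apply N_rearr_smul
    filter_upwards [(hnu 0).ae_le hWa] with x hx
    refine le_trans (le_of_eq ?_) hx
    simp only [hf, TnA, add_zero]
    rw [Real.rpow_natCast, Real.pow_rpow_inv_natCast (by positivity) (by omega)]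
    congr 1
    field_simp
  have hpt : ∀ᵐ x ∂(nuA n α R), ENNReal.ofReal |u x| ≤ (fun t => C * I + K * h t) (TnA n α R x) := by
    filter_upwards [(hnu α).ae_le hWb, hball α, (hnu α).ae_le h00] with x hx hxb hx0
    have hxR : ‖x‖ < R := by simpa using hxb
    have hxp : 0 < ‖x‖ := norm_pos_iff.2 hx0
    refine (hx hxR).trans ?_
    gcongr
    refine (subst_le m n hm hn1 R ‖x‖ hR hxp W).trans (le_of_eq ?_)
    have : (TnA n α R x) ^ ((n : ℝ) / ((n : ℝ) + α)) = (‖x‖ / R) ^ n := by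
      rw [TnA, ← Real.rpow_mul (by positivity), mul_div_cancel₀ _ (by positivity), Real.rpow_natCast]
    simp only [hh, this, hK]
    rfl
  calc Y.N (fun t => rearr (nuA n α R) (fun x => ENNReal.ofReal |u x|) (VnA n α R * t))
      ≤ Y.N (fun t => rearr (nuA n α R) (fun x => (fun t => C * I + K * h t) (TnA n α R x)) (VnA n α R * t)) :=
        N_rearr_mono Y _ _ _ _ hpt
    _ = Y.N (fun t => C * I + K * h t) :=
        N_rearr_comp Y (nuA n α R) (VnA n α R) hVα (TnA n α R) (TnA_meas n α R) (map_TnA n hn1 α R hα hR)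
          (fun t => C * I + K * h t) (by fun_prop)
    _ ≤ Y.N (fun _ => C * I) + Y.N (fun t => K * h t) := Y.add_le (fun _ => C * I) (fun t => K * h t) measurable_const (by fun_prop)
    _ ≤ C * I * Y.N (fun _ => 1) + K * Y.N h := by
        rw [Y.smul_eq K h hhm]
        gcongr
        exact N_const_le Y _
    _ ≤ C * (ENNReal.ofReal (VnA n 0 R) * C0 * (Xu + XD)) * Y.N (fun _ => 1) +
        K * (ENNReal.ofReal CH * (((n : ℝ≥0) ^ m : ℝ≥0) * (Xu + XD))) := by
        gcongr
        refine (H f hfm).trans ?_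
        gcongr
        refine hfX.trans ?_
        gcongr
        exact le_add_self
    _ = A * (Xu + XD) := by rw [hA]; ring
    _ ≤ ENNReal.ofReal (A.toReal + 1) * (Xu + XD) := by
        gcongr
        rw [ENNReal.le_ofReal_iff_toReal_le hAt (by positivity)]
        linarith

/-- the reduction principle for the weighted Sobolev embedding
`W^m_R X(B_R) ↪ Y(B_R, ν_α)` of radially symmetric functions. -/
theorem reduction_principle_weighted_ball (m n : ℕ) (hm : 1 ≤ m) (hn : 2 ≤ n)
    (α R : ℝ) (hα : 0 ≤ α) (hR : 0 < R) (X Y : RINorm μU) :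
    (∃ CS : ℝ, 0 < CS ∧
        ∀ (u : Euc n → ℝ) (Du : (Fin n → ℕ) → Euc n → ℝ),
          (∀ x y : Euc n, ‖x‖ = ‖y‖ → u x = u y) →
          HasWeakDerivsOn (Metric.ball (0 : Euc n) R) m u Du →
          Y.N (fun t => rearrR (nuA n α R) u
              ((nuA n α R (Metric.ball (0 : Euc n) R)).toReal * t))
            ≤ ENNReal.ofReal CS *
                (X.N (fun t => rearrR (volume.restrict (Metric.ball (0 : Euc n) R)) u
                    (omegaN n * R ^ n * t)) +
                  X.N (fun t => rearrR (volume.restrict (Metric.ball (0 : Euc n) R))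
                    (DmLen m Du) (omegaN n * R ^ n * t))))
      ↔
      (∃ CH : ℝ, 0 < CH ∧
        ∀ f : ℝ → ℝ≥0∞, Measurable f →
          Y.N (fun t => ∫⁻ s in Set.Ioo (t ^ ((n : ℝ) / ((n : ℝ) + α))) 1,
              f s * ENNReal.ofReal (s ^ ((m : ℝ) / (n : ℝ) - 1)))
            ≤ ENNReal.ofReal CH * X.N f) := by
  exact ⟨fun ⟨CS, _, H⟩ => dir1 m n hm hn α R hα hR X Y CS H, fun ⟨CH, _, H⟩ => dir2 m n hm hn α R hα hR X Y CH H⟩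

end
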